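/- Assume the Riemann Hypothesis. Then for every ε ∈ (0, 1/100) and every δ > 0 there exists a constant K = K(ε, δ) > 0 such that for all real X ≥ 1 and all real H with 1 ≤ H ≤ X^{1 − ε}, one has (1/X) ∫_X^{2X} | ∑_{x < m ≤ x+H} μ²(m) − 6H/π² |² dx ≤ K · H^{1/2 + δ}. -/

import Mathlib

open MeasureTheory

/-- The number of squarefree integers `m` with `x < m ≤ x + H`. -/
noncomputable def sqfShort (x H : ℝ) : ℝ :=
  ∑ m ∈ Finset.Ioc ⌊x⌋₊ ⌊x + H⌋₊, if Squarefree m then (1 : ℝ) else 0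

section ZetaMellin
open Set Filter Topology Asymptotics

/-- The fractional part, cut off below `1`. -/
noncomputable def fractTail (x : ℝ) : ℂ := (Ioi (1 : ℝ)).indicator (fun t => ((Int.fract t : ℝ) : ℂ)) x

lemma measurable_fractTail : Measurable fractTail :=
  (Complex.measurable_ofReal.comp measurable_fract).indicator measurableSet_Ioi

lemma norm_fractTail_le (x : ℝ) : ‖fractTail x‖ ≤ 1 := by
  unfold fractTail
  by_cases h : x ∈ Ioi (1 : ℝ)
  · rw [indicator_of_mem h, Complex.norm_real, Real.norm_eq_abs, abs_of_nonneg (Int.fract_nonneg x)]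
    exact (Int.fract_lt_one x).le
  · rw [indicator_of_notMem h]; simp

lemma fractTail_locallyIntegrable : LocallyIntegrableOn fractTail (Ioi 0) := by
  apply LocallyIntegrable.locallyIntegrableOn
  refine (locallyIntegrable_const (1 : ℝ)).mono measurable_fractTail.aestronglyMeasurable ?_
  exact Eventually.of_forall fun x => by simpa using norm_fractTail_le x

lemma fractTail_isBigO_atTop : fractTail =O[atTop] (fun x : ℝ => x ^ (-(0 : ℝ))) := by
  refine IsBigO.of_bound 1 (Eventually.of_forall fun x => ?_)
  simpa using norm_fractTail_le x

lemma fractTail_isBigO_zero (b : ℝ) : fractTail =O[𝓝[>] 0] (fun x : ℝ => x ^ (-b)) := by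
  refine IsBigO.of_bound 1 ?_
  have : ∀ᶠ x : ℝ in 𝓝[>] 0, x < 1 := nhdsWithin_le_nhds (gt_mem_nhds one_pos)
  filter_upwards [this] with x hx
  have : fractTail x = 0 := by
    unfold fractTail; exact indicator_of_notMem (by simp [hx.le]) _
  rw [this]; simp

lemma mellinConvergent_fractTail {s : ℂ} (hs : 0 < s.re) : MellinConvergent fractTail (-s) :=
  mellinConvergent_of_isBigO_rpow fractTail_locallyIntegrable fractTail_isBigO_atTop
    (by simpa using hs) (fractTail_isBigO_zero (-s.re - 1)) (by simp)

lemma differentiableAt_mellin_fractTail {s : ℂ} (hs : 0 < s.re) :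
    DifferentiableAt ℂ (fun s => mellin fractTail (-s)) s := by
  have : DifferentiableAt ℂ (mellin fractTail) (-s) :=
    mellin_differentiableAt_of_isBigO_rpow fractTail_locallyIntegrable fractTail_isBigO_atTop
      (by simpa using hs) (fractTail_isBigO_zero (-s.re - 1)) (by simp)
  exact DifferentiableAt.comp (g := mellin fractTail) (f := fun s => -s) s this (differentiable_neg s)

lemma mellin_fractTail_eq (s : ℂ) :
    mellin fractTail (-s) = ∫ t in Ioi (1 : ℝ), (t : ℂ) ^ (-s - 1) * (Int.fract t : ℝ) := by
  have h : ∀ t : ℝ, (t : ℂ) ^ (-s - 1) • fractTail t =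
      (Ioi (1 : ℝ)).indicator (fun t : ℝ => (t : ℂ) ^ (-s - 1) * (Int.fract t : ℝ)) t := by
    intro t
    unfold fractTail
    by_cases h : t ∈ Ioi (1 : ℝ)
    · rw [indicator_of_mem h, indicator_of_mem h, smul_eq_mul]
    · rw [indicator_of_notMem h, indicator_of_notMem h, smul_zero]
  unfold mellin
  simp_rw [h]
  rw [setIntegral_indicator measurableSet_Ioi]
  congr 2
  ext x; simp only [mem_inter_iff, mem_Ioi]; constructor
  · exact fun h => h.2
  · exact fun h => ⟨by linarith, h⟩

lemma norm_mellin_fractTail_le {s : ℂ} (hs : 0 < s.re) : ‖mellin fractTail (-s)‖ ≤ 1 / s.re := by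
  rw [mellin_fractTail_eq]
  have hintg : IntegrableOn (fun t : ℝ => t ^ (-s.re - 1)) (Ioi 1) :=
    integrableOn_Ioi_rpow_of_lt (by linarith) one_pos
  refine (norm_integral_le_of_norm_le hintg ?_).trans ?_
  · filter_upwards [ae_restrict_mem measurableSet_Ioi] with t ht
    have ht0 : (0 : ℝ) < t := lt_trans one_pos ht
    rw [norm_mul, Complex.norm_cpow_eq_rpow_re_of_pos ht0, Complex.norm_real, Real.norm_eq_abs,
      abs_of_nonneg (Int.fract_nonneg t)]
    simp only [Complex.sub_re, Complex.neg_re, Complex.one_re]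
    exact mul_le_of_le_one_right (by positivity) (Int.fract_lt_one t).le
  · rw [integral_Ioi_rpow_of_lt (by linarith) one_pos]
    rw [Real.one_rpow, sub_add_cancel, neg_div_neg_eq]

lemma riemannZeta₁_eq_of_one_lt {s : ℂ} (hs : 1 < s.re) :
    riemannZeta₁ s = s - (s - 1) * s * mellin fractTail (-s) := by
  have hs1 : s ≠ 1 := by rintro rfl; simp at hs
  have hs1' : s - 1 ≠ 0 := sub_ne_zero.mpr hs1
  have h1 : riemannZeta s = s * ∫ t in Ioi (1 : ℝ), (⌊t⌋₊ : ℂ) * (t : ℂ) ^ (-(s + 1)) := by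
    rw [← LSeries_one_eq_riemannZeta hs]
    have := LSeries_eq_mul_integral_of_nonneg (fun _ => (1 : ℝ)) zero_le_one (s := s) hs
      (by
        refine IsBigO.of_bound 1 (Eventually.of_forall fun n => ?_)
        simp) (fun _ => zero_le_one)
    simpa [Pi.one_def] using this
  have h2 : ∫ t in Ioi (1 : ℝ), (⌊t⌋₊ : ℂ) * (t : ℂ) ^ (-(s + 1)) =
      (∫ t in Ioi (1 : ℝ), (t : ℂ) ^ (-s)) -
        ∫ t in Ioi (1 : ℝ), (t : ℂ) ^ (-s - 1) * (Int.fract t : ℝ) := by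
    rw [← integral_sub]
    · refine setIntegral_congr_fun measurableSet_Ioi fun t ht => ?_
      have ht0 : (0 : ℝ) < t := lt_trans one_pos ht
      have h3 : (t : ℂ) ^ (-s) = t * (t : ℂ) ^ (-s - 1) := by
        have ht0' : (t : ℂ) ≠ 0 := by exact_mod_cast ht0.ne'
        rw [Complex.cpow_sub _ _ ht0', Complex.cpow_one]
        field_simp
      have h4 : ((⌊t⌋₊ : ℝ) : ℂ) = t - (Int.fract t : ℝ) := by
        rw [← Complex.ofReal_sub, Int.self_sub_fract, natCast_floor_eq_intCast_floor ht0.le]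
      have h5 : (⌊t⌋₊ : ℂ) = t - (Int.fract t : ℝ) := by rw [← h4]; simp
      rw [h3, h5, show -(s + 1) = -s - 1 by ring]; ring
    · exact integrableOn_Ioi_cpow_of_lt (by simpa using hs) one_pos
    · have := mellinConvergent_fractTail (s := s) (by linarith)
      have h := this.mono_set (Ioi_subset_Ioi (zero_le_one' ℝ))
      refine h.congr_fun (fun t ht => ?_) measurableSet_Ioi
      simp only [fractTail, indicator_of_mem ht, smul_eq_mul]
  rw [integral_Ioi_cpow_of_lt (by simpa using hs) one_pos, ← mellin_fractTail_eq] at h2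
  have h6 := riemannZeta_eq_inv_sub_mul hs1
  have h7 : riemannZeta₁ s = (s - 1) * riemannZeta s := by rw [h6]; field_simp
  rw [h7, h1, h2]
  have h8 : -s + 1 ≠ 0 := by intro h; apply hs1'; linear_combination -h
  simp only [Complex.ofReal_one, Complex.one_cpow]
  field_simp
  ring

lemma riemannZeta₁_eq {s : ℂ} (hs : 0 < s.re) :
    riemannZeta₁ s = s - (s - 1) * s * mellin fractTail (-s) := by
  have hU : IsOpen {s : ℂ | 0 < s.re} := isOpen_lt continuous_const Complex.continuous_re
  refine AnalyticOnNhd.eqOn_of_preconnected_of_eventuallyEq (𝕜 := ℂ) (U := {s : ℂ | 0 < s.re})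
    (f := riemannZeta₁) (g := fun s => s - (s - 1) * s * mellin fractTail (-s)) (z₀ := 2)
    ?_ ?_ ?_ ?_ ?_ hs
  · exact differentiable_riemannZeta₁.differentiableOn.analyticOnNhd hU
  · refine DifferentiableOn.analyticOnNhd (fun z hz => ?_) hU
    have := differentiableAt_mellin_fractTail (s := z) hz
    apply DifferentiableAt.differentiableWithinAt
    fun_prop
  · exact (convex_halfSpace_re_gt 0).isPreconnected
  · simp
  · have : ∀ᶠ z : ℂ in 𝓝 2, 1 < z.re :=
      (isOpen_lt continuous_const Complex.continuous_re).mem_nhds (by simp)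
    filter_upwards [this] with z hz using riemannZeta₁_eq_of_one_lt hz

lemma norm_riemannZeta₁_le {s : ℂ} (hs : 0 < s.re) :
    ‖riemannZeta₁ s‖ ≤ ‖s‖ + ‖s - 1‖ * ‖s‖ * (1 / s.re) := by
  rw [riemannZeta₁_eq hs]
  refine (norm_sub_le _ _).trans ?_
  rw [norm_mul, norm_mul]
  gcongr
  exact norm_mellin_fractTail_le hs

/-- The fractional part as a complex valued function. -/
noncomputable def fractC (x : ℝ) : ℂ := ((Int.fract x : ℝ) : ℂ)

/-- For `0 < re s < 1`, the Mellin transform of the fractional part at `-s` is `-ζ(s)/s`. -/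
lemma hasMellin_fractC {s : ℂ} (hs : 0 < s.re) (hs1 : s.re < 1) :
    HasMellin fractC (-s) (-(riemannZeta s / s)) := by
  have hs0 : s ≠ 0 := by rintro rfl; simp at hs
  have hs1' : s ≠ 1 := by rintro rfl; simp at hs1
  have hne : s - 1 ≠ 0 := sub_ne_zero.mpr hs1'
  have hne2 : -s + 1 ≠ 0 := by intro h; apply hne; linear_combination -h
  have hA := hasMellin_cpow_Ioc 1 (s := -s) (by simpa using hs1)
  have hB := mellinConvergent_fractTail hs
  have h := hasMellin_add hA.1 hB
  rw [hA.2, riemannZeta_eq_inv_sub_mul hs1', ] at *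
  have hM : (1 / (-s + 1) + mellin fractTail (-s)) = -((s - 1)⁻¹ * riemannZeta₁ s / s) := by
    rw [riemannZeta₁_eq hs]; field_simp; ring
  rw [hM] at h
  have hae : ∀ᵐ t : ℝ ∂(volume.restrict (Ioi 0)),
      (Ioc (0:ℝ) 1).indicator (fun t : ℝ => (t : ℂ) ^ (1 : ℂ)) t + fractTail t = fractC t := by
    have h1 : ∀ᵐ t : ℝ ∂(volume.restrict (Ioi 0)), t ≠ 1 :=
      ae_restrict_of_ae (Measure.ae_ne volume 1)
    filter_upwards [ae_restrict_mem measurableSet_Ioi, h1] with t ht ht1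
    rcases lt_or_gt_of_ne ht1 with h | h
    · have : Int.fract t = t := Int.fract_eq_self.mpr ⟨le_of_lt ht, h⟩
      rw [indicator_of_mem (show t ∈ Ioc (0 : ℝ) 1 from ⟨ht, h.le⟩)]
      simp [fractTail, fractC, this, not_lt.mpr h.le]
    · rw [indicator_of_notMem (by simp [h])]
      simp [fractTail, fractC, h]
  refine ⟨?_, ?_⟩
  · refine h.1.congr ?_
    filter_upwards [hae] with t ht
    rw [ht]
  · rw [← h.2]
    unfold mellin
    refine integral_congr_ae ?_
    filter_upwards [hae] with t ht
    rw [ht]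

end ZetaMellin

section DiscBounds
open Set Filter Topology Metric

lemma exists_log_of_ne_zero_ball {f : ℂ → ℂ} {R : ℝ} (hR : 0 < R)
    (hf : DifferentiableOn ℂ f (ball 0 R)) (hne : ∀ z ∈ ball (0 : ℂ) R, f z ≠ 0) (h0 : f 0 = 1) :
    ∃ L : ℂ → ℂ, DifferentiableOn ℂ L (ball 0 R) ∧ L 0 = 0 ∧
      ∀ z ∈ ball (0 : ℂ) R, Complex.exp (L z) = f z := by
  have hd : DifferentiableOn ℂ (fun z => deriv f z / f z) (ball 0 R) :=
    (hf.deriv isOpen_ball).div hf hne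
  obtain ⟨g, hg⟩ := hd.isExactOn_ball
  have h0mem : (0 : ℂ) ∈ ball (0 : ℂ) R := mem_ball_self hR
  have hfd : ∀ z ∈ ball (0 : ℂ) R, HasDerivAt f (deriv f z) z := fun z hz =>
    ((hf z hz).differentiableAt (isOpen_ball.mem_nhds hz)).hasDerivAt
  have hconst : ∀ z ∈ ball (0 : ℂ) R, f z * Complex.exp (-(g z)) = Complex.exp (-(g 0)) := by
    intro z hz
    have hder : ∀ z ∈ ball (0 : ℂ) R, HasDerivAt (fun z => f z * Complex.exp (-(g z))) 0 z := by
      intro z hz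
      have := (hfd z hz).mul ((hg z hz).neg.cexp)
      refine HasDerivAt.congr_deriv this ?_
      have hz' := hne z hz
      have e : f z * (Complex.exp (-(g z)) * -(deriv f z / f z)) =
          -(Complex.exp (-(g z)) * deriv f z) := by field_simp
      change deriv f z * Complex.exp (-(g z)) + f z * (Complex.exp (-(g z)) * -(deriv f z / f z)) = 0
      rw [e]; ring
    have := (convex_ball (0 : ℂ) R).is_const_of_fderivWithin_eq_zero (𝕜 := ℂ)
      (f := fun z => f z * Complex.exp (-(g z)))
      (fun z hz => (hder z hz).differentiableAt.differentiableWithinAt)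
      (fun z hz => by
        rw [fderivWithin_of_isOpen isOpen_ball hz]
        have := (hder z hz).hasFDerivAt.fderiv
        rw [this]; ext; simp) hz h0mem
    rw [this, h0, one_mul]
  refine ⟨fun z => g z - g 0, ?_, by simp, fun z hz => ?_⟩
  · exact fun z hz => ((hg z hz).differentiableAt.sub_const _).differentiableWithinAt
  · have h := hconst z hz
    rw [Complex.exp_sub]
    rw [Complex.exp_neg, Complex.exp_neg] at h
    have e1 := Complex.exp_ne_zero (g z)
    have e2 := Complex.exp_ne_zero (g 0)
    field_simp at h ⊢
    rw [← h]

/-- Hadamard's three circles theorem. -/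
lemma norm_le_of_three_circles {f : ℂ → ℂ} {R r₁ r₃ A B : ℝ} (h1 : 0 < r₁) (h13 : r₁ < r₃)
    (h3 : r₃ < R) (hf : DifferentiableOn ℂ f (ball 0 R)) (hA : ∀ z : ℂ, ‖z‖ = r₁ → ‖f z‖ ≤ A)
    (hB : ∀ z : ℂ, ‖z‖ = r₃ → ‖f z‖ ≤ B) {z : ℂ} (hz1 : r₁ ≤ ‖z‖) (hz3 : ‖z‖ ≤ r₃) :
    ‖f z‖ ≤ A ^ (1 - (Real.log ‖z‖ - Real.log r₁) / (Real.log r₃ - Real.log r₁)) *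
      B ^ ((Real.log ‖z‖ - Real.log r₁) / (Real.log r₃ - Real.log r₁)) := by
  have hz0 : 0 < ‖z‖ := h1.trans_le hz1
  have hzne : z ≠ 0 := norm_pos_iff.mp hz0
  have hlog : Real.log r₁ < Real.log r₃ := Real.log_lt_log h1 h13
  have hr3 : 0 < r₃ := h1.trans h13
  have key : ∀ w : ℂ, w.re ≤ Real.log r₃ → Complex.exp w ∈ closedBall (0 : ℂ) r₃ := by
    intro w hw
    rw [mem_closedBall_zero_iff, Complex.norm_exp, ← Real.exp_log hr3]
    exact Real.exp_le_exp.mpr hw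
  have hsub : closedBall (0 : ℂ) r₃ ⊆ ball 0 R := closedBall_subset_ball h3
  have := Complex.HadamardThreeLines.norm_le_interp_of_mem_verticalClosedStrip'
    (f := fun w => f (Complex.exp w)) (z := Complex.log z) (a := A) (b := B) hlog
    ?_ ?_ ?_ ?_ ?_
  · simpa [Complex.exp_log hzne, Complex.log_re] using this
  · simp only [Complex.HadamardThreeLines.verticalClosedStrip, mem_preimage, Complex.log_re, mem_Icc]
    exact ⟨Real.log_le_log h1 hz1, Real.log_le_log hz0 hz3⟩
  · have hopen : IsOpen {w : ℂ | w.re < Real.log R} := isOpen_lt Complex.continuous_re continuous_const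
    have hR : 0 < R := hr3.trans h3
    have hd : DifferentiableOn ℂ (fun w => f (Complex.exp w)) {w : ℂ | w.re < Real.log R} := by
      refine hf.comp Complex.differentiable_exp.differentiableOn ?_
      intro w hw
      rw [mem_ball_zero_iff, Complex.norm_exp, ← Real.exp_log hR]
      exact Real.exp_lt_exp.mpr hw
    refine DifferentiableOn.diffContOnCl (hd.mono ?_)
    have : closure (Complex.HadamardThreeLines.verticalStrip (Real.log r₁) (Real.log r₃)) ⊆
        {w : ℂ | w.re ≤ Real.log r₃} := by
      refine closure_minimal ?_ (isClosed_le Complex.continuous_re continuous_const)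
      intro w hw; exact hw.2.le
    intro w hw
    exact lt_of_le_of_lt (this hw) (Real.log_lt_log hr3 h3)
  · have hc : IsCompact (closedBall (0 : ℂ) r₃) := isCompact_closedBall _ _
    have hb := hc.bddAbove_image (f := fun z => ‖f z‖) (hf.continuousOn.mono hsub).norm
    refine hb.mono ?_
    rintro _ ⟨w, hw, rfl⟩
    exact ⟨Complex.exp w, key w hw.2, rfl⟩
  · intro w hw
    apply hA
    rw [Complex.norm_exp, show w.re = Real.log r₁ from hw, Real.exp_log h1]
  · intro w hw
    apply hB
    rw [Complex.norm_exp, show w.re = Real.log r₃ from hw, Real.exp_log hr3]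

/-- A zero-free function on a disc that is bounded on a smaller concentric disc is bounded below by
a subpolynomial function of its maximum. -/
lemma norm_inv_le_of_ne_zero_ball {f : ℂ → ℂ} {R ρ r₁ r₂ r₃ M M₁ : ℝ} (h1 : 0 < r₁) (h1ρ : r₁ < ρ)
    (h12 : r₁ < r₂) (h23 : r₂ < r₃) (h3 : r₃ < R) (hρ : ρ ≤ R)
    (hf : DifferentiableOn ℂ f (ball 0 R)) (hne : ∀ z ∈ ball (0 : ℂ) R, f z ≠ 0) (h0 : f 0 = 1)
    (hM : 1 < M) (hM₁ : 1 < M₁) (hfM : ∀ z ∈ ball (0 : ℂ) R, ‖f z‖ ≤ M)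
    (hfM₁ : ∀ z ∈ ball (0 : ℂ) ρ, ‖f z‖ ≤ M₁) {z : ℂ} (hz : ‖z‖ ≤ r₂) :
    ‖(f z)⁻¹‖ ≤ Real.exp (max 1 (2 * Real.log M₁ * r₁ / (ρ - r₁)) *
      max 1 (2 * Real.log M * r₃ / (R - r₃)) ^
        ((Real.log r₂ - Real.log r₁) / (Real.log r₃ - Real.log r₁))) := by
  set A := max 1 (2 * Real.log M₁ * r₁ / (ρ - r₁)) with hA
  set B := max 1 (2 * Real.log M * r₃ / (R - r₃)) with hB
  set θ := (Real.log r₂ - Real.log r₁) / (Real.log r₃ - Real.log r₁) with hθ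
  have hA1 : 1 ≤ A := le_max_left _ _
  have hB1 : 1 ≤ B := le_max_left _ _
  have hR : 0 < R := by linarith
  obtain ⟨L, hL, hL0, hLe⟩ := exists_log_of_ne_zero_ball hR hf hne h0
  have hre : ∀ z ∈ ball (0 : ℂ) R, ∀ N : ℝ, 0 < N → ‖f z‖ ≤ N → (L z).re ≤ Real.log N := by
    intro z hz N hN h
    rw [← hLe z hz, Complex.norm_exp] at h
    rwa [Real.le_log_iff_exp_le hN]
  have hlog1 : 0 < Real.log M₁ := Real.log_pos hM₁
  have hlog : 0 < Real.log M := Real.log_pos hM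
  have hsub : ball (0 : ℂ) ρ ⊆ ball 0 R := ball_subset_ball hρ
  have bd1 : ∀ w : ℂ, ‖w‖ ≤ r₁ → ‖L w‖ ≤ A := by
    intro w hw
    have := Complex.borelCaratheodory_zero hlog1 (hL.mono hsub)
      (fun z hz => hre z (hsub hz) M₁ (by linarith) (hfM₁ z hz)) (h1.trans h1ρ)
      (z := w) (mem_ball_zero_iff.mpr (by linarith)) hL0
    refine this.trans (le_trans ?_ (le_max_right _ _))
    have : 0 < ρ - r₁ := by linarith
    gcongr
  have bd3 : ∀ w : ℂ, ‖w‖ ≤ r₃ → ‖L w‖ ≤ B := by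
    intro w hw
    have := Complex.borelCaratheodory_zero hlog hL
      (fun z hz => hre z hz M (by linarith) (hfM z hz)) hR
      (z := w) (mem_ball_zero_iff.mpr (by linarith)) hL0
    refine this.trans (le_trans ?_ (le_max_right _ _))
    have : 0 < R - r₃ := by linarith
    have hr3 : 0 < r₃ := by linarith
    have : 0 ≤ 2 * Real.log M * r₃ := by positivity
    gcongr
  have hl : 0 < Real.log r₃ - Real.log r₁ := by
    have := Real.log_lt_log h1 (h12.trans h23); linarith
  have hθ0 : 0 ≤ θ := div_nonneg (by have := Real.log_lt_log h1 h12; linarith) hl.le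
  have main : ‖L z‖ ≤ A * B ^ θ := by
    rcases le_total ‖z‖ r₁ with h | h
    · calc ‖L z‖ ≤ A := bd1 z h
        _ = A * 1 := by ring
        _ ≤ A * B ^ θ := by
          gcongr; exact Real.one_le_rpow hB1 hθ0
    · refine (norm_le_of_three_circles h1 (h12.trans h23) h3 hL (fun w hw => bd1 w hw.le)
        (fun w hw => bd3 w hw.le) h (by linarith)).trans ?_
      have hz0 : 0 < ‖z‖ := by linarith
      have hlz1 : Real.log r₁ ≤ Real.log ‖z‖ := Real.log_le_log h1 h
      have hlz2 : Real.log ‖z‖ ≤ Real.log r₂ := Real.log_le_log hz0 hz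
      have hq0 : 0 ≤ (Real.log ‖z‖ - Real.log r₁) / (Real.log r₃ - Real.log r₁) :=
        div_nonneg (by linarith) hl.le
      gcongr ?_ * ?_
      · calc A ^ (1 - (Real.log ‖z‖ - Real.log r₁) / (Real.log r₃ - Real.log r₁)) ≤ A ^ (1 : ℝ) :=
            Real.rpow_le_rpow_of_exponent_le hA1 (by linarith)
          _ = A := Real.rpow_one A
      · refine Real.rpow_le_rpow_of_exponent_le hB1 ?_
        rw [hθ]; gcongr
  have hzb : z ∈ ball (0 : ℂ) R := mem_ball_zero_iff.mpr (by linarith)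
  rw [← hLe z hzb, ← Complex.exp_neg, Complex.norm_exp]
  gcongr
  refine le_trans ?_ main
  refine le_trans (Complex.re_le_norm _) ?_
  rw [norm_neg]

end DiscBounds

section ZetaReciprocal
open Set Filter Topology Metric

lemma norm_LSeries_le_of_norm_le_one {f : ℕ → ℂ} (hf : ∀ n, ‖f n‖ ≤ 1) {σ : ℝ} (hσ : 1 < σ) {s : ℂ}
    (hs : σ ≤ s.re) : ‖LSeries f s‖ ≤ ∑' n : ℕ, 1 / (n : ℝ) ^ σ := by
  have hsum : Summable fun n : ℕ => 1 / (n : ℝ) ^ σ := Real.summable_one_div_nat_rpow.mpr hσ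
  refine tsum_of_norm_bounded hsum.hasSum fun n => ?_
  rw [LSeries.norm_term_eq]
  split_ifs with h
  · subst h; positivity
  · have hn : (1 : ℝ) ≤ n := by exact_mod_cast Nat.one_le_iff_ne_zero.mpr h
    gcongr
    exact hf n

lemma norm_riemannZeta_le_of_one_lt {σ : ℝ} (hσ : 1 < σ) {s : ℂ} (hs : σ ≤ s.re) :
    ‖riemannZeta s‖ ≤ ∑' n : ℕ, 1 / (n : ℝ) ^ σ := by
  rw [← LSeries_one_eq_riemannZeta (hσ.trans_le hs)]
  exact norm_LSeries_le_of_norm_le_one (by simp) hσ hs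

lemma norm_intCast_moebius_le_one (n : ℕ) : ‖((ArithmeticFunction.moebius n : ℤ) : ℂ)‖ ≤ 1 := by
  rw [Complex.norm_intCast]
  exact_mod_cast ArithmeticFunction.abs_moebius_le_one

lemma norm_inv_riemannZeta_le_of_one_lt {σ : ℝ} (hσ : 1 < σ) {s : ℂ} (hs : σ ≤ s.re) :
    ‖(riemannZeta s)⁻¹‖ ≤ ∑' n : ℕ, 1 / (n : ℝ) ^ σ := by
  have h := LSeries_one_mul_Lseries_moebius (hσ.trans_le hs)
  rw [LSeries_one_eq_riemannZeta (hσ.trans_le hs)] at h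
  rw [← eq_inv_of_mul_eq_one_right h]
  exact norm_LSeries_le_of_norm_le_one norm_intCast_moebius_le_one hσ hs

/-- The entire-at-one reciprocal of the zeta function. -/
noncomputable def invZeta (w : ℂ) : ℂ := (w - 1) / riemannZeta₁ w

lemma invZeta_eq {w : ℂ} (hw : w ≠ 1) : invZeta w = (riemannZeta w)⁻¹ := by
  rw [invZeta, riemannZeta_eq_inv_sub_mul hw, mul_inv, inv_inv, div_eq_mul_inv]

lemma riemannZeta_ne_zero_of_RH (hRH : RiemannHypothesis) {w : ℂ} (hw : 1 / 2 < w.re)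
    (h1 : w ≠ 1) : riemannZeta w ≠ 0 := by
  intro h
  have := hRH w h ?_ h1
  · linarith
  · rintro ⟨n, rfl⟩
    have : ((-2 : ℂ) * (n + 1)).re = -2 * (n + 1) := by simp
    rw [this] at hw
    have : (0 : ℝ) ≤ n := n.cast_nonneg
    linarith

lemma riemannZeta₁_ne_zero_of_RH (hRH : RiemannHypothesis) {w : ℂ} (hw : 1 / 2 < w.re) :
    riemannZeta₁ w ≠ 0 := by
  by_cases h1 : w = 1
  · simp [h1, riemannZeta₁_one]
  · have := riemannZeta_ne_zero_of_RH hRH hw h1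
    rw [riemannZeta_eq_inv_sub_mul h1] at this
    exact right_ne_zero_of_mul this

lemma differentiableAt_invZeta (hRH : RiemannHypothesis) {w : ℂ} (hw : 1 / 2 < w.re) :
    DifferentiableAt ℂ invZeta w :=
  (differentiableAt_id.sub_const 1).div differentiable_riemannZeta₁.differentiableAt
    (riemannZeta₁_ne_zero_of_RH hRH hw)

lemma norm_riemannZeta_le_of_half {w : ℂ} (hw : 1 / 2 < w.re) (h1 : 1 / 2 ≤ ‖w - 1‖) :
    ‖riemannZeta w‖ ≤ 4 * ‖w‖ := by
  have hne : w ≠ 1 := by rintro rfl; norm_num at h1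
  rw [riemannZeta_eq_inv_sub_mul hne, norm_mul, norm_inv]
  have h2 := norm_riemannZeta₁_le (s := w) (by linarith)
  have h3 : 1 / w.re ≤ 2 := by
    rw [div_le_iff₀ (by linarith)]; linarith
  have h4 : 0 < ‖w - 1‖ := by linarith
  rw [inv_mul_le_iff₀ h4]
  refine h2.trans ?_
  have : 0 ≤ ‖w‖ := norm_nonneg w
  have : ‖w - 1‖ * ‖w‖ * (1 / w.re) ≤ ‖w - 1‖ * ‖w‖ * 2 := by gcongr
  nlinarith

lemma exists_mul_rpow_le_add {A θ κ : ℝ} (hθ1 : θ < 1) (hκ : 0 < κ) :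
    ∃ C, ∀ y : ℝ, 1 ≤ y → A * y ^ θ ≤ κ * y + C := by
  obtain ⟨Y, hY⟩ := eventually_atTop.mp
    ((tendsto_rpow_atTop (sub_pos.mpr hθ1)).eventually_ge_atTop (A / κ))
  have hc : ContinuousOn (fun y : ℝ => A * y ^ θ) (Icc 1 (max 1 Y)) := by
    refine ContinuousOn.mul continuousOn_const ?_
    exact continuousOn_id.rpow_const fun y hy => Or.inl (by have := hy.1; simp only [id]; linarith)
  obtain ⟨C, hC⟩ := isCompact_Icc.bddAbove_image hc
  refine ⟨max C 0, fun y hy => ?_⟩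
  rcases le_total y (max 1 Y) with h' | h'
  · have : A * y ^ θ ≤ C := hC ⟨y, ⟨hy, h'⟩, rfl⟩
    have : 0 ≤ κ * y := by positivity
    have := le_max_left C 0
    linarith
  · have := hY y ((le_max_right _ _).trans h')
    rw [div_le_iff₀ hκ] at this
    have hy0 : 0 < y := by linarith
    have h2 : A * y ^ θ ≤ y ^ (1 - θ) * κ * y ^ θ := by gcongr
    have h3 : y ^ (1 - θ) * y ^ θ = y := by
      rw [← Real.rpow_add hy0, sub_add_cancel, Real.rpow_one]
    have h4 : y ^ (1 - θ) * κ * y ^ θ = κ * y := by linear_combination κ * h3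
    have := le_max_right C 0
    linarith

/-- Under the Riemann Hypothesis the reciprocal of zeta grows subpolynomially to the right of the
critical line. -/
lemma exists_norm_invZeta_le (hRH : RiemannHypothesis) {η ε : ℝ} (hη : 0 < η) (hη1 : η < 1)
    (hε : 0 < ε) :
    ∃ C : ℝ, 0 < C ∧ ∀ w : ℂ, 1 / 2 + η ≤ w.re → w.re ≤ 2 →
      ‖invZeta w‖ ≤ C * (1 + |w.im|) ^ ε := by
  set B₀ : ℝ := max 1 (∑' n : ℕ, 1 / (n : ℝ) ^ (2 : ℝ)) with hB₀
  set B₁ : ℝ := ∑' n : ℕ, 1 / (n : ℝ) ^ (5 / 4 : ℝ) with hB₁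
  have hB₀1 : 1 ≤ B₀ := le_max_left _ _
  have hB₁0 : 0 ≤ B₁ := tsum_nonneg fun n => by positivity
  set M₁ : ℝ := B₀ * B₁ + 2
  have hM₁ : 1 < M₁ := by have : 0 ≤ B₀ * B₁ := by positivity
                          simp only [M₁]; linarith
  set r₂ : ℝ := 3 / 2 - η
  set r₃ : ℝ := 3 / 2 - η / 2
  set θ : ℝ := (Real.log r₂ - Real.log (1 / 2)) / (Real.log r₃ - Real.log (1 / 2))
  have h12 : 1 / 2 < r₂ := by simp only [r₂]; linarith
  have h23 : r₂ < r₃ := by simp only [r₂, r₃]; linarith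
  have h3R : r₃ < 3 / 2 := by simp only [r₃]; linarith
  have hθ1 : θ < 1 := by
    have h1 := Real.log_lt_log (by norm_num) (h12.trans h23)
    have h2 := Real.log_lt_log (by linarith) h23
    rw [div_lt_one (by linarith)]; linarith
  set A : ℝ := max 1 (2 * Real.log M₁ * (1 / 2) / (3 / 4 - 1 / 2))
  have hA : 1 ≤ A := le_max_left _ _
  set κ : ℝ := 2 * r₃ / (3 / 2 - r₃)
  have hκ : 0 < κ := div_pos (by linarith) (by linarith)
  obtain ⟨C₁, hC₁⟩ := exists_mul_rpow_le_add (A := A) (θ := θ) (κ := ε / κ) hθ1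
    (by positivity)
  have hcpt : IsCompact (Icc (1 / 2 + η) 2 ×ℂ Icc (-2) 2) := isCompact_Icc.reProdIm isCompact_Icc
  have hcont : ContinuousOn (fun w => ‖invZeta w‖) (Icc (1 / 2 + η) 2 ×ℂ Icc (-2) 2) := by
    intro w hw
    refine (differentiableAt_invZeta hRH ?_).continuousAt.norm.continuousWithinAt
    have := hw.1.1; linarith
  obtain ⟨C₂, hC₂⟩ := hcpt.bddAbove_image hcont
  set C₃ := B₀ * Real.exp (ε / κ * (1 + κ * Real.log (14 * B₀)) + C₁)
  have hC₃ : 0 < C₃ := by positivity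
  refine ⟨C₃ + |C₂|, by positivity, fun w hw1 hw2 => ?_⟩
  have hT1 : 1 ≤ 1 + |w.im| := by have := abs_nonneg w.im; linarith
  have hTε : 1 ≤ (1 + |w.im|) ^ ε := Real.one_le_rpow hT1 hε.le
  rcases le_total |w.im| 2 with him | him
  · have : ‖invZeta w‖ ≤ C₂ := hC₂ ⟨w, ⟨⟨hw1, hw2⟩, abs_le.mp him⟩, rfl⟩
    calc ‖invZeta w‖ ≤ |C₂| := this.trans (le_abs_self _)
      _ ≤ (C₃ + |C₂|) * 1 := by linarith
      _ ≤ _ := by gcongr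
  · set c : ℂ := ⟨2, w.im⟩ with hc
    have hball : ∀ z ∈ ball (0 : ℂ) (3 / 2), 1 / 2 < (c + z).re ∧ 1 / 2 ≤ ‖c + z - 1‖ ∧
        ‖c + z‖ ≤ 7 / 2 + |w.im| := by
      intro z hz
      rw [mem_ball_zero_iff] at hz
      have h1 := abs_lt.mp ((Complex.abs_re_le_norm z).trans_lt hz)
      have h2 := abs_lt.mp ((Complex.abs_im_le_norm z).trans_lt hz)
      refine ⟨by simp [hc]; linarith, ?_, ?_⟩
      · have h3 := Complex.abs_im_le_norm (c + z - 1)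
        have h4 : (c + z - 1).im = w.im + z.im := by simp [hc]
        rw [h4] at h3
        have h5 := abs_sub_abs_le_abs_sub w.im (-z.im)
        rw [abs_neg, sub_neg_eq_add] at h5
        have := (Complex.abs_im_le_norm z).trans_lt hz
        linarith
      · have h3 : ‖c‖ ≤ |c.re| + |c.im| := Complex.norm_le_abs_re_add_abs_im c
        have h4 : |c.re| + |c.im| = 2 + |w.im| := by simp [hc]
        have := norm_add_le c z
        linarith
    have hne1 : ∀ z ∈ ball (0 : ℂ) (3 / 2), c + z ≠ 1 := by
      intro z hz h
      have := (hball z hz).2.1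
      rw [h] at this; norm_num at this
    have hcinv : ‖(riemannZeta c)⁻¹‖ ≤ B₀ :=
      (norm_inv_riemannZeta_le_of_one_lt (σ := 2) (by norm_num) (by simp [hc])).trans
        (le_max_right _ _)
    have hcne : riemannZeta c ≠ 0 := riemannZeta_ne_zero_of_one_lt_re (by simp [hc])
    set f : ℂ → ℂ := fun z => riemannZeta (c + z) * (riemannZeta c)⁻¹ with hf
    have hmain := norm_inv_le_of_ne_zero_ball (f := f) (R := 3 / 2) (ρ := 3 / 4) (r₁ := 1 / 2)
      (r₂ := r₂) (r₃ := r₃) (M := 14 * B₀ * (1 + |w.im|)) (M₁ := M₁) (by norm_num) (by norm_num)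
      h12 h23 h3R (by norm_num) ?_ ?_ ?_ ?_ hM₁ ?_ ?_ (z := w - c) ?_
    · have hw : w ≠ 1 := by rintro rfl; norm_num at him
      have e1 : invZeta w = (f (w - c))⁻¹ * (riemannZeta c)⁻¹ := by
        rw [invZeta_eq hw, hf]
        simp only [add_sub_cancel]
        rw [mul_inv, inv_inv, mul_assoc, mul_inv_cancel₀ hcne, mul_one]
      rw [e1, norm_mul]
      set y := max 1 (2 * Real.log (14 * B₀ * (1 + |w.im|)) * r₃ / (3 / 2 - r₃)) with hy
      have hy1 : 1 ≤ y := le_max_left _ _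
      have hlogM : Real.log (14 * B₀ * (1 + |w.im|)) = Real.log (14 * B₀) + Real.log (1 + |w.im|) :=
        Real.log_mul (by positivity) (by positivity)
      have hlog0 : 0 ≤ Real.log (14 * B₀ * (1 + |w.im|)) := Real.log_nonneg (by nlinarith)
      have hy2 : y ≤ 1 + κ * (Real.log (14 * B₀) + Real.log (1 + |w.im|)) := by
        rw [← hlogM]
        have e : 2 * Real.log (14 * B₀ * (1 + |w.im|)) * r₃ / (3 / 2 - r₃) =
          κ * Real.log (14 * B₀ * (1 + |w.im|)) := by simp only [κ]; ring
        rw [hy, e]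
        have : 0 ≤ κ * Real.log (14 * B₀ * (1 + |w.im|)) := by positivity
        exact max_le (by linarith) (by linarith)
      have hexp : A * y ^ θ ≤ ε / κ * (1 + κ * Real.log (14 * B₀)) + C₁ +
          ε * Real.log (1 + |w.im|) := by
        refine (hC₁ y hy1).trans ?_
        have : ε / κ * y ≤ ε / κ * (1 + κ * (Real.log (14 * B₀) + Real.log (1 + |w.im|))) := by
          gcongr
        have e : ε / κ * (1 + κ * (Real.log (14 * B₀) + Real.log (1 + |w.im|))) =
          ε / κ * (1 + κ * Real.log (14 * B₀)) + ε * Real.log (1 + |w.im|) := by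
          field_simp; ring
        linarith
      have hfin : ‖(f (w - c))⁻¹‖ ≤ Real.exp (ε / κ * (1 + κ * Real.log (14 * B₀)) + C₁) *
          (1 + |w.im|) ^ ε := by
        refine hmain.trans ?_
        rw [Real.rpow_def_of_pos (show 0 < 1 + |w.im| by linarith), ← Real.exp_add]
        apply Real.exp_le_exp.mpr
        exact hexp.trans_eq (by ring)
      calc ‖(f (w - c))⁻¹‖ * ‖(riemannZeta c)⁻¹‖ ≤ (Real.exp (ε / κ * (1 + κ * Real.log (14 * B₀)) + C₁) *
          (1 + |w.im|) ^ ε) * B₀ := by gcongr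
        _ = C₃ * (1 + |w.im|) ^ ε := by simp only [C₃]; ring
        _ ≤ _ := by gcongr; have := abs_nonneg C₂; linarith
    · intro z hz
      refine DifferentiableAt.differentiableWithinAt ?_
      refine DifferentiableAt.mul_const ?_ _
      exact (differentiableAt_riemannZeta (hne1 z hz)).comp z (differentiableAt_id.const_add c)
    · intro z hz
      exact mul_ne_zero (riemannZeta_ne_zero_of_RH hRH (hball z hz).1 (hne1 z hz)) (inv_ne_zero hcne)
    · simp [hf, hcne]
    · have : 1 ≤ B₀ * (1 + |w.im|) := one_le_mul_of_one_le_of_one_le hB₀1 hT1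
      linarith
    · intro z hz
      obtain ⟨h1, h2, h3⟩ := hball z hz
      rw [hf]; simp only [norm_mul]
      calc ‖riemannZeta (c + z)‖ * ‖(riemannZeta c)⁻¹‖ ≤ (4 * ‖c + z‖) * B₀ := by
            gcongr; exact norm_riemannZeta_le_of_half h1 h2
        _ ≤ (4 * (7 / 2 + |w.im|)) * B₀ := by gcongr
        _ ≤ (14 * (1 + |w.im|)) * B₀ := by
          gcongr ?_ * _; have := abs_nonneg w.im; linarith
        _ = _ := by ring
    · intro z hz
      rw [mem_ball_zero_iff] at hz
      have h1 := abs_lt.mp ((Complex.abs_re_le_norm z).trans_lt hz)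
      rw [hf]; simp only [norm_mul]
      calc ‖riemannZeta (c + z)‖ * ‖(riemannZeta c)⁻¹‖ ≤ B₁ * B₀ := by
            gcongr
            exact norm_riemannZeta_le_of_one_lt (by norm_num) (by simp [hc]; linarith)
        _ ≤ M₁ := by simp only [M₁]; linarith
    · have : w - c = ((w.re - 2 : ℝ) : ℂ) := by
        apply Complex.ext <;> simp [hc]
      rw [this, Complex.norm_real, Real.norm_eq_abs, abs_of_nonpos (by linarith)]
      simp only [r₂]; linarith

end ZetaReciprocal

section RieszMean
open Set Filter Topology

/-- Moving a vertical line of integration across a strip. -/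
lemma integral_vertical_eq {f : ℂ → ℂ} {a b C r : ℝ} (hab : a ≤ b) (hr : 1 < r)
    (hf : ∀ z : ℂ, a ≤ z.re → z.re ≤ b → DifferentiableAt ℂ f z)
    (hbd : ∀ z : ℂ, a ≤ z.re → z.re ≤ b → ‖f z‖ ≤ C * (1 + |z.im|) ^ (-r)) :
    ∫ t : ℝ, f (a + t * Complex.I) = ∫ t : ℝ, f (b + t * Complex.I) := by
  have hintg : ∀ c : ℝ, a ≤ c → c ≤ b → Integrable fun t : ℝ => f (c + t * Complex.I) := by
    intro c h1 h2
    have hg : Integrable fun t : ℝ => C * (1 + ‖t‖) ^ (-r) :=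
      (integrable_one_add_norm (by simpa using hr)).const_mul C
    refine hg.mono' (Continuous.aestronglyMeasurable ?_) (ae_of_all _ fun t => ?_)
    · refine continuous_iff_continuousAt.mpr fun t => ?_
      refine ContinuousAt.comp (f := fun t : ℝ => (c : ℂ) + t * Complex.I)
        (hf _ (by simpa using h1) (by simpa using h2)).continuousAt ?_
      fun_prop
    · simpa using hbd (c + t * Complex.I) (by simpa using h1) (by simpa using h2)
  have hlim : ∀ c : ℝ, a ≤ c → c ≤ b → Tendsto (fun T : ℝ => ∫ t in (-T)..T, f (c + t * Complex.I))
      atTop (𝓝 (∫ t : ℝ, f (c + t * Complex.I))) := fun c h1 h2 =>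
    intervalIntegral_tendsto_integral (hintg c h1 h2) tendsto_neg_atTop_atBot tendsto_id
  have hdecay : Tendsto (fun T : ℝ => C * (1 + T) ^ (-r) * |b - a|) atTop (𝓝 0) := by
    have := (tendsto_rpow_neg_atTop (show 0 < r by linarith)).comp
      (tendsto_atTop_add_const_left atTop (1 : ℝ) tendsto_id)
    simpa using (this.const_mul C).mul_const |b - a|
  have hhor : ∀ s : ℝ, |s| = 1 → Tendsto (fun T : ℝ => ∫ x in a..b, f (x + (s * T : ℝ) * Complex.I)) atTop (𝓝 0) := by
    intro s hs
    refine squeeze_zero_norm' ?_ hdecay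
    filter_upwards [eventually_ge_atTop 0] with T hT
    refine intervalIntegral.norm_integral_le_of_norm_le_const fun x hx => ?_
    rw [uIoc_of_le hab] at hx
    have := hbd (x + (s * T : ℝ) * Complex.I) (by simpa using hx.1.le) (by simpa using hx.2)
    refine this.trans_eq ?_
    have e : ((x : ℂ) + (s * T : ℝ) * Complex.I).im = s * T := by simp
    rw [e, abs_mul, hs, abs_of_nonneg hT, one_mul]
  have hrect : ∀ T : ℝ, 0 ≤ T → (∫ t in (-T)..T, f (b + t * Complex.I)) -
      (∫ t in (-T)..T, f (a + t * Complex.I)) = Complex.I * ((∫ x in a..b, f (x + ((-1) * T : ℝ) * Complex.I)) -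
        ∫ x in a..b, f (x + (1 * T : ℝ) * Complex.I)) := by
    intro T hT
    have := Complex.integral_boundary_rect_eq_zero_of_differentiableOn f ⟨a, -T⟩ ⟨b, T⟩ ?_
    · simp only [smul_eq_mul] at this
      rw [neg_one_mul, one_mul]
      linear_combination (-Complex.I) * this + ((∫ t in (-T)..T, f (b + t * Complex.I)) -
        (∫ t in (-T)..T, f (a + t * Complex.I))) * (Complex.I_sq)
    · intro z hz
      have h1 := hz.1
      simp only [mem_preimage, uIcc_of_le hab] at h1
      exact (hf z h1.1 h1.2).differentiableWithinAt
  have hz : Tendsto (fun T : ℝ => (∫ t in (-T)..T, f (b + t * Complex.I)) -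
      (∫ t in (-T)..T, f (a + t * Complex.I))) atTop (𝓝 0) := by
    have h := ((hhor (-1) (by simp)).sub (hhor 1 (by simp))).const_mul Complex.I
    simp only [sub_zero, mul_zero] at h
    refine h.congr' ?_
    filter_upwards [eventually_ge_atTop 0] with T hT
    exact (hrect T hT).symm
  have := tendsto_nhds_unique hz ((hlim b hab le_rfl).sub (hlim a le_rfl hab))
  exact (sub_eq_zero.mp this.symm).symm

lemma hasMellin_max_one_sub {s : ℂ} (hs : 0 < s.re) :
    HasMellin (fun x : ℝ => ((max 0 (1 - x) : ℝ) : ℂ)) s (1 / (s * (s + 1))) := by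
  have h1 := hasMellin_one_Ioc hs
  have h2 := hasMellin_cpow_Ioc 1 (s := s) (by simp; linarith)
  have h3 := hasMellin_sub h1.1 h2.1
  rw [h1.2, h2.2] at h3
  have hcongr : ∀ x ∈ Ioi (0 : ℝ), (fun t : ℝ => (Ioc (0 : ℝ) 1).indicator (fun _ => (1 : ℂ)) t -
      (Ioc (0 : ℝ) 1).indicator (fun t : ℝ => (t : ℂ) ^ (1 : ℂ)) t) x =
      ((max 0 (1 - x) : ℝ) : ℂ) := by
    intro x hx
    simp only [indicator, mem_Ioc, mem_Ioi] at *
    by_cases h : x ≤ 1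
    · simp [hx, h]
    · have : 1 - x ≤ 0 := by linarith
      simp [hx, h, this]
  have hs0 : s ≠ 0 := by rintro rfl; simp at hs
  have hs1 : s + 1 ≠ 0 := by
    intro h; have := congrArg Complex.re h; simp at this; linarith
  refine ⟨?_, ?_⟩
  · refine (integrableOn_congr_fun (fun x hx => ?_) measurableSet_Ioi).mp h3.1
    exact congrArg (fun y : ℂ => (x : ℂ) ^ (s - 1) • y) (hcongr x hx)
  · rw [← show (1 : ℂ) / s - 1 / (s + 1) = 1 / (s * (s + 1)) by field_simp; ring, ← h3.2]
    refine setIntegral_congr_fun measurableSet_Ioi fun x hx => ?_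
    exact (congrArg (fun y : ℂ => (x : ℂ) ^ (s - 1) • y) (hcongr x hx)).symm

lemma norm_le_one_add_norm {z : ℂ} (hz : 0 < z.re) : ‖z‖ ≤ ‖z + 1‖ := by
  rw [Complex.norm_def, Complex.norm_def]
  apply Real.sqrt_le_sqrt
  simp only [Complex.normSq_apply, Complex.add_re, Complex.one_re, Complex.add_im, Complex.one_im]
  nlinarith

lemma norm_riesz_kernel_le {σ : ℝ} (h0 : 0 < σ) (h1 : σ ≤ 1) {z : ℂ} (hz : σ ≤ z.re) :
    ‖1 / (z * (z + 1))‖ ≤ 2 / σ ^ 2 * (1 + |z.im|) ^ (-2 : ℝ) := by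
  have hz0 : 0 < z.re := h0.trans_le hz
  have h2 := norm_le_one_add_norm hz0
  have hn : 0 < ‖z‖ := hz0.trans_le (Complex.re_le_norm z)
  have hn1 : 0 < ‖z + 1‖ := hn.trans_le h2
  have hsq : ‖z‖ ^ 2 = z.re ^ 2 + z.im ^ 2 := by
    rw [← Complex.normSq_eq_norm_sq, Complex.normSq_apply]; ring
  have habs := abs_nonneg z.im
  rw [norm_div, norm_one, norm_mul, Real.rpow_neg (by positivity), Real.rpow_two,
    div_mul_eq_mul_div, ← div_eq_mul_inv, div_div,
    div_le_div_iff₀ (by positivity) (by positivity), one_mul]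
  have h3 : (1 + |z.im|) ^ 2 ≤ 2 * (1 + z.im ^ 2) := by
    nlinarith [sq_abs z.im, sq_nonneg (1 - |z.im|)]
  have h4 : σ ^ 2 * (1 + z.im ^ 2) ≤ ‖z‖ ^ 2 := by
    rw [hsq]
    have : σ ^ 2 ≤ z.re ^ 2 := by gcongr
    have : σ ^ 2 ≤ 1 := by nlinarith
    nlinarith [sq_nonneg z.im]
  have h5 : ‖z‖ ^ 2 ≤ ‖z‖ * ‖z + 1‖ := by rw [sq]; gcongr
  nlinarith [sq_nonneg σ]

lemma integrable_riesz_kernel {σ : ℝ} (h0 : 0 < σ) (h1 : σ ≤ 1) :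
    Integrable fun t : ℝ => 1 / (((σ : ℂ) + t * Complex.I) * (σ + t * Complex.I + 1)) := by
  have hg : Integrable fun t : ℝ => 2 / σ ^ 2 * (1 + ‖t‖) ^ (-2 : ℝ) :=
    (integrable_one_add_norm (by simp)).const_mul _
  refine hg.mono' (Continuous.aestronglyMeasurable ?_) (ae_of_all _ fun t => ?_)
  · refine Continuous.div (by fun_prop) (by fun_prop) fun t => ?_
    refine mul_ne_zero ?_ ?_
    · intro h; have := congrArg Complex.re h; simp at this; linarith
    · intro h; have := congrArg Complex.re h; simp at this; linarith
  · have := norm_riesz_kernel_le h0 h1 (z := σ + t * Complex.I) (by simp)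
    simpa using this

lemma integral_riesz_kernel {σ x : ℝ} (h0 : 0 < σ) (h1 : σ ≤ 1) (hx : 0 < x) :
    ∫ t : ℝ, (x : ℂ) ^ (-((σ : ℂ) + t * Complex.I)) *
      (1 / (((σ : ℂ) + t * Complex.I) * (σ + t * Complex.I + 1))) =
      2 * Real.pi * (max 0 (1 - x) : ℝ) := by
  have hM : ∀ t : ℝ, mellin (fun x : ℝ => ((max 0 (1 - x) : ℝ) : ℂ)) (σ + t * Complex.I) =
      1 / (((σ : ℂ) + t * Complex.I) * (σ + t * Complex.I + 1)) :=
    fun t => (hasMellin_max_one_sub (by simpa using h0)).2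
  have := mellinInv_mellin_eq σ (fun x : ℝ => ((max 0 (1 - x) : ℝ) : ℂ)) hx
    (hasMellin_max_one_sub (by simpa using h0)).1 ?_ ?_
  · rw [mellinInv] at this
    simp only [hM, smul_eq_mul, Complex.real_smul] at this
    rw [← this, ← mul_assoc]
    have hpi : (Real.pi : ℂ) ≠ 0 := by exact_mod_cast Real.pi_ne_zero
    have : 2 * (Real.pi : ℂ) * ((1 / (2 * Real.pi) : ℝ) : ℂ) = 1 := by
      push_cast; field_simp
    rw [this, one_mul]
  · rw [Complex.VerticalIntegrable]
    simp only [hM]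
    exact integrable_riesz_kernel h0 h1
  · fun_prop

/-- The Riesz mean of the Dirichlet polynomial of the Möbius function. -/
noncomputable def rieszMoebius (N : ℕ) (w : ℂ) : ℂ :=
  ∑ d ∈ Finset.Icc 1 N, (ArithmeticFunction.moebius d : ℂ) * ((1 - (d : ℝ) / N : ℝ) : ℂ) *
    (d : ℂ) ^ (-w)

lemma rieszMoebius_eq_integral {N : ℕ} (hN : 1 ≤ N) {w : ℂ} (hw : 0 < w.re) :
    ∫ t : ℝ, (N : ℂ) ^ ((1 : ℝ) + t * Complex.I) * invZeta (w + ((1 : ℝ) + t * Complex.I)) *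
      (1 / ((((1 : ℝ) : ℂ) + t * Complex.I) * ((1 : ℝ) + t * Complex.I + 1))) =
      2 * Real.pi * rieszMoebius N w := by
  set k : ℝ → ℂ := fun t => 1 / ((((1 : ℝ) : ℂ) + t * Complex.I) * ((1 : ℝ) + t * Complex.I + 1))
    with hk
  have hN0 : (0 : ℝ) < N := by exact_mod_cast hN
  have hNc : (N : ℂ) ≠ 0 := by exact_mod_cast hN0.ne'
  have hkint : Integrable k := integrable_riesz_kernel one_pos le_rfl
  set F : ℕ → ℝ → ℂ := fun d t => if d = 0 then 0 else
    (ArithmeticFunction.moebius d : ℂ) * (d : ℂ) ^ (-w) *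
    ((((d : ℝ) / N : ℝ) : ℂ) ^ (-((1 : ℝ) + t * Complex.I)) * k t) with hF
  have hnorm : ∀ d t, ‖F d t‖ ≤ N / (d : ℝ) ^ (1 + w.re) * ‖k t‖ := by
    intro d t
    simp only [hF]
    split_ifs with h
    · rw [norm_zero]; positivity
    · have hd : (0 : ℝ) < d := by exact_mod_cast Nat.pos_of_ne_zero h
      have e1 : ‖(d : ℂ) ^ (-w)‖ = (d : ℝ) ^ (-w.re) := by
        rw [← Complex.ofReal_natCast, Complex.norm_cpow_eq_rpow_re_of_pos hd, Complex.neg_re]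
      have e2 : ‖(((d : ℝ) / N : ℝ) : ℂ) ^ (-((1 : ℝ) + t * Complex.I))‖ = N / d := by
        rw [Complex.norm_cpow_eq_rpow_re_of_pos (by positivity)]
        simp [Real.rpow_neg_one]
      rw [norm_mul, norm_mul, norm_mul, e1, e2]
      calc ‖(ArithmeticFunction.moebius d : ℂ)‖ * (d : ℝ) ^ (-w.re) * (N / d * ‖k t‖) ≤
          1 * (d : ℝ) ^ (-w.re) * (N / d * ‖k t‖) := by
            gcongr; exact norm_intCast_moebius_le_one d
        _ = _ := by
          rw [Real.rpow_add hd, Real.rpow_neg hd.le, Real.rpow_one]; field_simp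
  have hmeas : ∀ d, Integrable (F d) := by
    intro d
    by_cases h : d = 0
    · simp [hF, h]
    · refine (hkint.norm.const_mul (N / (d : ℝ) ^ (1 + w.re))).mono' ?_ (ae_of_all _ (hnorm d))
      simp only [hF, h, if_false]
      refine AEStronglyMeasurable.const_mul (AEStronglyMeasurable.mul ?_ hkint.1) _
      refine Continuous.aestronglyMeasurable ?_
      have : (((d : ℝ) / N : ℝ) : ℂ) ≠ 0 := by
        have : (0 : ℝ) < d := by exact_mod_cast Nat.pos_of_ne_zero h
        exact_mod_cast (by positivity : (d : ℝ) / N ≠ 0)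
      exact Continuous.const_cpow (by fun_prop) (Or.inl this)
  have hsum : Summable fun d => ∫ t, ‖F d t‖ := by
    have h1 : Summable fun d : ℕ => (N : ℝ) * (1 / (d : ℝ) ^ (1 + w.re)) * ∫ t, ‖k t‖ :=
      ((Real.summable_one_div_nat_rpow.mpr (by linarith)).mul_left _).mul_right _
    refine Summable.of_nonneg_of_le (fun d => integral_nonneg fun t => norm_nonneg _) (fun d => ?_) h1
    rw [← integral_const_mul]
    refine integral_mono (hmeas d).norm (hkint.norm.const_mul _) fun t => ?_
    exact (hnorm d t).trans_eq (by rw [mul_one_div])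
  have hintg := hasSum_integral_of_summable_integral_norm hmeas hsum
  have hval : ∀ d, ∫ t, F d t = if d ∈ Finset.Icc 1 N then 2 * Real.pi *
      ((ArithmeticFunction.moebius d : ℂ) * ((1 - (d : ℝ) / N : ℝ) : ℂ) * (d : ℂ) ^ (-w)) else 0 := by
    intro d
    by_cases h : d = 0
    · simp [hF, h]
    · have hd : (0 : ℝ) < d := by exact_mod_cast Nat.pos_of_ne_zero h
      have h1 : 1 ≤ d := Nat.one_le_iff_ne_zero.mpr h
      simp only [hF, h, if_false]
      rw [integral_const_mul, hk, integral_riesz_kernel one_pos le_rfl (by positivity)]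
      by_cases h2 : d ≤ N
      · have : (d : ℝ) / N ≤ 1 := by rw [div_le_one hN0]; exact_mod_cast h2
        rw [max_eq_right (by linarith), if_pos (Finset.mem_Icc.mpr ⟨h1, h2⟩)]
        ring
      · have : 1 ≤ (d : ℝ) / N := by rw [one_le_div hN0]; exact_mod_cast (not_le.mp h2).le
        rw [max_eq_left (by linarith), if_neg (fun h3 => h2 (Finset.mem_Icc.mp h3).2)]
        simp
  have htsum : ∀ t : ℝ, ∑' d, F d t = (N : ℂ) ^ ((1 : ℝ) + t * Complex.I) *
      invZeta (w + ((1 : ℝ) + t * Complex.I)) * k t := by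
    intro t
    set z : ℂ := (1 : ℝ) + t * Complex.I with hz
    have hre : 1 < (w + z).re := by simp [hz]; exact hw
    have hne : w + z ≠ 1 := by intro h; rw [h] at hre; simp at hre
    have hL : invZeta (w + z) = LSeries (fun n => (ArithmeticFunction.moebius n : ℂ)) (w + z) := by
      rw [invZeta_eq hne]
      have h := LSeries_one_mul_Lseries_moebius hre
      rw [LSeries_one_eq_riemannZeta hre] at h
      exact (eq_inv_of_mul_eq_one_right h).symm
    rw [hL, LSeries, ← tsum_mul_left, ← tsum_mul_right]
    refine tsum_congr fun d => ?_
    rw [LSeries.term_def]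
    simp only [hF, ← hz]
    clear_value z
    split_ifs with h
    · simp
    · have hd : (0 : ℝ) < d := by exact_mod_cast Nat.pos_of_ne_zero h
      have hdc : (d : ℂ) ≠ 0 := by exact_mod_cast h
      have e1 : (((d : ℝ) / N : ℝ) : ℂ) ^ (-z) = (d : ℂ) ^ (-z) * (N : ℂ) ^ z := by
        rw [div_eq_mul_inv, Complex.ofReal_mul, Complex.mul_cpow_ofReal_nonneg hd.le (by positivity),
          Complex.ofReal_inv, Complex.inv_cpow_ofReal_nonneg hN0.le, Complex.cpow_neg]
        simp [Complex.cpow_neg]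
      rw [e1, Complex.cpow_neg, Complex.cpow_neg, Complex.cpow_add _ _ hdc]
      field_simp
  rw [← integral_congr_ae (ae_of_all _ htsum), ← hintg.tsum_eq]
  simp only [hval]
  rw [tsum_eq_sum (s := Finset.Icc 1 N) (fun d hd => by rw [if_neg hd]), rieszMoebius,
    Finset.mul_sum]
  exact Finset.sum_congr rfl fun d hd => by rw [if_pos hd]

/-- Under the Riemann Hypothesis, Riesz means of the Möbius Dirichlet polynomial are small just to the
right of the critical line. -/
lemma exists_norm_rieszMoebius_le (hRH : RiemannHypothesis) {η ε κ : ℝ} (hη : 0 < η)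
    (hη1 : η ≤ 1 / 2) (hε : 0 < ε) (hε1 : ε < 1) (hκ : 0 < κ) (hκ1 : κ ≤ 1) :
    ∃ C : ℝ, 0 < C ∧ ∀ N : ℕ, 1 ≤ N → ∀ w : ℂ, w.re = 1 / 2 + η →
      ‖rieszMoebius N w‖ ≤ C * (N : ℝ) ^ κ * (1 + |w.im|) ^ ε := by
  obtain ⟨C₁, hC₁, hbd⟩ := exists_norm_invZeta_le hRH hη (by linarith) hε
  have hJ : Integrable fun t : ℝ => (1 + ‖t‖) ^ (-(2 - ε)) :=
    integrable_one_add_norm (by simp; linarith)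
  set J := ∫ t : ℝ, (1 + ‖t‖) ^ (-(2 - ε)) with hJdef
  have hJ0 : 0 ≤ J := integral_nonneg fun t => by positivity
  refine ⟨C₁ * (2 / κ ^ 2) * J + 1, by positivity, fun N hN w hw => ?_⟩
  have hN1 : (1 : ℝ) ≤ N := by exact_mod_cast hN
  have hN0 : (0 : ℝ) < N := by linarith
  set G : ℂ → ℂ := fun z => (N : ℂ) ^ z * invZeta (w + z) * (1 / (z * (z + 1))) with hG
  have hGbd : ∀ z : ℂ, κ ≤ z.re → z.re ≤ 1 → ‖G z‖ ≤
      (N : ℝ) ^ z.re * (C₁ * (2 / κ ^ 2) * (1 + |w.im|) ^ ε) * (1 + |z.im|) ^ (-(2 - ε)) := by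
    intro z h1 h2
    have hz : 0 ≤ |z.im| := abs_nonneg _
    have hw' : 0 ≤ |w.im| := abs_nonneg _
    have e1 : ‖(N : ℂ) ^ z‖ = (N : ℝ) ^ z.re := by
      rw [← Complex.ofReal_natCast, Complex.norm_cpow_eq_rpow_re_of_pos hN0]
    have e2 : ‖invZeta (w + z)‖ ≤ C₁ * ((1 + |w.im|) ^ ε * (1 + |z.im|) ^ ε) := by
      refine (hbd (w + z) (by simp; linarith) (by simp; linarith)).trans ?_
      rw [← Real.mul_rpow (by positivity) (by positivity), Complex.add_im]
      gcongr
      have := abs_add_le w.im z.im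
      nlinarith [mul_nonneg hz hw']
    have e3 := norm_riesz_kernel_le hκ hκ1 h1
    rw [hG]; simp only [norm_mul]
    rw [e1]
    calc (N : ℝ) ^ z.re * ‖invZeta (w + z)‖ * ‖1 / (z * (z + 1))‖ ≤
        (N : ℝ) ^ z.re * (C₁ * ((1 + |w.im|) ^ ε * (1 + |z.im|) ^ ε)) *
          (2 / κ ^ 2 * (1 + |z.im|) ^ (-2 : ℝ)) := by gcongr
      _ = _ := by
        rw [show -(2 - ε) = ε + (-2 : ℝ) by ring, Real.rpow_add (by positivity)]; ring
  have hshift : ∫ t : ℝ, G (κ + t * Complex.I) = ∫ t : ℝ, G ((1 : ℝ) + t * Complex.I) := by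
    refine integral_vertical_eq (C := (N : ℝ) * (C₁ * (2 / κ ^ 2) * (1 + |w.im|) ^ ε)) (r := 2 - ε)
      hκ1 (by linarith) ?_ ?_
    · intro z h1 h2
      have hz : 0 < z.re := hκ.trans_le h1
      have hz0 : z ≠ 0 := by rintro rfl; simp at hz
      have hz1 : z + 1 ≠ 0 := by
        intro h; have := congrArg Complex.re h; simp at this; linarith
      have hd := differentiableAt_invZeta hRH (w := w + z) (by simp; linarith)
      have hd2 : DifferentiableAt ℂ (fun z => invZeta (w + z)) z :=
        hd.comp z (differentiableAt_id.const_add w)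
      refine DifferentiableAt.mul (DifferentiableAt.mul ?_ hd2) ?_
      · exact differentiableAt_id.const_cpow (Or.inl (by exact_mod_cast hN0.ne'))
      · exact (differentiableAt_const _).div (by fun_prop) (mul_ne_zero hz0 hz1)
    · intro z h1 h2
      refine (hGbd z h1 h2).trans ?_
      gcongr
      calc (N : ℝ) ^ z.re ≤ (N : ℝ) ^ (1 : ℝ) := by gcongr
        _ = N := Real.rpow_one _
  have hrep : ∫ t : ℝ, G (κ + t * Complex.I) = 2 * Real.pi * rieszMoebius N w := by
    rw [hshift, ← rieszMoebius_eq_integral hN (by linarith)]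
  have hintg : ‖∫ t : ℝ, G (κ + t * Complex.I)‖ ≤
      (N : ℝ) ^ κ * (C₁ * (2 / κ ^ 2) * (1 + |w.im|) ^ ε) * J := by
    rw [hJdef, ← integral_const_mul]
    refine norm_integral_le_of_norm_le (hJ.const_mul _) (ae_of_all _ fun t => ?_)
    simpa using hGbd (κ + t * Complex.I) (by simp) (by simpa using hκ1)
  rw [hrep, norm_mul] at hintg
  have h2pi : 1 ≤ ‖(2 * Real.pi : ℂ)‖ := by
    rw [norm_mul, Complex.norm_real, Real.norm_of_nonneg Real.pi_pos.le]
    have := Real.pi_gt_three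
    simp; linarith
  have hr : ‖rieszMoebius N w‖ ≤ ‖(2 * Real.pi : ℂ)‖ * ‖rieszMoebius N w‖ :=
    le_mul_of_one_le_left (norm_nonneg _) h2pi
  refine (hr.trans hintg).trans ?_
  have : (0 : ℝ) ≤ (N : ℝ) ^ κ * (1 + |w.im|) ^ ε := by positivity
  nlinarith

end RieszMean

section Plancherel
open Set Filter Topology FourierTransform
open scoped ENNReal ContDiff

lemma continuous_fourier_of_integrable {F : ℝ → ℂ} (h1 : Integrable F) : Continuous (𝓕 F) :=
  VectorFourier.fourierIntegral_continuous Real.continuous_fourierChar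
    (by exact continuous_inner) h1

/-- Plancherel's theorem for functions that are both integrable and square integrable. -/
lemma eLpNorm_fourier_eq {F : ℝ → ℂ} (h1 : Integrable F) (h2 : MemLp F 2) :
    eLpNorm (𝓕 F) 2 = eLpNorm F 2 := by
  set f : Lp ℂ 2 (volume : Measure ℝ) := h2.toLp F with hf
  set fhat : Lp ℂ 2 (volume : Measure ℝ) := 𝓕 f with hfhat
  have hae : ∀ᵐ x : ℝ, fhat x = 𝓕 F x := by
    refine ae_eq_of_integral_contDiff_smul_eq ?_ ?_ fun g hg hgs => ?_
    · exact (Lp.memLp fhat).locallyIntegrable (by norm_num)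
    · exact (continuous_fourier_of_integrable h1).locallyIntegrable
    · have hgs' : HasCompactSupport fun x => (g x : ℂ) := hgs.comp_left (g := fun x : ℝ => (x : ℂ)) (by simp)
      have hg' : ContDiff ℝ ∞ fun x => (g x : ℂ) := Complex.ofRealCLM.contDiff.comp hg
      set G : SchwartzMap ℝ ℂ := hgs'.toSchwartzMap hg' with hG
      have hGx : ∀ x, G x = (g x : ℂ) := fun x => rfl
      have key := congrArg (fun T => T G) (Lp.fourier_toTemperedDistribution_eq f)
      simp only [TemperedDistribution.fourier_apply, Lp.toTemperedDistribution_apply] at key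
      have e1 : ∫ x, (𝓕 G) x • f x = ∫ x, (𝓕 G) x • F x := by
        refine integral_congr_ae ?_
        filter_upwards [h2.coeFn_toLp] with x hx
        rw [hf, hx]
      have e2 : ∫ x, (𝓕 (G : ℝ → ℂ)) x • F x = ∫ x, G x • (𝓕 F) x := by
        have := VectorFourier.integral_fourierIntegral_smul_eq_flip (μ := (volume : Measure ℝ))
          (ν := (volume : Measure ℝ)) (L := innerₗ ℝ) Real.continuous_fourierChar
          (by exact continuous_inner) (G.integrable) h1
        rw [flip_innerₗ] at this
        exact this
      rw [e1, SchwartzMap.fourier_coe, e2] at key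
      simp only [hGx] at key
      simpa only [Complex.real_smul, smul_eq_mul] using key.symm
  rw [← eLpNorm_congr_ae hae]
  have h := Lp.norm_fourier_eq f
  rw [hf, Lp.norm_toLp] at h
  rw [← ENNReal.toReal_eq_toReal_iff' (Lp.memLp fhat).2.ne h2.2.ne, ← h, ← hf, ← hfhat, Lp.norm_def]

lemma lintegral_enorm_sq_fourier {F : ℝ → ℂ} (h1 : Integrable F) (h2 : ∫⁻ x, ‖F x‖ₑ ^ 2 ≠ ⊤) :
    ∫⁻ x, ‖𝓕 F x‖ₑ ^ 2 = ∫⁻ x, ‖F x‖ₑ ^ 2 := by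
  have e : ∀ G : ℝ → ℂ, (eLpNorm G 2) ^ 2 = ∫⁻ x, ‖G x‖ₑ ^ 2 := by
    intro G
    rw [eLpNorm_eq_lintegral_rpow_enorm_toReal (by norm_num) (by norm_num)]
    simp only [ENNReal.toReal_ofNat, ENNReal.rpow_ofNat]
    rw [← ENNReal.rpow_natCast, ← ENNReal.rpow_mul]
    norm_num
  have hm : MemLp F 2 := by
    refine ⟨h1.1, ?_⟩
    have := e F
    rw [lt_top_iff_ne_top]
    intro h
    rw [h] at this
    exact h2 (by rw [← this]; simp)
  rw [← e, ← e, eLpNorm_fourier_eq h1 hm]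

lemma lintegral_comp_div_two_pi (G : ℝ → ℝ≥0∞) :
    ∫⁻ t : ℝ, G (t / (2 * Real.pi)) = ENNReal.ofReal (2 * Real.pi) * ∫⁻ x, G x := by
  have hpi : 0 < 2 * Real.pi := by positivity
  have h := lintegral_image_eq_lintegral_abs_deriv_mul (s := univ) (f := fun x : ℝ => 2 * Real.pi * x)
    (f' := fun _ => 2 * Real.pi) MeasurableSet.univ
    (fun x _ => by simpa using (hasDerivAt_id x).const_mul (2 * Real.pi))
    (fun x _ y _ h => by simpa [hpi.ne'] using h) (fun t => G (t / (2 * Real.pi)))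
  have himg : (fun x : ℝ => 2 * Real.pi * x) '' univ = univ :=
    image_univ_of_surjective fun y => ⟨y / (2 * Real.pi), by field_simp⟩
  rw [himg] at h
  simp only [Measure.restrict_univ, abs_of_pos hpi] at h
  rw [h, ← lintegral_const_mul' _ _ ENNReal.ofReal_ne_top]
  refine lintegral_congr fun x => ?_
  rw [mul_div_cancel_left₀ _ hpi.ne']

lemma lintegral_comp_exp_neg (G : ℝ → ℝ≥0∞) :
    ∫⁻ x in Ioi (0 : ℝ), G x = ∫⁻ u : ℝ, ENNReal.ofReal (Real.exp (-u)) * G (Real.exp (-u)) := by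
  have h := lintegral_image_eq_lintegral_abs_deriv_mul (s := univ) (f := fun x : ℝ => Real.exp (-x))
    (f' := fun x => -Real.exp (-x)) MeasurableSet.univ
    (fun x _ => by simpa using (hasDerivAt_id x).neg.exp)
    (fun x _ y _ h => by simpa using h) G
  have himg : (fun x : ℝ => Real.exp (-x)) '' univ = Ioi 0 := by
    ext y
    simp only [image_univ, mem_range, mem_Ioi]
    exact ⟨fun ⟨x, hx⟩ => hx ▸ Real.exp_pos _, fun hy => ⟨-Real.log y, by simp [Real.exp_log hy]⟩⟩
  rw [himg] at h
  simpa only [Measure.restrict_univ, abs_neg, abs_of_pos (Real.exp_pos _)] using h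

/-- Plancherel's theorem for the Mellin transform. -/
lemma lintegral_enorm_sq_mellin {f : ℝ → ℂ} {c : ℝ} (h1 : MellinConvergent f c)
    (h2 : ∫⁻ x in Ioi (0 : ℝ), ‖f x‖ₑ ^ 2 * ENNReal.ofReal (x ^ (2 * c - 1)) ≠ ⊤) :
    ∫⁻ t : ℝ, ‖mellin f (c + t * Complex.I)‖ₑ ^ 2 = ENNReal.ofReal (2 * Real.pi) *
      ∫⁻ x in Ioi (0 : ℝ), ‖f x‖ₑ ^ 2 * ENNReal.ofReal (x ^ (2 * c - 1)) := by
  set F : ℝ → ℂ := fun u => Real.exp (-c * u) • f (Real.exp (-u)) with hF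
  have hM : ∀ t : ℝ, mellin f (c + t * Complex.I) = 𝓕 F (t / (2 * Real.pi)) := by
    intro t
    rw [mellin_eq_fourier]
    simp [hF]
  have hval : ∫⁻ x in Ioi (0 : ℝ), ‖f x‖ₑ ^ 2 * ENNReal.ofReal (x ^ (2 * c - 1)) =
      ∫⁻ u, ‖F u‖ₑ ^ 2 := by
    rw [lintegral_comp_exp_neg]
    refine lintegral_congr fun u => ?_
    have e : Real.exp (-c * u) ^ 2 = Real.exp (-u) * Real.exp (-u) ^ (2 * c - 1) := by
      rw [← Real.exp_mul, ← Real.exp_add, sq, ← Real.exp_add]; ring_nf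
    have e2 : ‖Real.exp (-c * u)‖ₑ = ENNReal.ofReal (Real.exp (-c * u)) :=
      Real.enorm_of_nonneg (Real.exp_pos _).le
    rw [hF]; simp only [enorm_smul]
    rw [e2, mul_pow, ← ENNReal.ofReal_pow (Real.exp_pos _).le, e,
      ENNReal.ofReal_mul (Real.exp_pos _).le]
    ring
  have hintg : Integrable F := by
    have himg : (fun x : ℝ => Real.exp (-x)) '' univ = Ioi 0 := by
      ext y
      simp only [image_univ, mem_range, mem_Ioi]
      exact ⟨fun ⟨x, hx⟩ => hx ▸ Real.exp_pos _, fun hy => ⟨-Real.log y, by simp [Real.exp_log hy]⟩⟩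
    rw [MellinConvergent, ← himg, integrableOn_image_iff_integrableOn_abs_deriv_smul
      (f' := fun x => -Real.exp (-x)) MeasurableSet.univ
      (fun x _ => by simpa using (hasDerivAt_id x).neg.exp) (fun x _ y _ h => by simpa using h),
      integrableOn_univ] at h1
    refine h1.congr (Eventually.of_forall fun x => ?_)
    have e : ((Real.exp (-x) : ℝ) : ℂ) ^ ((c : ℂ) - 1) = ((Real.exp (-x) ^ (c - 1) : ℝ) : ℂ) := by
      rw [Complex.ofReal_cpow (Real.exp_pos _).le]; push_cast; rfl
    have e2 : Real.exp (-x) * Real.exp (-x) ^ (c - 1) = Real.exp (-c * x) := by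
      rw [← Real.exp_mul, ← Real.exp_add]; ring_nf
    simp only [abs_neg, abs_of_pos (Real.exp_pos _), e, hF, Complex.coe_smul, smul_smul, e2]
  rw [hval] at h2 ⊢
  simp only [hM]
  rw [lintegral_comp_div_two_pi (fun x => ‖𝓕 F x‖ₑ ^ 2), lintegral_enorm_sq_fourier hintg h2]

end Plancherel

section FractDiff
open Set Filter Topology
open scoped ENNReal

/-- The difference of the fractional parts of `x` and `l * x`. -/
noncomputable def fractDiff (l x : ℝ) : ℝ := Int.fract x - Int.fract (l * x)

lemma measurable_fractDiff (l : ℝ) : Measurable (fractDiff l) :=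
  measurable_fract.sub (measurable_fract.comp (measurable_const_mul l))

lemma abs_fractDiff_le_one (l x : ℝ) : |fractDiff l x| ≤ 1 := by
  rw [fractDiff, abs_le]
  constructor <;> linarith [Int.fract_nonneg x, Int.fract_lt_one x, Int.fract_nonneg (l * x),
    Int.fract_lt_one (l * x)]

lemma abs_fractDiff_le_mul {l x : ℝ} (hl : 1 ≤ l) (hl' : l ≤ 10) (hx : 0 ≤ x) :
    |fractDiff l x| ≤ 10 * x := by
  by_cases h : x < 1 / 10
  · rw [fractDiff, Int.fract_eq_self.mpr ⟨hx, by linarith⟩,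
      Int.fract_eq_self.mpr ⟨by positivity, by nlinarith⟩, abs_le]
    constructor <;> nlinarith
  · exact (abs_fractDiff_le_one l x).trans (by linarith)

lemma abs_fractDiff_le_add {l x : ℝ} (hl : 1 ≤ l) (hx : 0 ≤ x) :
    |fractDiff l x| ≤ fractDiff l x + 2 * (l - 1) * x := by
  have h0 : (⌊x⌋ : ℝ) ≤ ⌊l * x⌋ := by
    exact_mod_cast Int.floor_le_floor (by nlinarith)
  have h1 := Int.self_sub_floor x
  have h2 := Int.self_sub_floor (l * x)
  have h3 : 0 ≤ (l - 1) * x := mul_nonneg (by linarith) hx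
  rw [fractDiff, abs_le]
  constructor <;> nlinarith

lemma integrableOn_fract_mul_rpow {a : ℝ} (ha : -1 < a) (l : ℝ) {B : ℝ} (hB : 0 ≤ B) (hl : 0 < l) :
    IntegrableOn (fun x => Int.fract (l * x) * x ^ (a - 1)) (Ioc 0 B) := by
  have h1 : IntegrableOn (fun x : ℝ => l * x ^ a) (Ioc 0 B) := by
    refine Integrable.const_mul ?_ _
    exact (intervalIntegrable_iff_integrableOn_Ioc_of_le hB).mp
      (intervalIntegral.intervalIntegrable_rpow' ha)
  refine h1.mono' ?_ ?_
  · exact ((measurable_fract.comp (measurable_const_mul l)).mul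
      (measurable_id.pow_const _)).aestronglyMeasurable
  · filter_upwards [ae_restrict_mem measurableSet_Ioc] with x hx
    have hx0 := hx.1
    rw [Real.norm_of_nonneg (mul_nonneg (Int.fract_nonneg _) (by positivity))]
    have h2 : Int.fract (l * x) ≤ l * x := by
      have : (0:ℝ) ≤ ⌊l * x⌋ := by exact_mod_cast Int.floor_nonneg.mpr (by positivity)
      rw [← Int.self_sub_floor]; linarith
    have h3 : x ^ a = x * x ^ (a - 1) := by rw [Real.rpow_sub_one hx0.ne']; field_simp
    rw [h3, ← mul_assoc]
    exact mul_le_mul_of_nonneg_right h2 (by positivity)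

lemma integral_fractDiff_mul_rpow_nonpos {σ l B : ℝ} (hσ : 0 < σ) (hσ' : σ < 1 / 2) (hl : 1 ≤ l)
    (hB : 0 ≤ B) : ∫ x in Ioc 0 B, fractDiff l x * x ^ (2 * -σ - 1) ≤ 0 := by
  have hl0 : 0 < l := by linarith
  have i1 := integrableOn_fract_mul_rpow (a := 2 * -σ) (by linarith) 1 hB one_pos
  have i2 := integrableOn_fract_mul_rpow (a := 2 * -σ) (by linarith) l hB hl0
  have i3 := integrableOn_fract_mul_rpow (a := 2 * -σ) (by linarith) 1
    (B := l * B) (by positivity) one_pos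
  simp only [one_mul] at i1 i3
  simp only [fractDiff, sub_mul]
  rw [integral_sub i1 i2, sub_nonpos]
  have e : ∫ x in Ioc 0 B, Int.fract (l * x) * x ^ (2 * -σ - 1) =
      l ^ (2 * σ) * ∫ x in Ioc 0 (l * B), Int.fract x * x ^ (2 * -σ - 1) := by
    rw [← intervalIntegral.integral_of_le hB, ← intervalIntegral.integral_of_le (by positivity)]
    have := intervalIntegral.integral_comp_mul_left (a := 0) (b := B)
      (fun x => Int.fract x * x ^ (2 * -σ - 1)) hl0.ne'
    rw [mul_zero] at this
    have e2 : ∫ x in (0:ℝ)..(l * B), Int.fract x * x ^ (2 * -σ - 1) =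
        l * ∫ x in (0:ℝ)..B, Int.fract (l * x) * (l * x) ^ (2 * -σ - 1) := by
      rw [this, smul_eq_mul]; field_simp
    rw [e2, ← mul_assoc, ← intervalIntegral.integral_const_mul]
    refine intervalIntegral.integral_congr fun x hx => ?_
    rw [uIcc_of_le hB] at hx
    have : l ^ (2 * σ) * l * l ^ (2 * -σ - 1) = 1 := by
      rw [← Real.rpow_add_one hl0.ne', ← Real.rpow_add hl0]; ring_nf; simp
    simp only [Real.mul_rpow hl0.le hx.1]
    linear_combination (-(Int.fract (l * x) * x ^ (2 * -σ - 1))) * this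
  rw [e]
  have hnn : ∀ x : ℝ, 0 < x → 0 ≤ Int.fract x * x ^ (2 * -σ - 1) := fun x hx =>
    mul_nonneg (Int.fract_nonneg _) (by positivity)
  have h1 : ∫ x in Ioc 0 B, Int.fract x * x ^ (2 * -σ - 1) ≤
      ∫ x in Ioc 0 (l * B), Int.fract x * x ^ (2 * -σ - 1) := by
    refine setIntegral_mono_set i3 ?_ ?_
    · filter_upwards [ae_restrict_mem measurableSet_Ioc] with x hx using hnn x hx.1
    · exact (Ioc_subset_Ioc_right (by nlinarith)).eventuallyLE
  have h2 : 0 ≤ ∫ x in Ioc 0 (l * B), Int.fract x * x ^ (2 * -σ - 1) :=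
    setIntegral_nonneg measurableSet_Ioc fun x hx => hnn x hx.1
  have h3 : 1 ≤ l ^ (2 * σ) := Real.one_le_rpow hl (by linarith)
  nlinarith

lemma lintegral_fractDiff_sq_le {σ l : ℝ} (hσ : 0 < σ) (hσ' : σ < 1 / 2) (hl : 1 < l) :
    ∫⁻ x in Ioi (0 : ℝ), ‖(fractDiff l x : ℂ)‖ₑ ^ 2 * ENNReal.ofReal (x ^ (2 * -σ - 1)) ≤
      ENNReal.ofReal ((2 / (1 - 2 * σ) + 1 / (2 * σ)) * (l - 1) ^ (2 * σ)) := by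
  set L := l - 1 with hL
  have hL0 : 0 < L := by rw [hL]; linarith
  have hB : (0:ℝ) < 1 / L := by positivity
  have e : ∀ x : ℝ, 0 < x → ‖(fractDiff l x : ℂ)‖ₑ ^ 2 * ENNReal.ofReal (x ^ (2 * -σ - 1)) =
      ENNReal.ofReal (fractDiff l x ^ 2 * x ^ (2 * -σ - 1)) := by
    intro x hx
    rw [ENNReal.ofReal_mul (sq_nonneg _), ← sq_abs, ENNReal.ofReal_pow (abs_nonneg _),
      ← ofReal_norm, Complex.norm_real, Real.norm_eq_abs]
  have hsq : ∀ x, fractDiff l x ^ 2 ≤ |fractDiff l x| := fun x => by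
    have := abs_fractDiff_le_one l x
    rw [← sq_abs]; nlinarith [abs_nonneg (fractDiff l x)]
  rw [← Ioc_union_Ioi_eq_Ioi hB.le, lintegral_union measurableSet_Ioi Ioc_disjoint_Ioi_same, add_mul,
    ENNReal.ofReal_add (by have : 0 < 1 - 2 * σ := by linarith
                           positivity) (by positivity)]
  refine add_le_add ?_ ?_
  · have i1 := integrableOn_fract_mul_rpow (a := 2 * -σ) (by linarith) 1 hB.le one_pos
    have i2 := integrableOn_fract_mul_rpow (a := 2 * -σ) (by linarith) l hB.le (by linarith)
    have i3 : IntegrableOn (fun x : ℝ => x ^ (2 * -σ)) (Ioc 0 (1 / L)) :=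
      (intervalIntegrable_iff_integrableOn_Ioc_of_le hB.le).mp
        (intervalIntegral.intervalIntegrable_rpow' (by linarith))
    have i4 : IntegrableOn (fun x : ℝ => fractDiff l x * x ^ (2 * -σ - 1)) (Ioc 0 (1 / L)) := by
      simpa [fractDiff, sub_mul] using! i1.sub i2
    have i5 : IntegrableOn (fun x : ℝ => fractDiff l x * x ^ (2 * -σ - 1) + 2 * L * x ^ (2 * -σ))
      (Ioc 0 (1 / L)) := i4.add (i3.const_mul _)
    have hpt : ∀ x ∈ Ioc 0 (1 / L), fractDiff l x ^ 2 * x ^ (2 * -σ - 1) ≤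
        fractDiff l x * x ^ (2 * -σ - 1) + 2 * L * x ^ (2 * -σ) := by
      intro x hx
      have h3 : x ^ (2 * -σ) = x * x ^ (2 * -σ - 1) := by
        rw [Real.rpow_sub_one hx.1.ne']; field_simp [hx.1.ne']
      have h4 := (hsq x).trans (abs_fractDiff_le_add hl.le hx.1.le)
      have h5 : 0 ≤ x ^ (2 * -σ - 1) := Real.rpow_nonneg hx.1.le _
      rw [h3]
      calc _ ≤ (fractDiff l x + 2 * (l - 1) * x) * x ^ (2 * -σ - 1) :=
            mul_le_mul_of_nonneg_right h4 h5
        _ = _ := by rw [hL]; ring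
    calc _ ≤ ∫⁻ x in Ioc 0 (1 / L),
          ENNReal.ofReal (fractDiff l x * x ^ (2 * -σ - 1) + 2 * L * x ^ (2 * -σ)) := by
          refine setLIntegral_mono' measurableSet_Ioc fun x hx => ?_
          rw [e x hx.1]
          exact ENNReal.ofReal_le_ofReal (hpt x hx)
      _ = ENNReal.ofReal (∫ x in Ioc 0 (1 / L),
          (fractDiff l x * x ^ (2 * -σ - 1) + 2 * L * x ^ (2 * -σ))) := by
          rw [ofReal_integral_eq_lintegral_ofReal i5]
          filter_upwards [ae_restrict_mem measurableSet_Ioc] with x hx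
          exact le_trans (mul_nonneg (sq_nonneg _) (Real.rpow_nonneg hx.1.le _)) (hpt x hx)
      _ ≤ _ := by
          refine ENNReal.ofReal_le_ofReal ?_
          rw [integral_add i4 (i3.const_mul _), integral_const_mul]
          have h1 := integral_fractDiff_mul_rpow_nonpos hσ hσ' hl.le hB.le
          rw [← intervalIntegral.integral_of_le hB.le (f := fun x : ℝ => x ^ (2 * -σ)),
            integral_rpow (Or.inl (by linarith)), Real.zero_rpow (by linarith), sub_zero]
          have h2 : 2 * L * ((1 / L) ^ (2 * -σ + 1) / (2 * -σ + 1)) =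
              2 / (1 - 2 * σ) * L ^ (2 * σ) := by
            rw [one_div, Real.inv_rpow hL0.le, ← Real.rpow_neg hL0.le]
            have : L ^ (-(2 * -σ + 1)) = L ^ (2 * σ) / L := by
              rw [← Real.rpow_sub_one hL0.ne']; ring_nf
            rw [this, show 2 * -σ + 1 = 1 - 2 * σ by ring]
            have : 1 - 2 * σ ≠ 0 := by linarith
            field_simp
          linarith
  · calc _ ≤ ∫⁻ x in Ioi (1 / L), ENNReal.ofReal (x ^ (2 * -σ - 1)) := by
          refine setLIntegral_mono' measurableSet_Ioi fun x hx => ?_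
          have hx0 : 0 < x := hB.trans hx
          rw [e x hx0]
          refine ENNReal.ofReal_le_ofReal ?_
          have := (hsq x).trans (abs_fractDiff_le_one l x)
          have h5 : 0 ≤ x ^ (2 * -σ - 1) := Real.rpow_nonneg hx0.le _
          nlinarith
      _ = ENNReal.ofReal (∫ x in Ioi (1 / L), x ^ (2 * -σ - 1)) := by
          rw [ofReal_integral_eq_lintegral_ofReal (integrableOn_Ioi_rpow_of_lt (by linarith) hB)]
          filter_upwards [ae_restrict_mem measurableSet_Ioi] with x hx
          exact Real.rpow_nonneg (hB.trans hx).le _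
      _ ≤ _ := by
          refine ENNReal.ofReal_le_ofReal (le_of_eq ?_)
          rw [integral_Ioi_rpow_of_lt (by linarith) hB, one_div L, Real.inv_rpow hL0.le,
            ← Real.rpow_neg hL0.le]
          rw [show -(2 * -σ - 1 + 1) = 2 * σ by ring, show 2 * -σ - 1 + 1 = -(2 * σ) by ring]
          field_simp

end FractDiff

section FractDiffMellin
open Set Filter Topology
open scoped ENNReal

lemma HasMellin.comp_mul_left {f : ℝ → ℂ} {s m : ℂ} (h : HasMellin f s m) {a : ℝ} (ha : 0 < a) :
    HasMellin (fun t => f (a * t)) s ((a : ℂ) ^ (-s) * m) :=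
  ⟨(MellinConvergent.comp_mul_left ha).mpr h.1, by rw [mellin_comp_mul_left _ _ ha, h.2, smul_eq_mul]⟩

lemma hasMellin_fractDiff {s : ℂ} (hs : 0 < s.re) (hs1 : s.re < 1) {l : ℝ} (hl : 0 < l) :
    HasMellin (fun x => (fractDiff l x : ℂ)) (-s) (riemannZeta s / s * ((l : ℂ) ^ s - 1)) := by
  have h1 := hasMellin_fractC hs hs1
  have h2 := h1.comp_mul_left hl
  have h := hasMellin_sub h1.1 h2.1
  rw [h1.2, h2.2, neg_neg] at h
  convert h using 1
  · ext x; simp [fractDiff, fractC]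
  · ring

lemma exists_norm_exp_mul_sub_one_le {s : ℂ} (hs : 0 < s.re) (hs1 : s.re < 1) {h : ℝ} (hh : 0 < h)
    (hh' : Real.exp h ≤ 10) {ε : ℝ} (hε : 0 < ε) (hε1 : ε ≤ 1) :
    ∃ k : ℕ, ‖Complex.exp (h * s) - 1‖ * (1 + |s.im|) ^ ε ≤
      352 * ((h / 2 ^ k) ^ (-ε) * ‖Complex.exp ((h / 2 ^ k : ℝ) * s) - 1‖) := by
  have h3 : h ≤ 3 := by
    by_contra! hc
    have h1 : Real.exp 3 ≤ Real.exp h := Real.exp_le_exp.mpr hc.le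
    have h2 : Real.exp 3 = Real.exp 1 ^ 3 := by rw [← Real.exp_nat_mul]; norm_num
    have h4 := Real.exp_one_gt_d9
    have h5 : (2.7:ℝ) ^ 3 ≤ Real.exp 1 ^ 3 := pow_le_pow_left₀ (by norm_num) (by linarith) 3
    norm_num at h5
    linarith
  have him : 1 + |s.im| ≤ 1 + ‖s‖ := by linarith [Complex.abs_im_le_norm s]
  have hs0 : 0 < ‖s‖ := norm_pos_iff.mpr (by rintro rfl; simp at hs)
  have hpow : ∀ u : ℝ, 0 < u → 1 + |s.im| ≤ 4 / u → (1 + |s.im|) ^ ε ≤ 4 * u ^ (-ε) := by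
    intro u hu hle
    calc (1 + |s.im|) ^ ε ≤ (4 / u) ^ ε := Real.rpow_le_rpow (by positivity) hle hε.le
      _ = 4 ^ ε * u ^ (-ε) := by
        rw [Real.div_rpow (by norm_num) hu.le, Real.rpow_neg hu.le, div_eq_mul_inv]
      _ ≤ 4 * u ^ (-ε) := by
        have : (4:ℝ) ^ ε ≤ 4 ^ (1:ℝ) := Real.rpow_le_rpow_of_exponent_le (by norm_num) hε1
        rw [Real.rpow_one] at this
        exact mul_le_mul_of_nonneg_right this (by positivity)
  by_cases hc : h * ‖s‖ ≤ 1 / 2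
  · refine ⟨0, ?_⟩
    have h1 : 1 + |s.im| ≤ 4 / h := by
      rw [le_div_iff₀ hh]; nlinarith
    have h2 := hpow h hh h1
    simp only [pow_zero, div_one]
    have h4 : 0 ≤ h ^ (-ε) := by positivity
    have h5 := norm_nonneg (Complex.exp (h * s) - 1)
    nlinarith [mul_le_mul_of_nonneg_left h2 h5, mul_nonneg h4 h5]
  · push Not at hc
    obtain ⟨n, hn1, hn2⟩ := exists_nat_pow_near (x := 2 * (h * ‖s‖)) (y := 2) (by linarith) (by norm_num)
    refine ⟨n + 1, ?_⟩
    set u : ℝ := h / 2 ^ (n + 1) with hu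
    have hu0 : 0 < u := by positivity
    have e : h = u * 2 ^ (n + 1) := by rw [hu]; field_simp
    have hu1 : u * ‖s‖ ≤ 1 / 2 := by
      rw [hu, div_mul_eq_mul_div, div_le_iff₀ (by positivity)]; linarith
    have hu2 : 1 / 4 ≤ u * ‖s‖ := by
      rw [hu, div_mul_eq_mul_div, le_div_iff₀ (by positivity), pow_succ]; linarith
    have hn : ‖(u : ℂ) * s‖ = u * ‖s‖ := by
      rw [norm_mul, Complex.norm_real, Real.norm_of_nonneg hu0.le]
    have h8 : 1 / 8 ≤ ‖Complex.exp ((u : ℝ) * s) - 1‖ := by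
      have h1 := Complex.norm_exp_sub_one_sub_id_le (x := (u : ℂ) * s) (by rw [hn]; linarith)
      have h2 := norm_sub_norm_le ((u : ℂ) * s) (-(Complex.exp (u * s) - 1 - u * s))
      rw [norm_neg, show (u : ℂ) * s - -(Complex.exp (u * s) - 1 - u * s) = Complex.exp (u * s) - 1 by ring,
        hn] at h2
      rw [hn] at h1
      nlinarith
    have h11 : ‖Complex.exp (h * s) - 1‖ ≤ 11 := by
      refine (norm_sub_le _ _).trans ?_
      rw [Complex.norm_exp, norm_one, Complex.re_ofReal_mul]
      have : Real.exp (h * s.re) ≤ Real.exp h := Real.exp_le_exp.mpr (by nlinarith)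
      linarith
    have h1 : 1 + |s.im| ≤ 4 / u := by
      rw [le_div_iff₀ hu0]
      have hun : u ≤ h / 2 := by
        rw [hu]; gcongr
        have : (1:ℝ) ≤ 2 ^ n := one_le_pow₀ (by norm_num)
        rw [pow_succ]; linarith
      nlinarith
    have h2 := hpow u hu0 h1
    have h4 : 0 ≤ u ^ (-ε) := by positivity
    calc _ ≤ 11 * (4 * u ^ (-ε)) := by gcongr
      _ = 352 * (u ^ (-ε) * (1 / 8)) := by ring
      _ ≤ _ := by gcongr

lemma continuous_mellin_fractDiff {σ l : ℝ} (hσ : 0 < σ) (hσ' : σ < 1) (hl : 0 < l) :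
    Continuous fun t : ℝ => mellin (fun x => (fractDiff l x : ℂ)) ((-σ : ℝ) + t * Complex.I) := by
  have e : ∀ t : ℝ, mellin (fun x => (fractDiff l x : ℂ)) ((-σ : ℝ) + t * Complex.I) =
      riemannZeta (σ - t * Complex.I) / (σ - t * Complex.I) * ((l : ℂ) ^ (σ - t * Complex.I) - 1) := by
    intro t
    have := (hasMellin_fractDiff (s := σ - t * Complex.I) (by simpa) (by simpa) hl).2
    rw [← this]; congr 1; push_cast; ring
  simp only [e]
  have hne0 : ∀ t : ℝ, (σ : ℂ) - t * Complex.I ≠ 0 := fun t h => by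
    have := congrArg Complex.re h; simp at this; linarith
  have hne1 : ∀ t : ℝ, (σ : ℂ) - t * Complex.I ≠ 1 := fun t h => by
    have := congrArg Complex.re h; simp at this; linarith
  have hc : Continuous fun t : ℝ => (σ : ℂ) - t * Complex.I := by fun_prop
  have h1 : Continuous fun t : ℝ => riemannZeta (σ - t * Complex.I) :=
    continuous_iff_continuousAt.mpr fun t =>
      ContinuousAt.comp (g := riemannZeta) (differentiableAt_riemannZeta (hne1 t)).continuousAt hc.continuousAt
  refine (h1.div hc hne0).mul (Continuous.sub ?_ continuous_const)
  exact hc.const_cpow (Or.inl (by exact_mod_cast hl.ne'))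

lemma lintegral_mellin_fractDiff_sq_le {σ l : ℝ} (hσ : 0 < σ) (hσ' : σ < 1 / 2) (hl : 1 < l) :
    ∫⁻ t : ℝ, ‖mellin (fun x => (fractDiff l x : ℂ)) ((-σ : ℝ) + t * Complex.I)‖ₑ ^ 2 ≤
      ENNReal.ofReal (2 * Real.pi * ((2 / (1 - 2 * σ) + 1 / (2 * σ)) * (l - 1) ^ (2 * σ))) := by
  have h1 := lintegral_fractDiff_sq_le hσ hσ' hl
  have h2 := (hasMellin_fractDiff (s := σ) (by simpa) (by simp; linarith) (by linarith : 0 < l)).1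
  rw [lintegral_enorm_sq_mellin (by push_cast; exact h2) (ne_top_of_le_ne_top ENNReal.ofReal_ne_top h1)]
  refine (mul_le_mul_right h1 _).trans_eq ?_
  rw [← ENNReal.ofReal_mul (by positivity)]

lemma exists_lintegral_mellin_fractDiff_weighted_le {σ ε : ℝ} (hε : 0 < ε) (hεσ : ε < σ)
    (hσ' : σ < 1 / 2) :
    ∃ C : ℝ, 0 < C ∧ ∀ l : ℝ, 1 < l → l ≤ 10 →
      ∫⁻ t : ℝ, ‖mellin (fun x => (fractDiff l x : ℂ)) ((-σ : ℝ) + t * Complex.I)‖ₑ ^ 2 *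
        ENNReal.ofReal ((1 + |t|) ^ (2 * ε)) ≤ ENNReal.ofReal (C * (l - 1) ^ (2 * σ - 2 * ε)) := by
  have hσ : 0 < σ := hε.trans hεσ
  set p := 2 * σ - 2 * ε with hp
  have hp0 : 0 < p := by rw [hp]; linarith
  have h12 : 0 < 1 - 2 * σ := by linarith
  set C1 : ℝ := 2 * Real.pi * ((2 / (1 - 2 * σ) + 1 / (2 * σ)) * 10 ^ (2 * σ)) with hC1
  have hC10 : 0 < C1 := by rw [hC1]; positivity
  set r : ℝ := (2:ℝ) ^ (-p) with hr
  have hr0 : 0 < r := by positivity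
  have hr1 : r < 1 := Real.rpow_lt_one_of_one_lt_of_neg (by norm_num) (by linarith)
  have hr1' : 0 < 1 - r := by linarith
  refine ⟨352 ^ 2 * C1 * (1 - r)⁻¹, by positivity, fun l hl hl' => ?_⟩
  set h := Real.log l with hh
  have hl0 : 0 < l := by linarith
  have hh0 : 0 < h := Real.log_pos hl
  have hexp : Real.exp h = l := Real.exp_log hl0
  have hk0 : ∀ k : ℕ, 0 < h / 2 ^ k := fun k => by positivity
  have hkh : ∀ k : ℕ, h / 2 ^ k ≤ h := fun k => div_le_self hh0.le (one_le_pow₀ (by norm_num))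
  set M : ℕ → ℝ → ℝ≥0∞ := fun k t =>
    ‖mellin (fun x => (fractDiff (Real.exp (h / 2 ^ k)) x : ℂ)) ((-σ : ℝ) + t * Complex.I)‖ₑ ^ 2 with hM
  have hpt : ∀ t : ℝ, ‖mellin (fun x => (fractDiff l x : ℂ)) ((-σ : ℝ) + t * Complex.I)‖ₑ ^ 2 *
        ENNReal.ofReal ((1 + |t|) ^ (2 * ε)) ≤
      ∑' k, ENNReal.ofReal (352 ^ 2 * (h / 2 ^ k) ^ (-(2 * ε))) * M k t := by
    intro t
    set s : ℂ := σ - t * Complex.I with hs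
    have hsre : s.re = σ := by simp [hs]
    have hsim : |s.im| = |t| := by simp [hs]
    obtain ⟨k, hk⟩ := exists_norm_exp_mul_sub_one_le (s := s) (by rw [hsre]; exact hσ)
      (by rw [hsre]; linarith) hh0 (by rw [hexp]; exact hl') hε (by linarith)
    rw [hsim] at hk
    refine le_trans ?_ (ENNReal.le_tsum k)
    have hval : ∀ m : ℝ, mellin (fun x => (fractDiff (Real.exp m) x : ℂ)) ((-σ : ℝ) + t * Complex.I) =
        riemannZeta s / s * (Complex.exp (m * s) - 1) := by
      intro m
      have := (hasMellin_fractDiff (s := s) (by rw [hsre]; exact hσ) (by rw [hsre]; linarith)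
        (Real.exp_pos m)).2
      rw [show ((-σ : ℝ) : ℂ) + t * Complex.I = -s by rw [hs]; push_cast; ring, this,
        Complex.cpow_def_of_ne_zero (by exact_mod_cast (Real.exp_pos m).ne'), ← Complex.ofReal_log
          (Real.exp_pos m).le, Real.log_exp]
    have e1 : ∀ z : ℂ, ‖z‖ₑ ^ 2 = ENNReal.ofReal (‖z‖ ^ 2) := fun z => by
      rw [ENNReal.ofReal_pow (norm_nonneg _), ofReal_norm]
    have hvl := hval h
    rw [hexp] at hvl
    simp only [hM]
    rw [hvl, hval, e1, e1, ← ENNReal.ofReal_mul (by positivity), ← ENNReal.ofReal_mul (by positivity)]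
    refine ENNReal.ofReal_le_ofReal ?_
    have e2 : (1 + |t|) ^ (2 * ε) = ((1 + |t|) ^ ε) ^ 2 := by
      rw [← Real.rpow_mul_natCast (by positivity)]; ring_nf
    have e3 : (h / 2 ^ k) ^ (-(2 * ε)) = ((h / 2 ^ k) ^ (-ε)) ^ 2 := by
      rw [← Real.rpow_mul_natCast (hk0 k).le]; ring_nf
    rw [e2, e3, norm_mul, norm_mul, mul_pow, mul_pow]
    have h5 := pow_le_pow_left₀ (by positivity) hk 2
    have h6 := mul_le_mul_of_nonneg_left h5 (sq_nonneg ‖riemannZeta s / s‖)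
    calc _ = ‖riemannZeta s / s‖ ^ 2 * (‖Complex.exp (h * s) - 1‖ * (1 + |t|) ^ ε) ^ 2 := by ring
      _ ≤ _ := h6
      _ = _ := by push_cast; ring
  have hintg : ∀ k, ENNReal.ofReal (352 ^ 2 * (h / 2 ^ k) ^ (-(2 * ε))) * ∫⁻ t, M k t ≤
      ENNReal.ofReal (352 ^ 2 * C1 * h ^ p * r ^ k) := by
    intro k
    have h1 : 1 < Real.exp (h / 2 ^ k) := Real.one_lt_exp_iff.mpr (hk0 k)
    have h2 := lintegral_mellin_fractDiff_sq_le hσ hσ' h1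
    refine (mul_le_mul_right h2 _).trans ?_
    rw [← ENNReal.ofReal_mul (by have := hk0 k; positivity)]
    refine ENNReal.ofReal_le_ofReal ?_
    have h3 : Real.exp (h / 2 ^ k) - 1 ≤ 10 * (h / 2 ^ k) := by
      set u := h / 2 ^ k with hu
      have h4 := Real.add_one_le_exp (-u)
      have h5 : Real.exp u ≤ 10 := (Real.exp_le_exp.mpr (hkh k)).trans (by rw [hexp]; exact hl')
      have h6 : Real.exp u * Real.exp (-u) = 1 := by rw [← Real.exp_add]; simp
      nlinarith [Real.exp_pos u, hk0 k]
    have h4 : (Real.exp (h / 2 ^ k) - 1) ^ (2 * σ) ≤ 10 ^ (2 * σ) * (h / 2 ^ k) ^ (2 * σ) := by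
      rw [← Real.mul_rpow (by norm_num) (hk0 k).le]
      exact Real.rpow_le_rpow (by linarith) h3 (by linarith)
    have h5 : (h / 2 ^ k) ^ (-(2 * ε)) * (h / 2 ^ k) ^ (2 * σ) = h ^ p * r ^ k := by
      rw [← Real.rpow_add (hk0 k), show -(2 * ε) + 2 * σ = p by rw [hp]; ring,
        Real.div_rpow hh0.le (by positivity), hr, ← Real.rpow_natCast, ← Real.rpow_natCast,
        ← Real.rpow_mul (by norm_num), ← Real.rpow_mul (by norm_num), div_eq_mul_inv,
        ← Real.rpow_neg (by norm_num)]
      ring_nf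
    have h6 := hk0 k
    calc _ ≤ 352 ^ 2 * (h / 2 ^ k) ^ (-(2 * ε)) * (2 * Real.pi * ((2 / (1 - 2 * σ) + 1 / (2 * σ)) *
          (10 ^ (2 * σ) * (h / 2 ^ k) ^ (2 * σ)))) := by gcongr
      _ = 352 ^ 2 * C1 * ((h / 2 ^ k) ^ (-(2 * ε)) * (h / 2 ^ k) ^ (2 * σ)) := by rw [hC1]; ring
      _ = _ := by rw [h5]; ring
  have hmeas : ∀ k, Measurable (M k) := fun k =>
    (continuous_mellin_fractDiff hσ (by linarith) (Real.exp_pos _)).enorm.measurable.pow_const 2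
  calc _ ≤ ∫⁻ t, ∑' k, ENNReal.ofReal (352 ^ 2 * (h / 2 ^ k) ^ (-(2 * ε))) * M k t :=
        lintegral_mono hpt
    _ = ∑' k, ENNReal.ofReal (352 ^ 2 * (h / 2 ^ k) ^ (-(2 * ε))) * ∫⁻ t, M k t := by
        rw [lintegral_tsum fun k => ((hmeas k).const_mul _).aemeasurable]
        simp only [lintegral_const_mul _ (hmeas _)]
    _ ≤ ∑' k, ENNReal.ofReal (352 ^ 2 * C1 * h ^ p * r ^ k) := ENNReal.tsum_le_tsum hintg
    _ = ENNReal.ofReal (∑' k, 352 ^ 2 * C1 * h ^ p * r ^ k) :=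
        (ENNReal.ofReal_tsum_of_nonneg (fun k => by positivity)
          ((summable_geometric_of_lt_one hr0.le hr1).mul_left _)).symm
    _ ≤ _ := by
        refine ENNReal.ofReal_le_ofReal ?_
        rw [tsum_mul_left, tsum_geometric_of_lt_one hr0.le hr1]
        have : h ^ p ≤ (l - 1) ^ p :=
          Real.rpow_le_rpow hh0.le (Real.log_le_sub_one_of_pos hl0) hp0.le
        calc _ = 352 ^ 2 * C1 * (1 - r)⁻¹ * h ^ p := by ring
          _ ≤ _ := by gcongr

end FractDiffMellin

section SquarefreeCount
open Set Filter Topology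
open scoped ArithmeticFunction.Moebius

lemma sum_moebius_of_sq_dvd {n N : ℕ} (hn : 0 < n) (hN : n ≤ N ^ 2) :
    ∑ d ∈ Finset.Icc 1 N with d ^ 2 ∣ n, μ d = if Squarefree n then 1 else 0 := by
  obtain ⟨a, b, ha, hb, rfl, hsq⟩ := Nat.sq_mul_squarefree_of_pos hn
  have hfil : (Finset.Icc 1 N).filter (fun d => d ^ 2 ∣ b ^ 2 * a) = b.divisors := by
    ext d
    simp only [Finset.mem_filter, Finset.mem_Icc, Nat.mem_divisors]
    constructor
    · rintro ⟨⟨hd1, -⟩, hd⟩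
      refine ⟨?_, hb.ne'⟩
      have hg : 0 < d.gcd b := Nat.gcd_pos_of_pos_right _ hb
      obtain ⟨d', hd'⟩ := Nat.gcd_dvd_left d b
      obtain ⟨b', hb'⟩ := Nat.gcd_dvd_right d b
      have hcop : Nat.Coprime d' b' := by
        have := Nat.coprime_div_gcd_div_gcd hg
        rwa [Nat.div_eq_of_eq_mul_right hg hd', Nat.div_eq_of_eq_mul_right hg hb'] at this
      have h1 : d' ^ 2 ∣ b' ^ 2 * a := by
        have : d.gcd b ^ 2 * d' ^ 2 ∣ d.gcd b ^ 2 * (b' ^ 2 * a) := by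
          rw [← mul_pow, ← hd', ← mul_assoc, ← mul_pow, ← hb']; exact hd
        exact Nat.dvd_of_mul_dvd_mul_left (by positivity) this
      have h2 : d' ^ 2 ∣ a := (hcop.pow 2 2).dvd_of_dvd_mul_left h1
      have h3 : IsUnit d' := hsq d' (by rwa [← sq])
      rw [Nat.isUnit_iff] at h3
      rw [h3, mul_one] at hd'
      rw [hd']; exact Nat.gcd_dvd_right d b
    · rintro ⟨hd, -⟩
      have h1 : d ^ 2 ∣ b ^ 2 * a := (pow_dvd_pow_of_dvd hd 2).mul_right a
      refine ⟨⟨Nat.pos_of_dvd_of_pos hd hb, ?_⟩, h1⟩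
      have := (Nat.le_of_dvd hn h1).trans hN
      exact (Nat.pow_le_pow_iff_left (by norm_num)).mp this
  have hsum : ∑ d ∈ b.divisors, μ d = if b = 1 then 1 else 0 := by
    rw [← ArithmeticFunction.coe_mul_zeta_apply, ArithmeticFunction.moebius_mul_coe_zeta,
      ArithmeticFunction.one_apply]
  rw [hfil, hsum]
  congr 1
  refine propext ⟨fun h => by subst h; simpa using hsq, fun h => ?_⟩
  exact Nat.isUnit_iff.mp (h b (by rw [← sq]; exact Dvd.intro _ rfl))

lemma sum_ite_squarefree_eq {M N : ℕ} (hN : M ≤ N ^ 2) :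
    ∑ m ∈ Finset.Ioc 0 M, (if Squarefree m then (1 : ℝ) else 0) =
      ∑ d ∈ Finset.Icc 1 N, (μ d : ℝ) * ((M / d ^ 2 : ℕ) : ℝ) := by
  have h1 : ∀ m ∈ Finset.Ioc 0 M, (if Squarefree m then (1 : ℝ) else 0) =
      ∑ d ∈ Finset.Icc 1 N, (μ d : ℝ) * (if d ^ 2 ∣ m then 1 else 0) := by
    intro m hm
    rw [Finset.mem_Ioc] at hm
    have := sum_moebius_of_sq_dvd hm.1 (hm.2.trans hN)
    have h := congrArg (fun z : ℤ => (z : ℝ)) this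
    simp only [Finset.sum_filter] at h
    push_cast at h
    rw [← h]
    refine Finset.sum_congr rfl fun d _ => ?_
    split_ifs <;> simp
  rw [Finset.sum_congr rfl h1, Finset.sum_comm]
  refine Finset.sum_congr rfl fun d _ => ?_
  rw [← Finset.mul_sum, ← Nat.Ioc_filter_dvd_card_eq_div, Finset.card_filter]
  push_cast
  rfl

lemma hasSum_moebius_div_sq : HasSum (fun d : ℕ => (μ d : ℝ) / (d : ℝ) ^ 2) (6 / Real.pi ^ 2) := by
  have h1 := (ArithmeticFunction.LSeriesSummable_moebius_iff (s := 2)).mpr (by norm_num)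
  have h2 := ArithmeticFunction.LSeries_zeta_mul_Lseries_moebius (s := 2) (by norm_num)
  rw [ArithmeticFunction.LSeries_zeta_eq_riemannZeta (by norm_num), riemannZeta_two] at h2
  have hpi : (Real.pi : ℂ) ≠ 0 := by exact_mod_cast Real.pi_ne_zero
  have h3 := h1.LSeriesHasSum
  rw [LSeriesHasSum] at h3
  have h4 : LSeries (fun n => ((μ n : ℤ) : ℂ)) 2 = ((6 / Real.pi ^ 2 : ℝ) : ℂ) := by
    push_cast
    field_simp at h2 ⊢
    linear_combination h2
  rw [h4] at h3
  refine Complex.hasSum_ofReal.mp ?_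
  convert h3 using 1
  ext d
  rcases eq_or_ne d 0 with rfl | hd
  · simp
  · rw [LSeries.term_of_ne_zero hd]; push_cast; norm_cast

lemma abs_sub_sum_moebius_div_sq_le {N : ℕ} (hN : 1 ≤ N) :
    |6 / Real.pi ^ 2 - ∑ d ∈ Finset.Icc 1 N, (μ d : ℝ) / (d : ℝ) ^ 2| ≤ (1 : ℝ) / N := by
  have h := hasSum_moebius_div_sq.tendsto_sum_nat
  have h2 := ((tendsto_add_atTop_iff_nat 1).mpr h)
  have h3 := (h2.sub_const (∑ d ∈ Finset.Icc 1 N, (μ d : ℝ) / (d : ℝ) ^ 2)).abs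
  refine le_of_tendsto h3 ?_
  filter_upwards [eventually_ge_atTop N] with n hn
  have e : ∑ i ∈ Finset.range (n + 1), (μ i : ℝ) / (i : ℝ) ^ 2 =
      ∑ d ∈ Finset.Icc 1 N, (μ d : ℝ) / (d : ℝ) ^ 2 + ∑ d ∈ Finset.Ioc N n, (μ d : ℝ) / (d : ℝ) ^ 2 := by
    have h0 : ∀ k, Finset.Icc 1 k = Finset.Ioc 0 k := fun k => by ext; simp [Nat.succ_le_iff]
    rw [h0, ← Finset.sum_union, Finset.Ioc_union_Ioc_eq_Ioc (Nat.zero_le _) hn, Finset.sum_range_succ',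
      ← h0, Finset.range_eq_Ico, Finset.sum_Ico_add' (fun i : ℕ => (μ i : ℝ) / (i : ℝ) ^ 2) 0 n 1]
    · simp; rfl
    · exact Finset.Ioc_disjoint_Ioc_of_le le_rfl
  rw [e, add_sub_cancel_left]
  calc _ ≤ ∑ d ∈ Finset.Ioc N n, |(μ d : ℝ) / (d : ℝ) ^ 2| := Finset.abs_sum_le_sum_abs _ _
    _ ≤ ∑ d ∈ Finset.Ioc N n, ((d : ℝ) ^ 2)⁻¹ := by
      refine Finset.sum_le_sum fun d _ => ?_
      rw [abs_div, abs_of_nonneg (sq_nonneg (d : ℝ)), div_eq_mul_inv]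
      have : |(μ d : ℝ)| ≤ 1 := by exact_mod_cast ArithmeticFunction.abs_moebius_le_one
      exact mul_le_of_le_one_left (by positivity) this
    _ ≤ (N : ℝ)⁻¹ - (n : ℝ)⁻¹ := sum_Ioc_inv_sq_le_sub (by lia) hn
    _ ≤ 1 / N := by rw [one_div]; linarith [inv_nonneg.mpr (Nat.cast_nonneg (α := ℝ) n)]

/-- The discrepancy in the count of squarefree integers up to `y`. -/
noncomputable def sqfError (y : ℝ) : ℝ :=
  ∑ m ∈ Finset.Ioc 0 ⌊y⌋₊, (if Squarefree m then (1 : ℝ) else 0) - 6 * y / Real.pi ^ 2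

lemma measurable_sqfError : Measurable sqfError := by
  refine Measurable.sub ?_ (by fun_prop)
  exact (measurable_from_top (f := fun n : ℕ =>
    ∑ m ∈ Finset.Ioc 0 n, (if Squarefree m then (1 : ℝ) else 0))).comp Nat.measurable_floor

lemma sqfShort_sub_eq (x : ℝ) {H : ℝ} (hH : 0 ≤ H) :
    sqfShort x H - 6 * H / Real.pi ^ 2 = sqfError (x + H) - sqfError x := by
  have h : ⌊x⌋₊ ≤ ⌊x + H⌋₊ := Nat.floor_le_floor (by linarith)
  have e : ∑ m ∈ Finset.Ioc 0 ⌊x + H⌋₊, (if Squarefree m then (1 : ℝ) else 0) =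
      ∑ m ∈ Finset.Ioc 0 ⌊x⌋₊, (if Squarefree m then (1 : ℝ) else 0) + sqfShort x H := by
    rw [sqfShort, ← Finset.sum_union (Finset.Ioc_disjoint_Ioc_of_le le_rfl),
      Finset.Ioc_union_Ioc_eq_Ioc (Nat.zero_le _) h]
  rw [sqfError, sqfError, e]
  ring

lemma abs_sqfError_add_le {y : ℝ} (hy : 0 ≤ y) {N : ℕ} (hN : 1 ≤ N) (hyN : y ≤ N) :
    |sqfError y + ∑ d ∈ Finset.Icc 1 N, (μ d : ℝ) * Int.fract (y / (d : ℝ) ^ 2)| ≤ 1 := by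
  have hfl : ⌊y⌋₊ ≤ N := Nat.floor_le_of_le hyN
  have h1 := sum_ite_squarefree_eq (M := ⌊y⌋₊) (N := N) (hfl.trans (by nlinarith))
  have h2 : ∀ d ∈ Finset.Icc 1 N, (μ d : ℝ) * Int.fract (y / (d : ℝ) ^ 2) =
      y * ((μ d : ℝ) / (d : ℝ) ^ 2) - (μ d : ℝ) * ((⌊y⌋₊ / d ^ 2 : ℕ) : ℝ) := by
    intro d hd
    have : ((⌊y⌋₊ / d ^ 2 : ℕ) : ℝ) = (⌊y / (d : ℝ) ^ 2⌋ : ℝ) := by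
      rw [← natCast_floor_eq_intCast_floor (by positivity)]
      congr 1
      rw [← Nat.floor_div_natCast]; push_cast; rfl
    rw [this, ← Int.self_sub_floor]
    ring
  have h3 : sqfError y + ∑ d ∈ Finset.Icc 1 N, (μ d : ℝ) * Int.fract (y / (d : ℝ) ^ 2) =
      -(y * (6 / Real.pi ^ 2 - ∑ d ∈ Finset.Icc 1 N, (μ d : ℝ) / (d : ℝ) ^ 2)) := by
    rw [Finset.sum_congr rfl h2, Finset.sum_sub_distrib, ← Finset.mul_sum, sqfError, h1]
    ring
  rw [h3, abs_neg, abs_mul, abs_of_nonneg hy]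
  have h4 := abs_sub_sum_moebius_div_sq_le hN
  have hN0 : (0:ℝ) < N := by exact_mod_cast hN
  calc _ ≤ (N : ℝ) * (1 / N) := by gcongr
    _ = 1 := by field_simp

end SquarefreeCount

section RieszPlancherel
open Set Filter Topology
open scoped ENNReal ArithmeticFunction.Moebius

/-- The Riesz-smoothed Möbius average of the dilates of `fractDiff l`. -/
noncomputable def rieszFractDiff (N : ℕ) (l x : ℝ) : ℝ :=
  ∑ d ∈ Finset.Icc 1 N, (μ d : ℝ) * (1 - (d : ℝ) / N) * fractDiff l (x / (d : ℝ) ^ 2)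

lemma measurable_rieszFractDiff (N : ℕ) (l : ℝ) : Measurable (rieszFractDiff N l) :=
  Finset.measurable_fun_sum _ fun _ _ =>
    ((measurable_fractDiff l).comp (measurable_id.div_const _)).const_mul _

lemma HasMellin.finset_sum {ι : Type*} (S : Finset ι) {f : ι → ℝ → ℂ} {s : ℂ} {m : ι → ℂ}
    (h : ∀ i ∈ S, HasMellin (f i) s (m i)) :
    HasMellin (fun t => ∑ i ∈ S, f i t) s (∑ i ∈ S, m i) := by
  constructor
  · simpa only [MellinConvergent, Finset.smul_sum] using! integrable_finsetSum S fun i hi => (h i hi).1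
  · simp only [mellin, Finset.smul_sum]
    rw [integral_finsetSum S fun i hi => (h i hi).1]
    exact Finset.sum_congr rfl fun i hi => (h i hi).2

lemma HasMellin.const_mul {f : ℝ → ℂ} {s m : ℂ} (h : HasMellin f s m) (a : ℂ) :
    HasMellin (fun t => a * f t) s (a * m) :=
  ⟨by simpa only [smul_eq_mul] using! h.1.const_smul a, by
    simpa only [smul_eq_mul, h.2] using! mellin_const_smul f s a⟩

lemma hasMellin_rieszFractDiff {s : ℂ} (hs : 0 < s.re) (hs1 : s.re < 1) {l : ℝ} (hl : 0 < l) (N : ℕ) :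
    HasMellin (fun x => (rieszFractDiff N l x : ℂ)) (-s)
      (rieszMoebius N (2 * s) * mellin (fun x => (fractDiff l x : ℂ)) (-s)) := by
  have h0 := hasMellin_fractDiff hs hs1 hl
  have h1 : HasMellin (fun x => (fractDiff l x : ℂ)) (-s) (mellin (fun x => (fractDiff l x : ℂ)) (-s)) :=
    ⟨h0.1, rfl⟩
  have h2 := HasMellin.finset_sum (Finset.Icc 1 N) (s := -s)
    (f := fun d x => ((μ d : ℂ) * ((1 - (d : ℝ) / N : ℝ) : ℂ)) *
      (fractDiff l (((d : ℝ) ^ 2)⁻¹ * x) : ℂ)) (fun d hd =>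
      (h1.comp_mul_left (a := ((d : ℝ) ^ 2)⁻¹)
        (by rw [Finset.mem_Icc] at hd
            have : (0:ℝ) < d := by exact_mod_cast hd.1
            positivity)).const_mul _)
  convert h2 using 1
  · ext x
    rw [rieszFractDiff]
    push_cast
    refine Finset.sum_congr rfl fun d _ => ?_
    rw [div_eq_inv_mul x]
  · rw [rieszMoebius, Finset.sum_mul]
    refine Finset.sum_congr rfl fun d hd => ?_
    rw [Finset.mem_Icc] at hd
    have hd0 : (d : ℂ) ≠ 0 := by exact_mod_cast (by lia : d ≠ 0)
    have e : ((((d : ℝ) ^ 2)⁻¹ : ℝ) : ℂ) ^ (- -s) = (d : ℂ) ^ (-(2 * s)) := by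
      push_cast
      rw [neg_neg, Complex.inv_cpow _ _ (by
        rw [← Complex.ofReal_natCast, ← Complex.ofReal_pow, Complex.arg_ofReal_of_nonneg (by positivity)]
        exact Real.pi_pos.ne), Complex.cpow_neg, sq, Complex.natCast_mul_natCast_cpow,
        two_mul, Complex.cpow_add _ _ hd0]
    rw [e]; ring

lemma abs_rieszFractDiff_le {N : ℕ} {l x : ℝ} (B : ℝ)
    (hB : ∀ d ∈ Finset.Icc 1 N, |fractDiff l (x / (d : ℝ) ^ 2)| ≤ B) : |rieszFractDiff N l x| ≤ N * B := by
  calc _ ≤ ∑ d ∈ Finset.Icc 1 N, |(μ d : ℝ) * (1 - (d : ℝ) / N) * fractDiff l (x / (d : ℝ) ^ 2)| :=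
        Finset.abs_sum_le_sum_abs _ _
    _ ≤ ∑ d ∈ Finset.Icc 1 N, B := by
        refine Finset.sum_le_sum fun d hd => ?_
        have h1 : |(μ d : ℝ)| ≤ 1 := by exact_mod_cast ArithmeticFunction.abs_moebius_le_one
        have h2 : |1 - (d : ℝ) / N| ≤ 1 := by
          have h3 : (d : ℝ) / N ≤ 1 := div_le_one_of_le₀ (by exact_mod_cast (Finset.mem_Icc.mp hd).2) (by positivity)
          have h4 : (0:ℝ) ≤ (d : ℝ) / N := by positivity
          rw [abs_le]; constructor <;> linarith
        rw [abs_mul, abs_mul]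
        have := hB d hd
        calc _ ≤ 1 * 1 * B := by gcongr
          _ = B := by ring
    _ = N * B := by simp

lemma lintegral_rieszFractDiff_ne_top {σ l : ℝ} (hσ : 0 < σ) (hσ' : σ < 1 / 2) (hl : 1 ≤ l) (hl' : l ≤ 10)
    (N : ℕ) : ∫⁻ x in Ioi (0 : ℝ), ‖(rieszFractDiff N l x : ℂ)‖ₑ ^ 2 * ENNReal.ofReal (x ^ (2 * -σ - 1)) ≠ ⊤ := by
  have e : ∀ x : ℝ, ‖(rieszFractDiff N l x : ℂ)‖ₑ ^ 2 * ENNReal.ofReal (x ^ (2 * -σ - 1)) =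
      ENNReal.ofReal (rieszFractDiff N l x ^ 2 * x ^ (2 * -σ - 1)) := by
    intro x
    rw [ENNReal.ofReal_mul (sq_nonneg _), ← sq_abs, ENNReal.ofReal_pow (abs_nonneg _),
      ← ofReal_norm, Complex.norm_real, Real.norm_eq_abs]
  simp only [e]
  have hmeas : AEStronglyMeasurable (fun x : ℝ => rieszFractDiff N l x ^ 2 * x ^ (2 * -σ - 1))
      (volume : Measure ℝ) :=
    (((measurable_rieszFractDiff N l).pow_const 2).mul (measurable_id.pow_const _)).aestronglyMeasurable
  have key : IntegrableOn (fun x : ℝ => rieszFractDiff N l x ^ 2 * x ^ (2 * -σ - 1)) (Ioi 0) := by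
    rw [← Ioc_union_Ioi_eq_Ioi zero_le_one]
    refine IntegrableOn.union ?_ ?_
    · have i1 : IntegrableOn (fun x : ℝ => (10 * N) ^ 2 * x ^ (1 - 2 * σ)) (Ioc (0:ℝ) 1) := by
        refine Integrable.const_mul ?_ _
        exact (intervalIntegrable_iff_integrableOn_Ioc_of_le zero_le_one).mp
          (intervalIntegral.intervalIntegrable_rpow' (by linarith))
      refine i1.mono' hmeas.restrict ?_
      filter_upwards [ae_restrict_mem measurableSet_Ioc] with x hx
      have hx0 := hx.1
      rw [Real.norm_of_nonneg (by positivity)]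
      have h1 := abs_rieszFractDiff_le (N := N) (l := l) (x := x) (10 * x) fun d hd => by
        refine (abs_fractDiff_le_mul hl hl' (by positivity)).trans ?_
        have : (1:ℝ) ≤ d := by exact_mod_cast (Finset.mem_Icc.mp hd).1
        gcongr
        exact div_le_self hx0.le (one_le_pow₀ this)
      have h2 : x ^ (1 - 2 * σ) = x ^ 2 * x ^ (2 * -σ - 1) := by
        rw [← Real.rpow_natCast, ← Real.rpow_add hx0]; congr 1; push_cast; ring
      rw [h2, ← sq_abs, ← mul_assoc]
      have h3 := pow_le_pow_left₀ (abs_nonneg _) h1 2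
      calc _ ≤ (N * (10 * x)) ^ 2 * x ^ (2 * -σ - 1) := by gcongr
        _ = _ := by ring
    · refine ((integrableOn_Ioi_rpow_of_lt (a := 2 * -σ - 1) (by linarith) one_pos).const_mul
        ((N : ℝ) ^ 2)).mono' hmeas.restrict ?_
      filter_upwards [ae_restrict_mem measurableSet_Ioi] with x hx
      have hx0 : (0:ℝ) < x := one_pos.trans hx
      rw [Real.norm_of_nonneg (by positivity), ← sq_abs]
      have h1 := abs_rieszFractDiff_le (N := N) (l := l) (x := x) 1 fun d hd => abs_fractDiff_le_one _ _
      rw [mul_one] at h1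
      gcongr
  rw [← ofReal_integral_eq_lintegral_ofReal key]
  · exact ENNReal.ofReal_ne_top
  · filter_upwards [ae_restrict_mem measurableSet_Ioi] with x hx
    exact mul_nonneg (sq_nonneg _) (Real.rpow_nonneg (le_of_lt hx) _)

lemma exists_lintegral_rieszFractDiff_le (hRH : RiemannHypothesis) {σ ε κ : ℝ} (hσ : 1 / 4 < σ)
    (hσ' : σ < 1 / 2) (hε : 0 < ε) (hεσ : ε < σ) (hκ : 0 < κ) (hκ1 : κ ≤ 1) :
    ∃ C : ℝ, 0 < C ∧ ∀ (N : ℕ) (l : ℝ), 1 ≤ N → 1 < l → l ≤ 10 →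
      ∫⁻ x in Ioi (0 : ℝ), ‖(rieszFractDiff N l x : ℂ)‖ₑ ^ 2 * ENNReal.ofReal (x ^ (2 * -σ - 1)) ≤
        ENNReal.ofReal (C * (N : ℝ) ^ (2 * κ) * (l - 1) ^ (2 * σ - 2 * ε)) := by
  obtain ⟨C₁, hC₁, h1⟩ := exists_norm_rieszMoebius_le hRH (η := 2 * σ - 1 / 2) (ε := ε) (κ := κ)
    (by linarith) (by linarith) hε (by linarith) hκ hκ1
  obtain ⟨C₂, hC₂, h2⟩ := exists_lintegral_mellin_fractDiff_weighted_le hε hεσ hσ'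
  refine ⟨(2 * C₁) ^ 2 * C₂, by positivity, fun N l hN hl hl' => ?_⟩
  have hfin := lintegral_rieszFractDiff_ne_top (by linarith : 0 < σ) hσ' hl.le hl' N
  have hl0 : 0 < l := by linarith
  have hl1 : 0 < l - 1 := by linarith
  have hP := lintegral_enorm_sq_mellin (c := -σ) (f := fun x => (rieszFractDiff N l x : ℂ)) (by
    push_cast
    exact (hasMellin_rieszFractDiff (s := σ) (by simp; linarith) (by simp; linarith) hl0 N).1) hfin
  have hle : ∫⁻ x in Ioi (0 : ℝ), ‖(rieszFractDiff N l x : ℂ)‖ₑ ^ 2 * ENNReal.ofReal (x ^ (2 * -σ - 1)) ≤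
      ∫⁻ t : ℝ, ‖mellin (fun x => (rieszFractDiff N l x : ℂ)) ((-σ : ℝ) + t * Complex.I)‖ₑ ^ 2 := by
    rw [hP]
    refine le_mul_of_one_le_left zero_le ?_
    rw [ENNReal.one_le_ofReal]
    linarith [Real.pi_gt_three]
  refine hle.trans ?_
  have hpt : ∀ t : ℝ, ‖mellin (fun x => (rieszFractDiff N l x : ℂ)) ((-σ : ℝ) + t * Complex.I)‖ₑ ^ 2 ≤
      ENNReal.ofReal ((2 * C₁) ^ 2 * (N : ℝ) ^ (2 * κ)) *
      (‖mellin (fun x => (fractDiff l x : ℂ)) ((-σ : ℝ) + t * Complex.I)‖ₑ ^ 2 *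
        ENNReal.ofReal ((1 + |t|) ^ (2 * ε))) := by
    intro t
    set s : ℂ := σ - t * Complex.I with hs
    have hsre : s.re = σ := by simp [hs]
    have e0 : ((-σ : ℝ) : ℂ) + t * Complex.I = -s := by rw [hs]; push_cast; ring
    have e1 : ∀ z : ℂ, ‖z‖ₑ ^ 2 = ENNReal.ofReal (‖z‖ ^ 2) := fun z => by
      rw [ENNReal.ofReal_pow (norm_nonneg _), ofReal_norm]
    have hw := h1 N hN (2 * s) (by simp [hsre])
    have him : |(2 * s).im| = 2 * |t| := by simp [hs, abs_mul]
    rw [him] at hw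
    have hw2 : ‖rieszMoebius N (2 * s)‖ ≤ 2 * C₁ * (N : ℝ) ^ κ * (1 + |t|) ^ ε := by
      refine hw.trans ?_
      have h3 : (1 + 2 * |t|) ^ ε ≤ 2 * (1 + |t|) ^ ε := by
        calc (1 + 2 * |t|) ^ ε ≤ (2 * (1 + |t|)) ^ ε := by gcongr; linarith
          _ = 2 ^ ε * (1 + |t|) ^ ε := Real.mul_rpow (by norm_num) (by positivity)
          _ ≤ 2 * (1 + |t|) ^ ε := by
            have : (2:ℝ) ^ ε ≤ 2 ^ (1:ℝ) := Real.rpow_le_rpow_of_exponent_le (by norm_num) (by linarith)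
            rw [Real.rpow_one] at this
            gcongr
      calc _ ≤ C₁ * (N : ℝ) ^ κ * (2 * (1 + |t|) ^ ε) := by gcongr
        _ = _ := by ring
    rw [e0, (hasMellin_rieszFractDiff (s := s) (by rw [hsre]; linarith) (by rw [hsre]; linarith) hl0 N).2,
      e1, e1, ← ENNReal.ofReal_mul (by positivity), ← ENNReal.ofReal_mul (by positivity)]
    refine ENNReal.ofReal_le_ofReal ?_
    have e2 : (1 + |t|) ^ (2 * ε) = ((1 + |t|) ^ ε) ^ 2 := by
      rw [← Real.rpow_mul_natCast (by positivity)]; ring_nf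
    have e3 : (N : ℝ) ^ (2 * κ) = ((N : ℝ) ^ κ) ^ 2 := by
      rw [← Real.rpow_mul_natCast (by positivity)]; ring_nf
    rw [e2, e3, norm_mul, mul_pow]
    have := pow_le_pow_left₀ (norm_nonneg _) hw2 2
    calc _ ≤ (2 * C₁ * (N : ℝ) ^ κ * (1 + |t|) ^ ε) ^ 2 * _ := mul_le_mul_of_nonneg_right this (sq_nonneg _)
      _ = _ := by ring
  calc _ ≤ _ := lintegral_mono hpt
    _ = _ := lintegral_const_mul' _ _ ENNReal.ofReal_ne_top
    _ ≤ _ := mul_le_mul_right (h2 l hl hl') _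
    _ = _ := by
      rw [← ENNReal.ofReal_mul (by positivity)]
      congr 1; ring

end RieszPlancherel

section SaffariVaughan
open Set Filter Topology
open scoped ENNReal

lemma setLIntegral_Ioc_comp_add_right {f : ℝ → ℝ≥0∞} (a b c : ℝ) :
    ∫⁻ x in Ioc a b, f (x + c) = ∫⁻ x in Ioc (a + c) (b + c), f x := by
  have h := (measurePreserving_add_right (volume : Measure ℝ) c).setLIntegral_comp_preimage_emb
    (MeasurableEquiv.addRight c).measurableEmbedding f (Ioc (a + c) (b + c))
  rw [← h]
  congr 2
  ext x; simp

/-- Passing from additive to multiplicative short intervals on average. -/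
lemma lintegral_sub_sq_le_of_dilates {E : ℝ → ℝ} (hE : Measurable E) {X H : ℝ} (hX : 0 < X) (hH : 0 < H)
    (hHX : H ≤ X) {B : ℝ≥0∞}
    (hB : ∀ θ : ℝ, 0 < θ → θ ≤ 3 * H / X →
      ∫⁻ y in Ioc X (3 * X), ENNReal.ofReal ((E ((1 + θ) * y) - E y) ^ 2) ≤ B) :
    ∫⁻ x in Ioc X (2 * X), ENNReal.ofReal ((E (x + H) - E x) ^ 2) ≤ 36 * B := by
  set D : ℝ → ℝ → ℝ≥0∞ := fun x v => ENNReal.ofReal ((E (x + v) - E x) ^ 2) with hD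
  have hDm : Measurable (Function.uncurry D) := by
    refine ENNReal.measurable_ofReal.comp (Measurable.pow_const ?_ 2)
    exact (hE.comp (measurable_fst.add measurable_snd)).sub (hE.comp measurable_fst)
  have hDm1 : ∀ x, Measurable (D x) := fun x => hDm.comp measurable_prodMk_left
  set W : ℝ≥0∞ := ∫⁻ y in Ioc X (3 * X), ∫⁻ u in Ioc H (3 * H), D y u with hW
  have hsplit : ∀ x v, D x H ≤ 2 * D x v + 2 * D (x + H) (v - H) := by
    intro x v
    simp only [hD]
    have h2 : (2 : ℝ≥0∞) = ENNReal.ofReal 2 := by simp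
    rw [h2, ← ENNReal.ofReal_mul (by norm_num), ← ENNReal.ofReal_mul (by norm_num),
      ← ENNReal.ofReal_add (by positivity) (by positivity)]
    refine ENNReal.ofReal_le_ofReal ?_
    rw [show x + H + (v - H) = x + v by ring]
    nlinarith [sq_nonneg ((E (x + v) - E x) + (E (x + v) - E (x + H)))]
  have hvol : ∀ c : ℝ≥0∞, ∫⁻ _ in Ioc (2 * H) (3 * H), c = ENNReal.ofReal H * c := by
    intro c
    rw [setLIntegral_const, Real.volume_Ioc, mul_comm]; congr 2; ring
  have h1 : ENNReal.ofReal H * ∫⁻ x in Ioc X (2 * X), D x H ≤ 4 * W := by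
    rw [← lintegral_const_mul' _ _ ENNReal.ofReal_ne_top]
    calc ∫⁻ x in Ioc X (2 * X), ENNReal.ofReal H * D x H
        ≤ ∫⁻ x in Ioc X (2 * X), (2 * (∫⁻ v in Ioc (2 * H) (3 * H), D x v) +
            2 * ∫⁻ u in Ioc H (2 * H), D (x + H) u) := by
          refine lintegral_mono fun x => ?_
          rw [← hvol]
          refine (lintegral_mono fun v => hsplit x v).trans ?_
          rw [lintegral_add_left ((hDm1 x).const_mul _), lintegral_const_mul' _ _ (by simp),
            lintegral_const_mul' _ _ (by simp)]
          refine add_le_add le_rfl (mul_le_mul_right (le_of_eq ?_) _)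
          have := setLIntegral_Ioc_comp_add_right (f := D (x + H)) (2 * H) (3 * H) (-H)
          simp only [← sub_eq_add_neg] at this
          rw [this]; congr 3 <;> ring
      _ = 2 * (∫⁻ x in Ioc X (2 * X), ∫⁻ v in Ioc (2 * H) (3 * H), D x v) +
            2 * ∫⁻ x in Ioc X (2 * X), ∫⁻ u in Ioc H (2 * H), D (x + H) u := by
          rw [lintegral_add_left, lintegral_const_mul' _ _ (by simp), lintegral_const_mul' _ _ (by simp)]
          exact (hDm.lintegral_prod_right').const_mul _
      _ ≤ 2 * W + 2 * W := by
          refine add_le_add (mul_le_mul_right ?_ _) (mul_le_mul_right ?_ _)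
          · refine (lintegral_mono fun x => lintegral_mono_set
              (Ioc_subset_Ioc_left (by linarith : H ≤ 2 * H))).trans ?_
            exact lintegral_mono_set (Ioc_subset_Ioc_right (by linarith))
          · rw [setLIntegral_Ioc_comp_add_right (f := fun y => ∫⁻ u in Ioc H (2 * H), D y u)]
            refine (lintegral_mono fun x => lintegral_mono_set
              (Ioc_subset_Ioc_right (by linarith : 2 * H ≤ 3 * H))).trans ?_
            exact lintegral_mono_set (Ioc_subset_Ioc (by linarith) (by linarith))
      _ = 4 * W := by rw [← add_mul]; norm_num
  have h2 : W ≤ ENNReal.ofReal (3 * X) * (ENNReal.ofReal (3 * H / X) * B) := by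
    calc W ≤ ∫⁻ y in Ioc X (3 * X), ENNReal.ofReal (3 * X) *
            ∫⁻ θ in Ioc 0 (3 * H / X), D y (y * θ) := by
          refine setLIntegral_mono' measurableSet_Ioc fun y hy => ?_
          have hy0 : 0 < y := hX.trans hy.1
          have hsub : Ioc H (3 * H) ⊆ (fun θ => y * θ) '' Ioc 0 (3 * H / X) := by
            intro u hu
            refine ⟨u / y, ⟨div_pos (hH.trans hu.1) hy0, ?_⟩, by field_simp⟩
            exact div_le_div₀ (by positivity) hu.2 hX hy.1.le
          refine (lintegral_mono_set hsub).trans ?_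
          rw [lintegral_image_eq_lintegral_abs_deriv_mul (f' := fun _ => y) measurableSet_Ioc
            (fun x _ => by simpa using ((hasDerivAt_id x).const_mul y).hasDerivWithinAt)
            (fun a _ b _ h => mul_left_cancel₀ hy0.ne' h), lintegral_const_mul' _ _ ENNReal.ofReal_ne_top,
            abs_of_pos hy0]
          exact mul_le_mul_left (ENNReal.ofReal_le_ofReal hy.2) _
      _ = ENNReal.ofReal (3 * X) * ∫⁻ θ in Ioc 0 (3 * H / X), ∫⁻ y in Ioc X (3 * X), D y (y * θ) := by
          rw [lintegral_const_mul' _ _ ENNReal.ofReal_ne_top, lintegral_lintegral_swap]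
          exact (hDm.comp (measurable_fst.prodMk (measurable_fst.mul measurable_snd))).aemeasurable
      _ ≤ ENNReal.ofReal (3 * X) * ∫⁻ _ in Ioc 0 (3 * H / X), B := by
          refine mul_le_mul_right (setLIntegral_mono' measurableSet_Ioc fun θ hθ => ?_) _
          refine le_trans (le_of_eq ?_) (hB θ hθ.1 hθ.2)
          refine lintegral_congr fun y => ?_
          simp only [hD]
          rw [show y + y * θ = (1 + θ) * y by ring]
      _ = _ := by rw [setLIntegral_const, Real.volume_Ioc, sub_zero, mul_comm B]
  have h3 : ENNReal.ofReal H * ∫⁻ x in Ioc X (2 * X), D x H ≤ ENNReal.ofReal H * (36 * B) := by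
    refine h1.trans ((mul_le_mul_right h2 _).trans (le_of_eq ?_))
    rw [← mul_assoc (ENNReal.ofReal (3 * X)), ← ENNReal.ofReal_mul (by positivity),
      show 3 * X * (3 * H / X) = 9 * H by field_simp; norm_num, ENNReal.ofReal_mul (by norm_num),
      ENNReal.ofReal_ofNat]
    ring
  exact (ENNReal.mul_le_mul_iff_right (by simpa using hH) ENNReal.ofReal_ne_top).mp h3

end SaffariVaughan

section LongIntervals
open Set Filter Topology
open scoped ENNReal ArithmeticFunction.Moebius

lemma sum_Icc_inv_le_two_mul {n : ℕ} (hn : 1 ≤ n) : ∑ d ∈ Finset.Icc 1 (n ^ 2), (1 : ℝ) / d ≤ 2 * n := by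
  have h := harmonic_le_one_add_log (n ^ 2)
  rw [harmonic_eq_sum_Icc] at h
  push_cast at h
  have hn0 : (0:ℝ) < n := by exact_mod_cast hn
  have h2 := Real.log_le_sub_one_of_pos hn0
  rw [Real.log_pow] at h
  simp only [one_div]
  push_cast at h
  linarith

lemma abs_sqfError_sub_sub_le {x l : ℝ} (hx : 0 ≤ x) (hl : 1 ≤ l) (hl' : l ≤ 10) {n : ℕ} (hn : 1 ≤ n)
    (hxn : l * x ≤ n) : |sqfError (l * x) - sqfError x - rieszFractDiff (n ^ 2) l x| ≤ 22 := by
  have hn1 : (1:ℝ) ≤ n := by exact_mod_cast hn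
  have hN : 1 ≤ n ^ 2 := Nat.one_le_pow _ _ hn
  have hnN : (n : ℝ) ≤ ((n ^ 2 : ℕ) : ℝ) := by push_cast; nlinarith
  have hxl : x ≤ l * x := by nlinarith
  have h1 := abs_sqfError_add_le (y := l * x) (by positivity) hN (hxn.trans hnN)
  have h2 := abs_sqfError_add_le (y := x) hx hN (hxl.trans (hxn.trans hnN))
  set A := ∑ d ∈ Finset.Icc 1 (n ^ 2), (μ d : ℝ) * Int.fract (l * x / (d : ℝ) ^ 2) with hA
  set B := ∑ d ∈ Finset.Icc 1 (n ^ 2), (μ d : ℝ) * Int.fract (x / (d : ℝ) ^ 2) with hB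
  have h3 : B - A - rieszFractDiff (n ^ 2) l x =
      ∑ d ∈ Finset.Icc 1 (n ^ 2), (μ d : ℝ) * ((d : ℝ) / (n ^ 2 : ℕ)) * fractDiff l (x / (d : ℝ) ^ 2) := by
    rw [hA, hB, rieszFractDiff, ← Finset.sum_sub_distrib, ← Finset.sum_sub_distrib]
    refine Finset.sum_congr rfl fun d _ => ?_
    rw [fractDiff, mul_div_assoc]; ring
  have h4 : |B - A - rieszFractDiff (n ^ 2) l x| ≤ 20 := by
    rw [h3]
    calc _ ≤ ∑ d ∈ Finset.Icc 1 (n ^ 2),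
          |(μ d : ℝ) * ((d : ℝ) / (n ^ 2 : ℕ)) * fractDiff l (x / (d : ℝ) ^ 2)| :=
          Finset.abs_sum_le_sum_abs _ _
      _ ≤ ∑ d ∈ Finset.Icc 1 (n ^ 2), 10 * x / (n ^ 2 : ℕ) * (1 / d) := by
          refine Finset.sum_le_sum fun d hd => ?_
          have hd0 : (0:ℝ) < d := by exact_mod_cast (Finset.mem_Icc.mp hd).1
          have h5 : |(μ d : ℝ)| ≤ 1 := by exact_mod_cast ArithmeticFunction.abs_moebius_le_one
          have h6 := abs_fractDiff_le_mul (l := l) (x := x / (d : ℝ) ^ 2) hl hl' (by positivity)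
          rw [abs_mul, abs_mul, abs_of_nonneg (by positivity : (0:ℝ) ≤ (d : ℝ) / (n ^ 2 : ℕ))]
          calc _ ≤ 1 * ((d : ℝ) / (n ^ 2 : ℕ)) * (10 * (x / (d : ℝ) ^ 2)) := by gcongr
            _ = _ := by field_simp
      _ = 10 * x / (n ^ 2 : ℕ) * ∑ d ∈ Finset.Icc 1 (n ^ 2), (1 : ℝ) / d := by rw [Finset.mul_sum]
      _ ≤ 10 * x / (n ^ 2 : ℕ) * (2 * n) := by
          gcongr
          exact sum_Icc_inv_le_two_mul hn
      _ ≤ 20 := by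
          push_cast
          rw [div_mul_eq_mul_div, div_le_iff₀ (by positivity)]
          nlinarith
  have h5 : sqfError (l * x) - sqfError x - rieszFractDiff (n ^ 2) l x =
      (sqfError (l * x) + A) - (sqfError x + B) + (B - A - rieszFractDiff (n ^ 2) l x) := by ring
  rw [h5]
  rw [abs_le] at *
  constructor <;> linarith

lemma exists_lintegral_sqfError_dilate_le (hRH : RiemannHypothesis) {σ ε κ : ℝ} (hσ : 1 / 4 < σ)
    (hσ' : σ < 1 / 2) (hε : 0 < ε) (hεσ : ε < σ) (hκ : 0 < κ) (hκ1 : κ ≤ 1) :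
    ∃ C : ℝ, 0 < C ∧ ∀ X l : ℝ, 1 ≤ X → 1 < l → l ≤ 10 →
      ∫⁻ x in Ioc X (3 * X), ENNReal.ofReal ((sqfError (l * x) - sqfError x) ^ 2) ≤
        ENNReal.ofReal (C * (X ^ (2 * σ + 1 + 4 * κ) * (l - 1) ^ (2 * σ - 2 * ε) + X)) := by
  obtain ⟨C, hC, h⟩ := exists_lintegral_rieszFractDiff_le hRH hσ hσ' hε hεσ hκ hκ1
  refine ⟨18 * C * 31 ^ 4 + 1936, by positivity, fun X l hX hl hl' => ?_⟩
  have hX0 : 0 < X := by linarith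
  have hl1 : 0 < l - 1 := by linarith
  set n := ⌈30 * X⌉₊ with hn
  have hn1 : 30 * X ≤ n := Nat.le_ceil _
  have hn2 : (n : ℝ) ≤ 31 * X := by
    have := (Nat.ceil_lt_add_one (by positivity : 0 ≤ 30 * X)).le
    linarith
  have hn3 : 1 ≤ n := by
    have : (1:ℝ) ≤ n := by linarith
    exact_mod_cast this
  have hG := h (n ^ 2) l (Nat.one_le_pow _ _ hn3) hl hl'
  have hpt : ∀ x ∈ Ioc X (3 * X), ENNReal.ofReal ((sqfError (l * x) - sqfError x) ^ 2) ≤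
      ENNReal.ofReal (2 * (9 * X ^ (2 * σ + 1))) *
        (‖(rieszFractDiff (n ^ 2) l x : ℂ)‖ₑ ^ 2 * ENNReal.ofReal (x ^ (2 * -σ - 1))) +
      ENNReal.ofReal 968 := by
    intro x hx
    have hx0 : 0 < x := hX0.trans hx.1
    have h1 := abs_sqfError_sub_sub_le hx0.le hl.le hl' hn3 (x := x) (by nlinarith [hx.2])
    set g := rieszFractDiff (n ^ 2) l x with hg
    rw [← ofReal_norm, Complex.norm_real, Real.norm_eq_abs, ← ENNReal.ofReal_pow (abs_nonneg _), sq_abs,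
      ← ENNReal.ofReal_mul (sq_nonneg _), ← ENNReal.ofReal_mul (by positivity),
      ← ENNReal.ofReal_add (by positivity) (by norm_num)]
    refine ENNReal.ofReal_le_ofReal ?_
    have h2 : 1 ≤ 9 * X ^ (2 * σ + 1) * x ^ (2 * -σ - 1) := by
      have h3 : x ^ (2 * σ + 1) ≤ 9 * X ^ (2 * σ + 1) := by
        calc x ^ (2 * σ + 1) ≤ (3 * X) ^ (2 * σ + 1) := Real.rpow_le_rpow hx0.le hx.2 (by linarith)
          _ = 3 ^ (2 * σ + 1) * X ^ (2 * σ + 1) := Real.mul_rpow (by norm_num) hX0.le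
          _ ≤ 9 * X ^ (2 * σ + 1) := by
            have : (3:ℝ) ^ (2 * σ + 1) ≤ 3 ^ (2:ℝ) :=
              Real.rpow_le_rpow_of_exponent_le (by norm_num) (by linarith)
            norm_num at this
            gcongr
      calc 1 = x ^ (2 * σ + 1) * x ^ (2 * -σ - 1) := by
            rw [← Real.rpow_add hx0]; ring_nf; simp
        _ ≤ _ := by gcongr
    have h4 : (sqfError (l * x) - sqfError x) ^ 2 ≤ 2 * g ^ 2 + 968 := by
      have h5 : (sqfError (l * x) - sqfError x - g) ^ 2 ≤ 22 ^ 2 := sq_le_sq' (by linarith [(abs_le.mp h1).1]) (abs_le.mp h1).2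
      nlinarith [sq_nonneg (sqfError (l * x) - sqfError x - g - g)]
    nlinarith [sq_nonneg g, mul_le_mul_of_nonneg_left h2 (sq_nonneg g)]
  have hval : (((n ^ 2 : ℕ) : ℝ)) ^ (2 * κ) ≤ 31 ^ 4 * X ^ (4 * κ) := by
    calc (((n ^ 2 : ℕ) : ℝ)) ^ (2 * κ) = (n : ℝ) ^ (4 * κ) := by
          push_cast
          rw [← Real.rpow_natCast, ← Real.rpow_mul (by positivity)]; congr 1; push_cast; ring
      _ ≤ (31 * X) ^ (4 * κ) := Real.rpow_le_rpow (by positivity) hn2 (by positivity)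
      _ = 31 ^ (4 * κ) * X ^ (4 * κ) := Real.mul_rpow (by norm_num) hX0.le
      _ ≤ 31 ^ 4 * X ^ (4 * κ) := by
          gcongr
          rw [← Real.rpow_natCast]
          exact Real.rpow_le_rpow_of_exponent_le (by norm_num) (by push_cast; linarith)
  calc _ ≤ ∫⁻ x in Ioc X (3 * X), (ENNReal.ofReal (2 * (9 * X ^ (2 * σ + 1))) *
        (‖(rieszFractDiff (n ^ 2) l x : ℂ)‖ₑ ^ 2 * ENNReal.ofReal (x ^ (2 * -σ - 1))) +
          ENNReal.ofReal 968) := setLIntegral_mono' measurableSet_Ioc hpt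
    _ = ENNReal.ofReal (2 * (9 * X ^ (2 * σ + 1))) * (∫⁻ x in Ioc X (3 * X),
        ‖(rieszFractDiff (n ^ 2) l x : ℂ)‖ₑ ^ 2 * ENNReal.ofReal (x ^ (2 * -σ - 1))) +
          ENNReal.ofReal 968 * ENNReal.ofReal (2 * X) := by
        rw [lintegral_add_right _ measurable_const, lintegral_const_mul' _ _ ENNReal.ofReal_ne_top,
          setLIntegral_const, Real.volume_Ioc]
        ring_nf
    _ ≤ ENNReal.ofReal (2 * (9 * X ^ (2 * σ + 1))) *
        ENNReal.ofReal (C * ((n ^ 2 : ℕ) : ℝ) ^ (2 * κ) * (l - 1) ^ (2 * σ - 2 * ε)) +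
          ENNReal.ofReal 968 * ENNReal.ofReal (2 * X) := by
        refine add_le_add (mul_le_mul_right ?_ _) le_rfl
        exact (lintegral_mono_set fun x hx => hX0.trans hx.1).trans hG
    _ ≤ _ := by
        rw [← ENNReal.ofReal_mul (by positivity), ← ENNReal.ofReal_mul (by norm_num),
          ← ENNReal.ofReal_add (by positivity) (by positivity)]
        refine ENNReal.ofReal_le_ofReal ?_
        have e : X ^ (2 * σ + 1 + 4 * κ) = X ^ (2 * σ + 1) * X ^ (4 * κ) := Real.rpow_add hX0 _ _
        set P := (l - 1) ^ (2 * σ - 2 * ε) with hP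
        have hP0 : 0 ≤ P := by positivity
        have hQ : 0 ≤ X ^ (2 * σ + 1 + 4 * κ) * P := by positivity
        calc _ ≤ 2 * (9 * X ^ (2 * σ + 1)) * (C * (31 ^ 4 * X ^ (4 * κ)) * P) + 968 * (2 * X) := by gcongr
          _ = 18 * C * 31 ^ 4 * (X ^ (2 * σ + 1 + 4 * κ) * P) + 1936 * X := by rw [e]; ring
          _ ≤ _ := by nlinarith [mul_pos hC hX0]

lemma exists_lintegral_sqfShort_le (hRH : RiemannHypothesis) {σ ε κ : ℝ} (hσ : 1 / 4 < σ)
    (hσ' : σ < 1 / 2) (hε : 0 < ε) (hεσ : ε < σ) (hκ : 0 < κ) (hκ1 : κ ≤ 1) :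
    ∃ C : ℝ, 0 < C ∧ ∀ X H : ℝ, 1 ≤ X → 0 < H → H ≤ X →
      ∫⁻ x in Ioc X (2 * X), ENNReal.ofReal ((sqfShort x H - 6 * H / Real.pi ^ 2) ^ 2) ≤
        ENNReal.ofReal (C * (X ^ (2 * σ + 1 + 4 * κ) * (H / X) ^ (2 * σ - 2 * ε) + X)) := by
  obtain ⟨C, hC, h⟩ := exists_lintegral_sqfError_dilate_le hRH hσ hσ' hε hεσ hκ hκ1
  refine ⟨108 * C, by positivity, fun X H hX hH hHX => ?_⟩
  have hX0 : 0 < X := by linarith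
  simp only [sqfShort_sub_eq _ hH.le]
  have hB := lintegral_sub_sq_le_of_dilates measurable_sqfError hX0 hH hHX
    (B := ENNReal.ofReal (3 * C * (X ^ (2 * σ + 1 + 4 * κ) * (H / X) ^ (2 * σ - 2 * ε) + X)))
    (fun θ hθ hθ' => by
      have hHX' : H / X ≤ 1 := (div_le_one hX0).mpr hHX
      have h3 : θ ≤ 3 * (H / X) := by rw [← mul_div_assoc]; exact hθ'
      refine (h X (1 + θ) hX (by linarith) (by linarith)).trans (ENNReal.ofReal_le_ofReal ?_)
      rw [add_sub_cancel_left]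
      have h4 : θ ^ (2 * σ - 2 * ε) ≤ 3 * (H / X) ^ (2 * σ - 2 * ε) := by
        calc θ ^ (2 * σ - 2 * ε) ≤ (3 * (H / X)) ^ (2 * σ - 2 * ε) :=
              Real.rpow_le_rpow hθ.le h3 (by linarith)
          _ = 3 ^ (2 * σ - 2 * ε) * (H / X) ^ (2 * σ - 2 * ε) :=
              Real.mul_rpow (by norm_num) (by positivity)
          _ ≤ _ := by
              have : (3:ℝ) ^ (2 * σ - 2 * ε) ≤ 3 ^ (1:ℝ) :=
                Real.rpow_le_rpow_of_exponent_le (by norm_num) (by linarith)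
              rw [Real.rpow_one] at this
              gcongr
      calc _ ≤ C * (X ^ (2 * σ + 1 + 4 * κ) * (3 * (H / X) ^ (2 * σ - 2 * ε)) + 3 * X) := by
            gcongr; linarith
        _ = _ := by ring)
  refine hB.trans (le_of_eq ?_)
  rw [show (36 : ℝ≥0∞) = ENNReal.ofReal 36 by simp, ← ENNReal.ofReal_mul (by norm_num)]
  congr 1; ring

/-- The variance bound for `X ^ (1 / 5) ≤ H ≤ X`. -/
lemma exists_variance_le_of_long (hRH : RiemannHypothesis) {δ : ℝ} (hδ : 0 < δ) :
    ∃ K : ℝ, 0 < K ∧ ∀ X H : ℝ, 1 ≤ X → 1 ≤ H → H ≤ X → X ≤ H ^ 5 →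
      ∫⁻ x in Ioc X (2 * X), ENNReal.ofReal ((sqfShort x H - 6 * H / Real.pi ^ 2) ^ 2) ≤
        ENNReal.ofReal (K * X * H ^ ((1 : ℝ) / 2 + δ)) := by
  set d := min δ 1 with hd
  have hd0 : 0 < d := lt_min hδ one_pos
  have hd1 : d ≤ 1 := min_le_right _ _
  have hdδ : d ≤ δ := min_le_left _ _
  obtain ⟨C, hC, h⟩ := exists_lintegral_sqfShort_le hRH (σ := 1 / 4 + d / 8) (ε := d / 64) (κ := d / 80)
    (by linarith) (by linarith) (by linarith) (by linarith) (by linarith) (by linarith)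
  refine ⟨2 * C, by positivity, fun X H hX hH hHX hXH => ?_⟩
  have hX0 : 0 < X := by linarith
  have hH0 : 0 < H := by linarith
  refine (h X H hX hH0 hHX).trans (ENNReal.ofReal_le_ofReal ?_)
  set p := 2 * (1 / 4 + d / 8) - 2 * (d / 64) with hp
  set q := 2 * (d / 64) + 4 * (d / 80) with hq
  have e : X ^ (2 * (1 / 4 + d / 8) + 1 + 4 * (d / 80)) * (H / X) ^ p = X * (X ^ q * H ^ p) := by
    rw [Real.div_rpow hH0.le hX0.le, show 2 * (1 / 4 + d / 8) + 1 + 4 * (d / 80) = 1 + q + p by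
      rw [hp, hq]; ring, Real.rpow_add hX0, Real.rpow_add hX0, Real.rpow_one]
    field_simp
  have h1 : X ^ q * H ^ p ≤ H ^ ((1 : ℝ) / 2 + δ) := by
    calc X ^ q * H ^ p ≤ (H ^ 5) ^ q * H ^ p := by gcongr
      _ = H ^ (5 * q + p) := by
        rw [Real.rpow_add hH0, Real.rpow_mul hH0.le]; norm_cast
      _ ≤ _ := Real.rpow_le_rpow_of_exponent_le hH (by rw [hp, hq]; linarith)
  have h2 : 1 ≤ H ^ ((1 : ℝ) / 2 + δ) := Real.one_le_rpow hH (by linarith)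
  rw [e]
  calc _ ≤ C * (X * H ^ ((1 : ℝ) / 2 + δ) + X * H ^ ((1 : ℝ) / 2 + δ)) := by
        gcongr; exact le_mul_of_one_le_right hX0.le h2
    _ = _ := by ring

end LongIntervals

section ResidueCounts
open Finset

lemma abs_sum_ite_modEq_sub_le (M : ℕ) {L : ℕ} (hL : 0 < L) (c : ℕ) :
    |∑ n ∈ range M, (if n ≡ c [MOD L] then (1 : ℝ) else 0) - M / L| ≤ 1 := by
  have h1 : ∑ n ∈ range M, (if n ≡ c [MOD L] then (1 : ℝ) else 0) =
      (Nat.count (fun n => n ≡ c [MOD L]) M : ℕ) := by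
    rw [Nat.count_eq_card_filter_range, card_filter]; push_cast; rfl
  rw [h1, Nat.count_modEq_card _ hL]
  have hL' : (0 : ℝ) < L := by exact_mod_cast hL
  have h2 : (M : ℝ) / L = (M / L : ℕ) + (M % L : ℕ) / L := by
    have : (M : ℝ) = L * (M / L : ℕ) + (M % L : ℕ) := by exact_mod_cast (Nat.div_add_mod M L).symm
    rw [this]
    field_simp
  have h3 : ((M % L : ℕ) : ℝ) / L ≤ 1 := by
    rw [div_le_one hL']; exact_mod_cast (Nat.mod_lt M hL).le
  have h4 : 0 ≤ ((M % L : ℕ) : ℝ) / L := by positivity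
  rw [h2, abs_le]
  split_ifs <;> push_cast <;> constructor <;> linarith

lemma abs_sum_ite_dvd_and_dvd_sub_le (M : ℕ) {p q : ℕ} (hp : 0 < p) (hq : 0 < q) (a b : ℕ) :
    |∑ n ∈ range M, (if p ∣ n + a then (1 : ℝ) else 0) * (if q ∣ n + b then 1 else 0) -
      M / (p * q) * (p.gcd q * if a ≡ b [MOD p.gcd q] then 1 else 0)| ≤ 1 := by
  have hg : 0 < p.gcd q := Nat.gcd_pos_of_pos_left _ hp
  by_cases h : a ≡ b [MOD p.gcd q]
  · have hex : ∃ k, p ∣ k + a ∧ q ∣ k + b := by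
      have hab : (p - 1) * a ≡ (q - 1) * b [MOD p.gcd q] := by
        refine Nat.ModEq.add_right_cancel h ?_
        have e1 : (p - 1) * a + a = p * a := by
          rw [← Nat.succ_mul, Nat.succ_eq_add_one, Nat.sub_add_cancel hp]
        have e2 : (q - 1) * b + b = q * b := by
          rw [← Nat.succ_mul, Nat.succ_eq_add_one, Nat.sub_add_cancel hq]
        rw [e1, e2]
        exact ((Nat.modEq_zero_iff_dvd.mpr ((Nat.gcd_dvd_left p q).mul_right a))).trans
          (Nat.modEq_zero_iff_dvd.mpr ((Nat.gcd_dvd_right p q).mul_right b)).symm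
      obtain ⟨k, hk1, hk2⟩ := Nat.chineseRemainder' hab
      refine ⟨k, ?_, ?_⟩
      · rw [← Nat.modEq_zero_iff_dvd]
        refine (hk1.add_right a).trans ?_
        rw [← Nat.succ_mul, Nat.succ_eq_add_one, Nat.sub_add_cancel hp]
        exact Nat.modEq_zero_iff_dvd.mpr (dvd_mul_right _ _)
      · rw [← Nat.modEq_zero_iff_dvd]
        refine (hk2.add_right b).trans ?_
        rw [← Nat.succ_mul, Nat.succ_eq_add_one, Nat.sub_add_cancel hq]
        exact Nat.modEq_zero_iff_dvd.mpr (dvd_mul_right _ _)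
    obtain ⟨k, hk1, hk2⟩ := hex
    have hiff : ∀ n, (p ∣ n + a ∧ q ∣ n + b) ↔ n ≡ k [MOD p.lcm q] := by
      intro n
      have aux : ∀ r c, r ∣ k + c → (r ∣ n + c ↔ n ≡ k [MOD r]) := by
        intro r c hr
        rw [← Nat.modEq_zero_iff_dvd] at hr ⊢
        exact ⟨fun h => Nat.ModEq.add_right_cancel' c (h.trans hr.symm),
          fun h => (h.add_right c).trans hr⟩
      rw [aux p a hk1, aux q b hk2, Nat.modEq_iff_dvd, Nat.modEq_iff_dvd, Nat.modEq_iff_dvd,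
        ← Int.coe_lcm_dvd_iff]
      rfl
    have hL : 0 < p.lcm q := Nat.lcm_pos hp hq
    have := abs_sum_ite_modEq_sub_le M hL k
    have e : ∑ n ∈ range M, (if p ∣ n + a then (1 : ℝ) else 0) * (if q ∣ n + b then 1 else 0) =
        ∑ n ∈ range M, (if n ≡ k [MOD p.lcm q] then (1 : ℝ) else 0) := by
      refine sum_congr rfl fun n _ => ?_
      rw [ite_zero_mul_ite_zero, mul_one]
      exact if_congr (hiff n) rfl rfl
    have e2 : (M : ℝ) / (p.lcm q : ℕ) = M / (p * q) * (p.gcd q * 1) := by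
      have : ((p.gcd q : ℕ) : ℝ) * (p.lcm q : ℕ) = p * q := by exact_mod_cast Nat.gcd_mul_lcm p q
      rw [← this]
      have : (0 : ℝ) < p.lcm q := by exact_mod_cast hL
      have : (0 : ℝ) < p.gcd q := by exact_mod_cast hg
      field_simp
    rw [if_pos h, e, ← e2]
    exact this
  · rw [if_neg h, mul_zero, mul_zero, sub_zero, sum_eq_zero, abs_zero]
    · exact zero_le_one
    · intro n _
      rw [ite_zero_mul_ite_zero]
      refine if_neg fun hn => h ?_
      have h1 := (Nat.modEq_zero_iff_dvd.mpr ((Nat.gcd_dvd_left p q).trans hn.1))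
      have h2 := (Nat.modEq_zero_iff_dvd.mpr ((Nat.gcd_dvd_right p q).trans hn.2))
      exact Nat.ModEq.add_left_cancel' n (h1.trans h2.symm)

lemma abs_sum_mul_sub_inv_sub_le (M : ℕ) {p q : ℕ} (hp : 0 < p) (hq : 0 < q) (a b : ℕ) :
    |∑ n ∈ range M, ((if p ∣ n + a then (1 : ℝ) else 0) - 1 / p) *
        ((if q ∣ n + b then 1 else 0) - 1 / q) -
      M / (p * q) * ((p.gcd q * if a ≡ b [MOD p.gcd q] then 1 else 0) - 1)| ≤ 3 := by
  have h1 := abs_sum_ite_dvd_and_dvd_sub_le M hp hq a b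
  have h2 := abs_sum_ite_dvd_and_dvd_sub_le M hp one_pos a b
  have h3 := abs_sum_ite_dvd_and_dvd_sub_le M one_pos hq a b
  simp only [isUnit_one, IsUnit.dvd, if_true, mul_one, Nat.cast_one, Nat.gcd_one_right,
    Nat.gcd_one_left, Nat.modEq_one, one_mul] at h2 h3
  set A := ∑ n ∈ range M, (if p ∣ n + a then (1 : ℝ) else 0)
  set B := ∑ n ∈ range M, (if q ∣ n + b then (1 : ℝ) else 0)
  set C := ∑ n ∈ range M, (if p ∣ n + a then (1 : ℝ) else 0) * (if q ∣ n + b then 1 else 0)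
  have e : ∑ n ∈ range M, ((if p ∣ n + a then (1 : ℝ) else 0) - 1 / p) *
      ((if q ∣ n + b then 1 else 0) - 1 / q) = C - A / q - B / p + M / (p * q) := by
    simp only [sub_mul, mul_sub, sum_sub_distrib]
    rw [← sum_mul, ← mul_sum, sum_const, card_range, nsmul_eq_mul]
    ring
  have hp' : (1 : ℝ) ≤ p := by exact_mod_cast hp
  have hq' : (1 : ℝ) ≤ q := by exact_mod_cast hq
  have h4 : |(A - M / p) / q| ≤ 1 := by
    rw [abs_div, Nat.abs_cast, div_le_one (by linarith)]; linarith
  have h5 : |(B - M / q) / p| ≤ 1 := by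
    rw [abs_div, Nat.abs_cast, div_le_one (by linarith)]; linarith
  rw [e, show C - A / q - B / p + M / (p * q) -
    M / (p * q) * ((p.gcd q * if a ≡ b [MOD p.gcd q] then 1 else 0) - 1) =
    (C - M / (p * q) * (p.gcd q * if a ≡ b [MOD p.gcd q] then 1 else 0)) - (A - M / p) / q -
      (B - M / q) / p by field_simp; ring]
  rw [abs_le] at *
  constructor <;> linarith [h1.1, h1.2]

lemma sum_sum_ite_modEq_sub (h : ℕ) {g : ℕ} (hg : 0 < g) :
    ∑ i ∈ range h, ∑ j ∈ range h, ((g : ℝ) * (if i ≡ j [MOD g] then 1 else 0) - 1) =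
      g * (h % g : ℕ) - ((h % g : ℕ) : ℝ) ^ 2 := by
  have h1 : ∀ i, ∑ j ∈ range h, (if i ≡ j [MOD g] then (1 : ℝ) else 0) =
      (h / g : ℕ) + if i % g < h % g then (1 : ℝ) else 0 := by
    intro i
    have := Nat.count_modEq_card h hg i
    rw [Nat.count_eq_card_filter_range, card_filter] at this
    have h' := congrArg (fun n : ℕ => (n : ℝ)) this
    push_cast at h'
    rw [← h']
    exact sum_congr rfl fun j _ => if_congr ⟨fun h => h.symm, fun h => h.symm⟩ rfl rfl
  have h2 : ∀ k r, r ≤ g → ∑ i ∈ range (g * k + r), (if i % g < h % g then (1 : ℝ) else 0) =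
      k * (h % g : ℕ) + (min r (h % g) : ℕ) := by
    have h0 : ∀ r, r ≤ g → ∑ i ∈ range r, (if i % g < h % g then (1 : ℝ) else 0) =
        (min r (h % g) : ℕ) := by
      intro r hr
      have : ∀ i ∈ range r, (if i % g < h % g then (1 : ℝ) else 0) = if i < h % g then 1 else 0 := by
        intro i hi
        rw [Nat.mod_eq_of_lt ((mem_range.mp hi).trans_le hr)]
      rw [sum_congr rfl this, sum_boole]
      congr 1
      rw [← card_range (min r (h % g))]
      congr 1
      ext i
      simp
    intro k
    induction k with
    | zero => intro r hr; simpa using h0 r hr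
    | succ k ih =>
      intro r hr
      have hsplit : g * (k + 1) + r = (g * k + g) + r := by ring
      rw [hsplit, sum_range_add, ih g le_rfl]
      have : ∀ i ∈ range r, (if (g * k + g + i) % g < h % g then (1 : ℝ) else 0) =
          if i % g < h % g then 1 else 0 := by
        intro i _
        rw [show g * k + g + i = i + g * (k + 1) by ring, Nat.add_mul_mod_self_left]
      rw [sum_congr rfl this, h0 r hr, min_eq_right (Nat.mod_lt h hg).le]
      push_cast
      ring
  have h3 := h2 (h / g) (h % g) (Nat.mod_lt h hg).le
  rw [Nat.div_add_mod, min_self] at h3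
  simp only [sum_sub_distrib, ← mul_sum, h1, sum_add_distrib, h3, sum_const, card_range,
    nsmul_eq_mul, mul_one]
  have h4 : (h : ℝ) = g * (h / g : ℕ) + (h % g : ℕ) := by exact_mod_cast (Nat.div_add_mod h g).symm
  generalize ((h / g : ℕ) : ℝ) = k at *
  generalize ((h % g : ℕ) : ℝ) = r at *
  rw [h4]
  ring

/-- The deviation of the number of multiples of `q` in `(n, n + h]` from its mean. -/
noncomputable def multipleError (h q n : ℕ) : ℝ :=
  ∑ i ∈ range h, ((if q ∣ n + (i + 1) then (1 : ℝ) else 0) - 1 / q)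

lemma abs_sum_multipleError_mul_le (M h : ℕ) {p q : ℕ} (hp : 0 < p) (hq : 0 < q) :
    |∑ n ∈ range M, multipleError h p n * multipleError h q n| ≤
      M / (p * q) * (p.gcd q * min (p.gcd q : ℝ) h) + 3 * h ^ 2 := by
  have hg : 0 < p.gcd q := Nat.gcd_pos_of_pos_left _ hp
  have e1 : ∑ n ∈ range M, multipleError h p n * multipleError h q n =
      ∑ i ∈ range h, ∑ j ∈ range h, ∑ n ∈ range M,
        ((if p ∣ n + (i + 1) then (1 : ℝ) else 0) - 1 / p) *
        ((if q ∣ n + (j + 1) then 1 else 0) - 1 / q) := by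
    simp only [multipleError, sum_mul_sum]
    rw [sum_comm]
    exact sum_congr rfl fun i _ => sum_comm
  have e2 : ∑ i ∈ range h, ∑ j ∈ range h, (M : ℝ) / (p * q) *
      ((p.gcd q * if i + 1 ≡ j + 1 [MOD p.gcd q] then 1 else 0) - 1) =
      M / (p * q) * (p.gcd q * (h % p.gcd q : ℕ) - ((h % p.gcd q : ℕ) : ℝ) ^ 2) := by
    rw [← sum_sum_ite_modEq_sub h hg]
    simp only [mul_sum]
    refine sum_congr rfl fun i _ => sum_congr rfl fun j _ => ?_
    have : (i + 1 ≡ j + 1 [MOD p.gcd q]) ↔ (i ≡ j [MOD p.gcd q]) :=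
      ⟨fun h => Nat.ModEq.add_right_cancel' 1 h, fun h => h.add_right 1⟩
    rw [if_congr this rfl rfl]
  have h3 : |∑ n ∈ range M, multipleError h p n * multipleError h q n -
      M / (p * q) * (p.gcd q * (h % p.gcd q : ℕ) - ((h % p.gcd q : ℕ) : ℝ) ^ 2)| ≤ 3 * h ^ 2 := by
    rw [e1, ← e2, ← sum_sub_distrib]
    simp only [← sum_sub_distrib]
    calc _ ≤ ∑ i ∈ range h, ∑ j ∈ range h, (3 : ℝ) := by
          refine (abs_sum_le_sum_abs _ _).trans (sum_le_sum fun i _ => ?_)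
          refine (abs_sum_le_sum_abs _ _).trans (sum_le_sum fun j _ => ?_)
          exact abs_sum_mul_sub_inv_sub_le M hp hq (i + 1) (j + 1)
      _ = 3 * h ^ 2 := by simp; ring
  have hr1 : ((h % p.gcd q : ℕ) : ℝ) ≤ p.gcd q := by exact_mod_cast (Nat.mod_lt h hg).le
  have hr2 : ((h % p.gcd q : ℕ) : ℝ) ≤ h := by exact_mod_cast Nat.mod_le h _
  have hr0 : (0 : ℝ) ≤ (h % p.gcd q : ℕ) := Nat.cast_nonneg _
  have h4 : |(M : ℝ) / (p * q) * (p.gcd q * (h % p.gcd q : ℕ) - ((h % p.gcd q : ℕ) : ℝ) ^ 2)| ≤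
      M / (p * q) * (p.gcd q * min (p.gcd q : ℝ) h) := by
    rw [abs_mul, abs_of_nonneg (by positivity : (0 : ℝ) ≤ M / (p * q))]
    refine mul_le_mul_of_nonneg_left ?_ (by positivity)
    rw [abs_of_nonneg (by nlinarith)]
    have := le_min hr1 hr2
    nlinarith
  rw [abs_le] at *
  constructor <;> linarith [h3.1, h3.2, h4.1, h4.2]

end ResidueCounts

section GcdSums
open Finset
open scoped ArithmeticFunction.Moebius

lemma sum_sum_gcd_div_sq_le {S : Finset ℕ} {D : ℕ} (hS : ∀ d ∈ S, 0 < d ∧ d ≤ D) {F : ℕ → ℝ}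
    (hF : ∀ g, 0 ≤ F g) :
    ∑ d ∈ S, ∑ e ∈ S, F (d.gcd e) / ((d : ℝ) ^ 2 * (e : ℝ) ^ 2) ≤
      ∑ g ∈ Ioc 0 D, F g * (∑ d ∈ S with g ∣ d, ((d : ℝ) ^ 2)⁻¹) ^ 2 := by
  have e1 : ∀ g, F g * (∑ d ∈ S with g ∣ d, ((d : ℝ) ^ 2)⁻¹) ^ 2 = ∑ d ∈ S, ∑ e ∈ S,
      if g ∣ d ∧ g ∣ e then F g / ((d : ℝ) ^ 2 * (e : ℝ) ^ 2) else 0 := by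
    intro g
    rw [sum_filter, sq, sum_mul_sum, mul_sum]
    refine sum_congr rfl fun d _ => ?_
    rw [mul_sum]
    refine sum_congr rfl fun e _ => ?_
    rw [ite_zero_mul_ite_zero, mul_ite, mul_zero, ← mul_inv, div_eq_mul_inv]
  simp only [e1]
  conv_rhs => rw [sum_comm]
  refine sum_le_sum fun d hd => ?_
  conv_rhs => rw [sum_comm]
  refine sum_le_sum fun e _ => ?_
  have hm : d.gcd e ∈ Ioc 0 D := mem_Ioc.mpr ⟨Nat.gcd_pos_of_pos_left _ (hS d hd).1,
    (Nat.gcd_le_left _ (hS d hd).1).trans (hS d hd).2⟩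
  refine le_trans ?_ (single_le_sum (f := fun g => if g ∣ d ∧ g ∣ e then
    F g / ((d : ℝ) ^ 2 * (e : ℝ) ^ 2) else 0) (fun g _ => ?_) hm)
  · rw [if_pos ⟨Nat.gcd_dvd_left _ _, Nat.gcd_dvd_right _ _⟩]
  · have := hF g
    split_ifs <;> positivity

lemma sum_multiples_inv_sq_le (z D : ℕ) {g : ℕ} (hg : 0 < g) :
    ∑ d ∈ Ioc z D with g ∣ d, ((d : ℝ) ^ 2)⁻¹ ≤ 2 / ((g : ℝ) ^ 2 * ((z / g : ℕ) + 1)) := by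
  have e1 : (Ioc z D).filter (fun d => g ∣ d) = (Ioo (z / g) (D / g + 1)).image (fun e => g * e) := by
    ext d
    simp only [mem_filter, mem_Ioc, mem_image, mem_Ioo]
    constructor
    · rintro ⟨⟨h1, h2⟩, e, rfl⟩
      refine ⟨e, ⟨?_, ?_⟩, rfl⟩
      · rw [Nat.div_lt_iff_lt_mul hg, mul_comm]; exact h1
      · rw [Nat.lt_succ_iff, Nat.le_div_iff_mul_le hg, mul_comm]; exact h2
    · rintro ⟨e, ⟨h1, h2⟩, rfl⟩
      rw [Nat.div_lt_iff_lt_mul hg, mul_comm] at h1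
      rw [Nat.lt_succ_iff, Nat.le_div_iff_mul_le hg, mul_comm] at h2
      exact ⟨⟨h1, h2⟩, dvd_mul_right _ _⟩
  rw [e1, sum_image (fun a _ b _ hab => Nat.eq_of_mul_eq_mul_left hg hab)]
  have h1 := sum_Ioo_inv_sq_le (α := ℝ) (z / g) (D / g + 1)
  calc _ = ((g : ℝ) ^ 2)⁻¹ * ∑ i ∈ Ioo (z / g) (D / g + 1), ((i : ℝ) ^ 2)⁻¹ := by
        rw [mul_sum]
        refine sum_congr rfl fun e _ => ?_
        push_cast
        rw [mul_pow, mul_inv]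
    _ ≤ ((g : ℝ) ^ 2)⁻¹ * (2 / ((z / g : ℕ) + 1)) := by gcongr
    _ = _ := by rw [← div_div, div_eq_inv_mul, div_eq_inv_mul]; ring

lemma sum_min_one_div_sq_le (D : ℕ) {Y : ℝ} (hY : 0 ≤ Y) :
    ∑ g ∈ Ioc 0 D, min 1 (Y ^ 2 / (g : ℝ) ^ 2) ≤ 3 * Y := by
  set k := ⌊Y⌋₊
  have hk : (k : ℝ) ≤ Y := Nat.floor_le hY
  have hk' : Y < k + 1 := Nat.lt_floor_add_one Y
  calc ∑ g ∈ Ioc 0 D, min 1 (Y ^ 2 / (g : ℝ) ^ 2)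
      ≤ ∑ g ∈ Ioc 0 (max D k), min 1 (Y ^ 2 / (g : ℝ) ^ 2) := by
        refine sum_le_sum_of_subset_of_nonneg (Ioc_subset_Ioc_right (le_max_left _ _)) ?_
        intro g _ _
        positivity
    _ = ∑ g ∈ Ioc 0 k, min 1 (Y ^ 2 / (g : ℝ) ^ 2) +
        ∑ g ∈ Ioc k (max D k), min 1 (Y ^ 2 / (g : ℝ) ^ 2) := by
        rw [← sum_union (Ioc_disjoint_Ioc_of_le le_rfl),
          Ioc_union_Ioc_eq_Ioc (Nat.zero_le _) (le_max_right _ _)]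
    _ ≤ ∑ g ∈ Ioc 0 k, (1 : ℝ) + ∑ g ∈ Ioo k (max D k + 1), Y ^ 2 * ((g : ℝ) ^ 2)⁻¹ := by
        refine add_le_add (sum_le_sum fun g _ => min_le_left _ _) ?_
        refine (sum_le_sum fun g _ => min_le_right _ _).trans (le_of_eq ?_)
        refine sum_congr ?_ fun g _ => div_eq_mul_inv _ _
        ext g; simp
    _ ≤ Y + Y ^ 2 * (2 / (k + 1)) := by
        rw [← mul_sum]
        have := sum_Ioo_inv_sq_le (α := ℝ) k (max D k + 1)
        simp only [sum_const, Nat.card_Ioc, nsmul_eq_mul, mul_one, Nat.sub_zero]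
        gcongr
    _ ≤ 3 * Y := by
        have : Y ^ 2 * (2 / (k + 1)) ≤ 2 * Y := by
          rw [mul_div_assoc', div_le_iff₀ (by positivity)]
          nlinarith
        linarith

lemma sum_sq_card_sq_dvd_le (z D N : ℕ) (hz : 0 < z) :
    ∑ m ∈ Ioc 0 N, (∑ d ∈ Ioc z D, if d ^ 2 ∣ m then (1 : ℝ) else 0) ^ 2 ≤ 12 * N / z := by
  have hz' : (0 : ℝ) < z := by exact_mod_cast hz
  have e1 : ∑ m ∈ Ioc 0 N, (∑ d ∈ Ioc z D, if d ^ 2 ∣ m then (1 : ℝ) else 0) ^ 2 =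
      ∑ d ∈ Ioc z D, ∑ e ∈ Ioc z D, ((N / (d ^ 2).lcm (e ^ 2) : ℕ) : ℝ) := by
    simp only [sq (∑ _ ∈ _, _), sum_mul_sum]
    rw [sum_comm]
    refine sum_congr rfl fun d _ => ?_
    rw [sum_comm]
    refine sum_congr rfl fun e _ => ?_
    rw [← Nat.Ioc_filter_dvd_card_eq_div, card_filter]
    push_cast
    refine sum_congr rfl fun m _ => ?_
    rw [ite_zero_mul_ite_zero, mul_one]
    exact if_congr (by rw [← Nat.lcm_dvd_iff]) rfl rfl
  have hS : ∀ d ∈ Ioc z D, 0 < d ∧ d ≤ D := fun d hd => by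
    rw [mem_Ioc] at hd; exact ⟨by lia, hd.2⟩
  have h2 : ∀ d ∈ Ioc z D, ∀ e ∈ Ioc z D, ((N / (d ^ 2).lcm (e ^ 2) : ℕ) : ℝ) ≤
      N * (((d.gcd e : ℕ) : ℝ) ^ 2 / ((d : ℝ) ^ 2 * (e : ℝ) ^ 2)) := by
    intro d hd e he
    have hd0 : (0 : ℝ) < d := by exact_mod_cast (hS d hd).1
    have he0 : (0 : ℝ) < e := by exact_mod_cast (hS e he).1
    refine (Nat.cast_div_le).trans (le_of_eq ?_)
    have hlcm : (((d.gcd e : ℕ) : ℝ)) ^ 2 * ((d ^ 2).lcm (e ^ 2) : ℕ) = (d : ℝ) ^ 2 * (e : ℝ) ^ 2 := by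
      have := Nat.gcd_mul_lcm (d ^ 2) (e ^ 2)
      rw [Nat.pow_gcd_pow] at this
      exact_mod_cast this
    have hl0 : (0 : ℝ) < ((d ^ 2).lcm (e ^ 2) : ℕ) := by
      exact_mod_cast Nat.lcm_pos (pow_pos (hS d hd).1 2) (pow_pos (hS e he).1 2)
    have hg0 : (0 : ℝ) < (d.gcd e : ℕ) := by
      exact_mod_cast Nat.gcd_pos_of_pos_left _ (hS d hd).1
    rw [← hlcm]
    field_simp
  rw [e1]
  calc _ ≤ ∑ d ∈ Ioc z D, ∑ e ∈ Ioc z D,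
        N * (((d.gcd e : ℕ) : ℝ) ^ 2 / ((d : ℝ) ^ 2 * (e : ℝ) ^ 2)) :=
        sum_le_sum fun d hd => sum_le_sum fun e he => h2 d hd e he
    _ = N * ∑ d ∈ Ioc z D, ∑ e ∈ Ioc z D, ((d.gcd e : ℕ) : ℝ) ^ 2 / ((d : ℝ) ^ 2 * (e : ℝ) ^ 2) := by
        simp only [mul_sum]
    _ ≤ N * ∑ g ∈ Ioc 0 D, (g : ℝ) ^ 2 * (∑ d ∈ Ioc z D with g ∣ d, ((d : ℝ) ^ 2)⁻¹) ^ 2 := by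
        gcongr
        exact sum_sum_gcd_div_sq_le hS (F := fun g => (g : ℝ) ^ 2) fun g => sq_nonneg _
    _ ≤ N * ∑ g ∈ Ioc 0 D, 4 / (z : ℝ) ^ 2 * min 1 ((z : ℝ) ^ 2 / (g : ℝ) ^ 2) := by
        refine mul_le_mul_of_nonneg_left (sum_le_sum fun g hg => ?_) (Nat.cast_nonneg _)
        have hg' : 0 < g := (mem_Ioc.mp hg).1
        have hg0 : (0 : ℝ) < g := by exact_mod_cast hg'
        have h3 := sum_multiples_inv_sq_le z D hg'
        have hP : 0 ≤ ∑ d ∈ Ioc z D with g ∣ d, ((d : ℝ) ^ 2)⁻¹ := sum_nonneg fun d _ => by positivity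
        have hq : (z : ℝ) ≤ g * ((z / g : ℕ) + 1) := by
          have : z < g * (z / g + 1) := Nat.lt_mul_div_succ z hg'
          exact_mod_cast this.le
        have hq0 : (0 : ℝ) ≤ (z / g : ℕ) := Nat.cast_nonneg _
        rw [mul_min_of_nonneg _ _ (by positivity), le_min_iff]
        constructor
        · calc _ ≤ (g : ℝ) ^ 2 * (2 / ((g : ℝ) ^ 2 * ((z / g : ℕ) + 1))) ^ 2 := by gcongr
            _ = 4 / (g * ((z / g : ℕ) + 1)) ^ 2 := by field_simp; norm_num
            _ ≤ 4 / (z : ℝ) ^ 2 := by gcongr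
            _ = _ := by ring
        · calc _ ≤ (g : ℝ) ^ 2 * (2 / ((g : ℝ) ^ 2 * ((z / g : ℕ) + 1))) ^ 2 := by gcongr
            _ ≤ (g : ℝ) ^ 2 * (2 / ((g : ℝ) ^ 2 * (0 + 1))) ^ 2 := by gcongr
            _ = _ := by field_simp; norm_num
    _ = N * (4 / (z : ℝ) ^ 2 * ∑ g ∈ Ioc 0 D, min 1 ((z : ℝ) ^ 2 / (g : ℝ) ^ 2)) := by rw [← mul_sum]
    _ ≤ N * (4 / (z : ℝ) ^ 2 * (3 * z)) := by
        gcongr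
        exact sum_min_one_div_sq_le D hz'.le
    _ = _ := by field_simp; ring

lemma sum_sq_sum_moebius_mul_multipleError_le (M h z : ℕ) :
    ∑ n ∈ range M, (∑ d ∈ Ioc 0 z, (μ d : ℝ) * multipleError h (d ^ 2) n) ^ 2 ≤
      12 * M * √h + 3 * h ^ 2 * z ^ 2 := by
  have hS : ∀ d ∈ Ioc 0 z, 0 < d ∧ d ≤ z := fun d hd => mem_Ioc.mp hd
  have hmu : ∀ d : ℕ, |(μ d : ℝ)| ≤ 1 := fun d => by
    exact_mod_cast ArithmeticFunction.abs_moebius_le_one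
  have e1 : ∑ n ∈ range M, (∑ d ∈ Ioc 0 z, (μ d : ℝ) * multipleError h (d ^ 2) n) ^ 2 =
      ∑ d ∈ Ioc 0 z, ∑ e ∈ Ioc 0 z, (μ d : ℝ) * (μ e : ℝ) *
        ∑ n ∈ range M, multipleError h (d ^ 2) n * multipleError h (e ^ 2) n := by
    simp only [sq (∑ _ ∈ _, _), sum_mul_sum]
    rw [sum_comm]
    refine sum_congr rfl fun d _ => ?_
    rw [sum_comm]
    refine sum_congr rfl fun e _ => ?_
    rw [mul_sum]
    exact sum_congr rfl fun n _ => by ring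
  set F : ℕ → ℝ := fun g => (g : ℝ) ^ 2 * min ((g : ℝ) ^ 2) h with hF
  have hF0 : ∀ g, 0 ≤ F g := fun g => by rw [hF]; positivity
  rw [e1]
  calc _ ≤ ∑ d ∈ Ioc 0 z, ∑ e ∈ Ioc 0 z,
        ((M : ℝ) * (F (d.gcd e) / ((d : ℝ) ^ 2 * (e : ℝ) ^ 2)) + 3 * h ^ 2) := by
        refine sum_le_sum fun d hd => sum_le_sum fun e he => ?_
        have := abs_sum_multipleError_mul_le M h (pow_pos (hS d hd).1 2) (pow_pos (hS e he).1 2)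
        rw [Nat.pow_gcd_pow] at this
        refine (le_abs_self _).trans ?_
        rw [abs_mul, abs_mul]
        refine (mul_le_of_le_one_left (abs_nonneg _) (mul_le_one₀ (hmu d) (abs_nonneg _) (hmu e))).trans
          (this.trans (le_of_eq ?_))
        push_cast
        rw [hF]
        ring
    _ = M * ∑ d ∈ Ioc 0 z, ∑ e ∈ Ioc 0 z, F (d.gcd e) / ((d : ℝ) ^ 2 * (e : ℝ) ^ 2) +
        3 * h ^ 2 * z ^ 2 := by
        simp only [sum_add_distrib, ← mul_sum, sum_const, Nat.card_Ioc, nsmul_eq_mul, Nat.sub_zero]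
        ring
    _ ≤ M * ∑ g ∈ Ioc 0 z, F g * (∑ d ∈ Ioc 0 z with g ∣ d, ((d : ℝ) ^ 2)⁻¹) ^ 2 +
        3 * h ^ 2 * z ^ 2 := by
        exact add_le_add_left (mul_le_mul_of_nonneg_left (sum_sum_gcd_div_sq_le hS hF0)
          (Nat.cast_nonneg _)) _
    _ ≤ M * ∑ g ∈ Ioc 0 z, 4 * min 1 (√h ^ 2 / (g : ℝ) ^ 2) + 3 * h ^ 2 * z ^ 2 := by
        refine add_le_add_left (mul_le_mul_of_nonneg_left (sum_le_sum fun g hg => ?_)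
          (Nat.cast_nonneg _)) _
        have hg' : 0 < g := (mem_Ioc.mp hg).1
        have hg0 : (0 : ℝ) < g := by exact_mod_cast hg'
        have h3 := sum_multiples_inv_sq_le 0 z hg'
        simp only [Nat.zero_div, Nat.cast_zero, zero_add, mul_one] at h3
        have hP : 0 ≤ ∑ d ∈ Ioc 0 z with g ∣ d, ((d : ℝ) ^ 2)⁻¹ := sum_nonneg fun d _ => by positivity
        have hFg := hF0 g
        calc _ ≤ F g * (2 / (g : ℝ) ^ 2) ^ 2 := by gcongr
          _ = 4 * (min ((g : ℝ) ^ 2) h / (g : ℝ) ^ 2) := by rw [hF]; field_simp; norm_num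
          _ = _ := by
            rw [Real.sq_sqrt (Nat.cast_nonneg _), ← min_div_div_right (by positivity),
              div_self (by positivity)]
    _ = M * (4 * ∑ g ∈ Ioc 0 z, min 1 (√h ^ 2 / (g : ℝ) ^ 2)) + 3 * h ^ 2 * z ^ 2 := by rw [← mul_sum]
    _ ≤ M * (4 * (3 * √h)) + 3 * h ^ 2 * z ^ 2 := by
        gcongr
        exact sum_min_one_div_sq_le z (Real.sqrt_nonneg _)
    _ = _ := by ring

end GcdSums

section ShortIntervals
open Finset
open scoped ArithmeticFunction.Moebius ENNReal

lemma sum_sq_sum_range_sum_le (M h : ℕ) {a : ℕ → ℝ} :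
    ∑ n ∈ range M, (∑ i ∈ range h, a (n + (i + 1))) ^ 2 ≤
      h ^ 2 * ∑ m ∈ Ioc 0 (M + h), a m ^ 2 := by
  calc _ ≤ ∑ n ∈ range M, (h : ℝ) * ∑ i ∈ range h, a (n + (i + 1)) ^ 2 := by
        refine sum_le_sum fun n _ => ?_
        simpa using sq_sum_le_card_mul_sum_sq (s := range h) (f := fun i => a (n + (i + 1)))
    _ = h * ∑ i ∈ range h, ∑ n ∈ range M, a (n + (i + 1)) ^ 2 := by rw [← mul_sum, sum_comm]
    _ ≤ h * ∑ i ∈ range h, ∑ m ∈ Ioc 0 (M + h), a m ^ 2 := by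
        refine mul_le_mul_of_nonneg_left (sum_le_sum fun i hi => ?_) (Nat.cast_nonneg _)
        rw [← sum_image (f := fun m => a m ^ 2) (g := fun n => n + (i + 1)) (fun x _ y _ hxy => by
          simpa using hxy)]
        refine sum_le_sum_of_subset_of_nonneg (fun m hm => ?_) fun _ _ _ => sq_nonneg _
        obtain ⟨n, hn, rfl⟩ := mem_image.mp hm
        rw [mem_range] at hn hi
        exact mem_Ioc.mpr ⟨by lia, by lia⟩
    _ = _ := by simp; ring

lemma sum_sq_sum_squarefree_sub_le {h M : ℕ} (hh : 1 ≤ h) (hM : h ^ 5 ≤ M) :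
    ∑ n ∈ range M, (∑ i ∈ range h, (if Squarefree (n + (i + 1)) then (1 : ℝ) else 0) -
      6 * h / Real.pi ^ 2) ^ 2 ≤ 147 * M * √h := by
  set s := Nat.sqrt h + 1 with hs
  set z := h * s with hz
  set D := M + h + z with hD
  have hh1 : (1 : ℝ) ≤ h := by exact_mod_cast hh
  have hr : √(h : ℝ) ^ 2 = h := Real.sq_sqrt (Nat.cast_nonneg _)
  have hr1 : 1 ≤ √(h : ℝ) := by rw [Real.one_le_sqrt]; exact hh1
  have hs1 : √(h : ℝ) ≤ s := by
    refine Real.sqrt_le_iff.mpr ⟨Nat.cast_nonneg _, ?_⟩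
    exact_mod_cast (Nat.lt_succ_sqrt' h).le
  have hs2 : (s : ℝ) ≤ 2 * √h := by
    have : ((Nat.sqrt h : ℕ) : ℝ) ≤ √h := Real.nat_sqrt_le_real_sqrt
    rw [hs]; push_cast; linarith
  have hs0 : 0 < s := Nat.succ_pos _
  have hz0 : 0 < z := Nat.mul_pos hh hs0
  have hs0' : (0 : ℝ) < s := by exact_mod_cast hs0
  have hzc : (z : ℝ) = h * s := by rw [hz]; push_cast; rfl
  have hMh : (h : ℝ) ≤ M := by
    have : h ≤ M := (Nat.le_self_pow (by norm_num) h).trans hM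
    exact_mod_cast this
  have hMc : (h : ℝ) ^ 5 ≤ M := by exact_mod_cast hM
  set a : ℕ → ℝ := fun m => ∑ d ∈ Ioc z D, if d ^ 2 ∣ m then (1 : ℝ) else 0 with ha
  set A : ℕ → ℝ := fun n => ∑ d ∈ Ioc 0 z, (μ d : ℝ) * multipleError h (d ^ 2) n with hA
  set B : ℕ → ℝ := fun n => ∑ i ∈ range h, a (n + (i + 1)) with hB
  have hmu : ∀ d : ℕ, |(μ d : ℝ)| ≤ 1 := fun d => by
    exact_mod_cast ArithmeticFunction.abs_moebius_le_one
  have key : ∀ n ∈ range M, (∑ i ∈ range h, (if Squarefree (n + (i + 1)) then (1 : ℝ) else 0) -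
      6 * h / Real.pi ^ 2) ^ 2 ≤ 3 * A n ^ 2 + 3 * B n ^ 2 + 3 := by
    intro n hn
    rw [mem_range] at hn
    have e1 : ∀ i ∈ range h, (if Squarefree (n + (i + 1)) then (1 : ℝ) else 0) =
        ∑ d ∈ Ioc 0 z, (μ d : ℝ) * (if d ^ 2 ∣ n + (i + 1) then 1 else 0) +
        ∑ d ∈ Ioc z D, (μ d : ℝ) * (if d ^ 2 ∣ n + (i + 1) then 1 else 0) := by
      intro i hi
      rw [mem_range] at hi
      have h1 := sum_moebius_of_sq_dvd (n := n + (i + 1)) (N := D) (by lia)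
        ((show n + (i + 1) ≤ D by lia).trans (Nat.le_self_pow (by norm_num) D))
      have h2 := congrArg (fun z : ℤ => (z : ℝ)) h1
      simp only [sum_filter] at h2
      push_cast at h2
      rw [← sum_union (Ioc_disjoint_Ioc_of_le le_rfl), Ioc_union_Ioc_eq_Ioc (Nat.zero_le _)
        (by lia : z ≤ D), ← h2]
      refine sum_congr ?_ fun d _ => ?_
      · ext; simp [Nat.succ_le_iff]
      · split_ifs <;> simp
    have e2 : A n = ∑ i ∈ range h, ∑ d ∈ Ioc 0 z, (μ d : ℝ) * (if d ^ 2 ∣ n + (i + 1) then 1 else 0) -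
        h * ∑ d ∈ Ioc 0 z, (μ d : ℝ) / (d : ℝ) ^ 2 := by
      simp only [hA, multipleError, sum_sub_distrib, mul_sub, sum_const, card_range, nsmul_eq_mul]
      rw [sum_comm, mul_sum]
      congr 1
      · exact sum_congr rfl fun d _ => mul_sum _ _ _
      · refine sum_congr rfl fun d _ => ?_
        push_cast
        ring
    have e3 : |∑ i ∈ range h, ∑ d ∈ Ioc z D, (μ d : ℝ) * (if d ^ 2 ∣ n + (i + 1) then 1 else 0)| ≤
        B n := by
      refine (abs_sum_le_sum_abs _ _).trans (sum_le_sum fun i _ => ?_)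
      refine (abs_sum_le_sum_abs _ _).trans (sum_le_sum fun d _ => ?_)
      rw [abs_mul]
      refine (mul_le_of_le_one_left (abs_nonneg _) (hmu d)).trans ?_
      split_ifs <;> simp
    have e4 : |(h : ℝ) * (6 / Real.pi ^ 2 - ∑ d ∈ Ioc 0 z, (μ d : ℝ) / (d : ℝ) ^ 2)| ≤ 1 := by
      have := abs_sub_sum_moebius_div_sq_le (N := z) hz0
      rw [show Icc 1 z = Ioc 0 z by ext; simp [Nat.succ_le_iff]] at this
      rw [abs_mul, Nat.abs_cast]
      have hs1' : (1 : ℝ) ≤ s := by exact_mod_cast hs0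
      calc _ ≤ (h : ℝ) * (1 / z) := by gcongr
        _ = 1 / s := by rw [hzc]; field_simp
        _ ≤ 1 := by rw [div_le_one hs0']; exact hs1'
    rw [sum_congr rfl e1, sum_add_distrib]
    set P := ∑ i ∈ range h, ∑ d ∈ Ioc 0 z, (μ d : ℝ) * (if d ^ 2 ∣ n + (i + 1) then 1 else 0)
    set Q := ∑ i ∈ range h, ∑ d ∈ Ioc z D, (μ d : ℝ) * (if d ^ 2 ∣ n + (i + 1) then 1 else 0)
    set R := (h : ℝ) * (6 / Real.pi ^ 2 - ∑ d ∈ Ioc 0 z, (μ d : ℝ) / (d : ℝ) ^ 2) with hR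
    have e5 : P + Q - 6 * h / Real.pi ^ 2 = A n + Q - R := by
      rw [e2, hR]; ring
    have hQ : Q ^ 2 ≤ B n ^ 2 := sq_le_sq' (by linarith [(abs_le.mp e3).1]) (abs_le.mp e3).2
    have hR2 : R ^ 2 ≤ 1 := (sq_le_one_iff_abs_le_one R).mpr e4
    rw [e5]
    nlinarith [sq_nonneg (A n - Q), sq_nonneg (A n + R), sq_nonneg (Q + R)]
  have hA2 := sum_sq_sum_moebius_mul_multipleError_le M h z
  have hB2 := (sum_sq_sum_range_sum_le M h (a := a)).trans
    (mul_le_mul_of_nonneg_left (sum_sq_card_sq_dvd_le z D (M + h) hz0) (sq_nonneg _))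
  have hz2 : 3 * (h : ℝ) ^ 2 * z ^ 2 ≤ 12 * M := by
    calc 3 * (h : ℝ) ^ 2 * z ^ 2 = 3 * (h : ℝ) ^ 4 * s ^ 2 := by rw [hzc]; ring
      _ ≤ 3 * (h : ℝ) ^ 4 * (2 * √h) ^ 2 := by gcongr
      _ = 12 * (h : ℝ) ^ 5 := by rw [mul_pow, hr]; ring
      _ ≤ 12 * M := by gcongr
  have hB3 : (h : ℝ) ^ 2 * (12 * (M + h : ℕ) / z) ≤ 24 * M * √h := by
    push_cast
    calc (h : ℝ) ^ 2 * (12 * (M + h) / z) ≤ (h : ℝ) ^ 2 * (12 * (M + M) / (h * √h)) := by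
          rw [hzc]; gcongr
      _ = 24 * M * (√h ^ 2 / √h) := by rw [hr]; field_simp; ring
      _ = 24 * M * √h := by field_simp
  have hM1 : (M : ℝ) ≤ M * √h := le_mul_of_one_le_right (Nat.cast_nonneg _) hr1
  calc _ ≤ ∑ n ∈ range M, (3 * A n ^ 2 + 3 * B n ^ 2 + 3) := sum_le_sum key
    _ = 3 * ∑ n ∈ range M, A n ^ 2 + 3 * ∑ n ∈ range M, B n ^ 2 + 3 * M := by
      rw [sum_add_distrib, sum_add_distrib, mul_sum, mul_sum]
      simp [mul_comm]
    _ ≤ 147 * M * √h := by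
      have := hB2.trans hB3
      linarith

lemma sum_Ioc_add_eq_sum_range (f : ℕ → ℝ) (n h : ℕ) :
    ∑ m ∈ Ioc n (n + h), f m = ∑ i ∈ range h, f (n + (i + 1)) := by
  induction h with
  | zero => simp
  | succ h ih => rw [← add_assoc, sum_Ioc_succ_top (by lia), ih, sum_range_succ]; rfl

lemma abs_sqfShort_sub_floor_le {x H : ℝ} (hx : 0 ≤ x) (hH : 0 ≤ H) :
    |(sqfShort x H - 6 * H / Real.pi ^ 2) -
      (∑ i ∈ range ⌊H⌋₊, (if Squarefree (⌊x⌋₊ + (i + 1)) then (1 : ℝ) else 0) -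
        6 * ⌊H⌋₊ / Real.pi ^ 2)| ≤ 1 := by
  have h1 := Nat.floor_le hx
  have h2 := Nat.floor_le hH
  have h3 := Nat.lt_floor_add_one x
  have h4 := Nat.lt_floor_add_one H
  have hpi : 6 / Real.pi ^ 2 ≤ 1 := by
    rw [div_le_one (by positivity)]
    nlinarith [Real.pi_gt_three]
  have hpi0 : 0 ≤ 6 / Real.pi ^ 2 := by positivity
  have e1 : 6 * H / Real.pi ^ 2 - 6 * ⌊H⌋₊ / Real.pi ^ 2 = 6 / Real.pi ^ 2 * (H - ⌊H⌋₊) := by ring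
  have e2 : 0 ≤ 6 / Real.pi ^ 2 * (H - ⌊H⌋₊) := mul_nonneg hpi0 (by linarith)
  have e3 : 6 / Real.pi ^ 2 * (H - ⌊H⌋₊) ≤ 1 := mul_le_one₀ hpi (by linarith) (by linarith)
  have h5 : ⌊x⌋₊ + ⌊H⌋₊ ≤ ⌊x + H⌋₊ := Nat.le_floor (by push_cast; linarith)
  have h6 : ⌊x + H⌋₊ < ⌊x⌋₊ + ⌊H⌋₊ + 2 := (Nat.floor_lt (by positivity)).mpr (by
    push_cast; linarith)
  rw [← sum_Ioc_add_eq_sum_range (fun m => if Squarefree m then (1 : ℝ) else 0), sqfShort]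
  have h7 : ⌊x + H⌋₊ = ⌊x⌋₊ + ⌊H⌋₊ ∨ ⌊x + H⌋₊ = ⌊x⌋₊ + ⌊H⌋₊ + 1 := by lia
  rcases h7 with h7 | h7
  · rw [h7, abs_le]
    constructor <;> linarith
  · rw [h7, sum_Ioc_succ_top (by lia), abs_le]
    split_ifs <;> constructor <;> linarith

lemma lintegral_le_sum_range_floor {X : ℝ} (hX : 0 ≤ X) {f : ℝ → ℝ≥0∞} {c : ℕ → ℝ≥0∞}
    (hf : ∀ x, X < x → f x ≤ c ⌊x⌋₊) :
    ∫⁻ x in Set.Ioc X (2 * X), f x ≤ ∑ n ∈ range (⌊2 * X⌋₊ + 1), c n := by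
  calc ∫⁻ x in Set.Ioc X (2 * X), f x
      ≤ ∫⁻ x in Set.Ioc X (2 * X), ∑ n ∈ range (⌊2 * X⌋₊ + 1),
          (Set.Ico (n : ℝ) (n + 1)).indicator (fun _ => c n) x := by
        refine setLIntegral_mono' measurableSet_Ioc fun x hx => ?_
        have hx0 : 0 ≤ x := hX.trans hx.1.le
        refine (hf x hx.1).trans ?_
        have hm : ⌊x⌋₊ ∈ range (⌊2 * X⌋₊ + 1) :=
          mem_range.mpr (Nat.lt_succ_of_le (Nat.floor_le_floor hx.2))
        refine le_trans (le_of_eq ?_) (single_le_sum (f := fun n : ℕ =>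
          (Set.Ico (n : ℝ) (n + 1)).indicator (fun _ => c n) x) (fun _ _ => zero_le) hm)
        exact (Set.indicator_of_mem (show x ∈ Set.Ico ((⌊x⌋₊ : ℕ) : ℝ) ((⌊x⌋₊ : ℕ) + 1) from
          ⟨Nat.floor_le hx0, Nat.lt_floor_add_one x⟩) (fun _ => c ⌊x⌋₊)).symm
    _ ≤ ∫⁻ x, ∑ n ∈ range (⌊2 * X⌋₊ + 1),
          (Set.Ico (n : ℝ) (n + 1)).indicator (fun _ => c n) x := setLIntegral_le_lintegral _ _
    _ = ∑ n ∈ range (⌊2 * X⌋₊ + 1), c n := by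
        rw [lintegral_finsetSum _ fun n _ => measurable_const.indicator measurableSet_Ico]
        refine sum_congr rfl fun n _ => ?_
        rw [lintegral_indicator_const measurableSet_Ico, Real.volume_Ico]
        simp

lemma exists_variance_le_of_short : ∃ K : ℝ, 0 < K ∧ ∀ X H : ℝ, 1 ≤ X → 1 ≤ H → H ^ 5 ≤ X →
    ∫⁻ x in Set.Ioc X (2 * X), ENNReal.ofReal ((sqfShort x H - 6 * H / Real.pi ^ 2) ^ 2) ≤
      ENNReal.ofReal (K * X * H ^ ((1 : ℝ) / 2)) := by
  refine ⟨888, by norm_num, fun X H hX hH hHX => ?_⟩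
  set N : ℕ → ℝ := fun n =>
    ∑ i ∈ range ⌊H⌋₊, (if Squarefree (n + (i + 1)) then (1 : ℝ) else 0) -
      6 * ⌊H⌋₊ / Real.pi ^ 2 with hN
  have hH0 : 0 ≤ H := by linarith
  have h1 := lintegral_le_sum_range_floor (by linarith : 0 ≤ X)
    (f := fun x => ENNReal.ofReal ((sqfShort x H - 6 * H / Real.pi ^ 2) ^ 2))
    (c := fun n => ENNReal.ofReal (2 * N n ^ 2 + 2)) (fun x hx => by
      refine ENNReal.ofReal_le_ofReal ?_
      have := abs_sqfShort_sub_floor_le (by linarith : 0 ≤ x) hH0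
      have h2 := (sq_le_one_iff_abs_le_one _).mpr this
      simp only [hN]
      set u := sqfShort x H - 6 * H / Real.pi ^ 2
      set v := ∑ i ∈ range ⌊H⌋₊, (if Squarefree (⌊x⌋₊ + (i + 1)) then (1 : ℝ) else 0) -
        6 * ⌊H⌋₊ / Real.pi ^ 2
      nlinarith [sq_nonneg (u - 2 * v)])
  refine h1.trans ?_
  rw [← ENNReal.ofReal_sum_of_nonneg fun n _ => by positivity]
  refine ENNReal.ofReal_le_ofReal ?_
  set M := ⌊2 * X⌋₊ + 1 with hMdef
  have hM2 : (M : ℝ) ≤ 3 * X := by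
    have := Nat.floor_le (by linarith : 0 ≤ 2 * X)
    rw [hMdef]; push_cast; linarith
  have hM1 : 2 * X ≤ (M : ℝ) := by
    have := Nat.lt_floor_add_one (2 * X)
    rw [hMdef]; push_cast; linarith
  have hfl := Nat.floor_le hH0
  have hM5 : ⌊H⌋₊ ^ 5 ≤ M := by
    have : ((⌊H⌋₊ : ℕ) : ℝ) ^ 5 ≤ M := by
      calc _ ≤ H ^ 5 := by gcongr
        _ ≤ M := by linarith
    exact_mod_cast this
  have h2 := sum_sq_sum_squarefree_sub_le (Nat.one_le_floor_iff H |>.mpr hH) hM5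
  have h3 : √(⌊H⌋₊ : ℝ) ≤ H ^ ((1 : ℝ) / 2) := by
    rw [← Real.sqrt_eq_rpow]; exact Real.sqrt_le_sqrt hfl
  have h4 : 1 ≤ H ^ ((1 : ℝ) / 2) := Real.one_le_rpow hH (by norm_num)
  calc ∑ n ∈ range M, (2 * N n ^ 2 + 2) = 2 * ∑ n ∈ range M, N n ^ 2 + 2 * M := by
        rw [sum_add_distrib, mul_sum]; simp [mul_comm]
    _ ≤ 2 * (147 * M * H ^ ((1 : ℝ) / 2)) + 2 * M * H ^ ((1 : ℝ) / 2) := by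
        have h5 : 147 * (M : ℝ) * √(⌊H⌋₊ : ℝ) ≤ 147 * M * H ^ ((1 : ℝ) / 2) := by gcongr
        have h6 : 2 * (M : ℝ) ≤ 2 * M * H ^ ((1 : ℝ) / 2) :=
          le_mul_of_one_le_right (by positivity) h4
        have := h2.trans h5
        linarith
    _ = 296 * M * H ^ ((1 : ℝ) / 2) := by ring
    _ ≤ 296 * (3 * X) * H ^ ((1 : ℝ) / 2) := by gcongr
    _ = _ := by ring

end ShortIntervals

theorem RH_implies_variance_upper_bound (hRH : RiemannHypothesis) :
    ∀ ε : ℝ, ε ∈ Set.Ioo (0 : ℝ) (1 / 100) →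
      ∀ δ : ℝ, 0 < δ →
        ∃ K : ℝ, 0 < K ∧
          ∀ X H : ℝ, 1 ≤ X → 1 ≤ H → H ≤ X ^ (1 - ε : ℝ) →
            (1 / X) * (∫ x in X..(2 * X), |sqfShort x H - 6 * H / Real.pi ^ 2| ^ 2)
              ≤ K * H ^ ((1 : ℝ) / 2 + δ) := by
  intro ε hε δ hδ
  obtain ⟨K₁, hK₁, h₁⟩ := exists_variance_le_of_long hRH hδ
  obtain ⟨K₂, hK₂, h₂⟩ := exists_variance_le_of_short
  refine ⟨max K₁ K₂, lt_max_of_lt_left hK₁, fun X H hX hH hHX => ?_⟩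
  have hX0 : 0 < X := by linarith
  have hH0 : 0 < H := by linarith
  have hHX' : H ≤ X := hHX.trans <| by
    simpa using Real.rpow_le_rpow_of_exponent_le hX (by linarith [hε.1] : 1 - ε ≤ 1)
  have hmeas : Measurable fun x => (sqfShort x H - 6 * H / Real.pi ^ 2) ^ 2 := by
    simp only [sqfShort_sub_eq _ hH0.le]
    exact ((measurable_sqfError.comp (measurable_add_const H)).sub measurable_sqfError).pow_const 2
  have hl : ∫⁻ x in Set.Ioc X (2 * X), ENNReal.ofReal ((sqfShort x H - 6 * H / Real.pi ^ 2) ^ 2) ≤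
      ENNReal.ofReal (max K₁ K₂ * X * H ^ ((1 : ℝ) / 2 + δ)) := by
    rcases le_total X (H ^ 5) with h5 | h5
    · refine (h₁ X H hX hH hHX' h5).trans (ENNReal.ofReal_le_ofReal ?_)
      gcongr
      exact le_max_left _ _
    · refine (h₂ X H hX hH h5).trans (ENNReal.ofReal_le_ofReal ?_)
      gcongr
      · exact le_max_right _ _
      · linarith
  have hintg : ∫ x in X..(2 * X), |sqfShort x H - 6 * H / Real.pi ^ 2| ^ 2 ≤
      max K₁ K₂ * X * H ^ ((1 : ℝ) / 2 + δ) := by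
    simp only [sq_abs]
    rw [intervalIntegral.integral_of_le (by linarith),
      integral_eq_lintegral_of_nonneg_ae (Filter.Eventually.of_forall fun x => sq_nonneg _)
        hmeas.aestronglyMeasurable]
    exact ENNReal.toReal_le_of_le_ofReal (by positivity) hl
  calc _ ≤ 1 / X * (max K₁ K₂ * X * H ^ ((1 : ℝ) / 2 + δ)) := by gcongr
    _ = _ := by field_simp
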